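/- Let n ≥ 2, T > 0, K > 0, and let g be a smooth time-dependent metric on ℝ^n over [0,T] solving the Ricci flow such that g(t) is complete for every t ∈ [0,T]. If R(x,0) ≥ −K for every x ∈ ℝ^n, then R(x,t) ≥ −n/(2t + n/K) for every x ∈ ℝ^n and t ∈ [0,T]. -/

import Mathlib

open Set MeasureTheory
open scoped BigOperators Matrix

noncomputable section

variable {n : ℕ}

/-- Partial derivative of `f` at `x` in the `i`-th coordinate direction. -/
def pd (f : (Fin n → ℝ) → ℝ) (i : Fin n) (x : Fin n → ℝ) : ℝ :=
  fderiv ℝ f x (Pi.single i 1)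

/-- Christoffel symbols `Γ^k_{ij}` of a (time-independent) metric `G`. -/
def christoffel (G : (Fin n → ℝ) → Matrix (Fin n) (Fin n) ℝ)
    (x : Fin n → ℝ) (k i j : Fin n) : ℝ :=
  (1/2) * ∑ l, (G x)⁻¹ k l *
    (pd (fun y => G y j l) i x + pd (fun y => G y i l) j x - pd (fun y => G y i j) l x)

/-- Ricci tensor `R_{jk}`. -/
def ricci (G : (Fin n → ℝ) → Matrix (Fin n) (Fin n) ℝ)
    (x : Fin n → ℝ) (j k : Fin n) : ℝ :=
  ∑ i, (pd (fun y => christoffel G y i j k) i x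
      - pd (fun y => christoffel G y i i k) j x
      + ∑ p, (christoffel G x i i p * christoffel G x p j k
            - christoffel G x i j p * christoffel G x p i k))

/-- Scalar curvature. -/
def scalarCurv (G : (Fin n → ℝ) → Matrix (Fin n) (Fin n) ℝ) (x : Fin n → ℝ) : ℝ :=
  ∑ j, ∑ k, (G x)⁻¹ j k * ricci G x j k

/-- Riemann tensor `R_{ijkl}`. -/
def riemann (G : (Fin n → ℝ) → Matrix (Fin n) (Fin n) ℝ)
    (x : Fin n → ℝ) (i j k l : Fin n) : ℝ :=
  ∑ m, G x l m *
    (pd (fun y => christoffel G y m j k) i x - pd (fun y => christoffel G y m i k) j x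
      + ∑ p, (christoffel G x m i p * christoffel G x p j k
            - christoffel G x m j p * christoffel G x p i k))

/-- Norm of the Riemann tensor. -/
def riemNorm (G : (Fin n → ℝ) → Matrix (Fin n) (Fin n) ℝ) (x : Fin n → ℝ) : ℝ :=
  Real.sqrt (∑ i, ∑ j, ∑ k, ∑ l, ∑ a, ∑ b, ∑ c, ∑ d,
    (G x)⁻¹ i a * (G x)⁻¹ j b * (G x)⁻¹ k c * (G x)⁻¹ l d *
      riemann G x i j k l * riemann G x a b c d)

/-- Sectional curvature of the plane spanned by `u`, `v`. -/
def sectionalCurv (G : (Fin n → ℝ) → Matrix (Fin n) (Fin n) ℝ)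
    (x : Fin n → ℝ) (u v : Fin n → ℝ) : ℝ :=
  (∑ i, ∑ j, ∑ k, ∑ l, riemann G x i j k l * u i * v j * v k * u l) /
    ((∑ i, ∑ j, G x i j * u i * u j) * (∑ i, ∑ j, G x i j * v i * v j)
      - (∑ i, ∑ j, G x i j * u i * v j) ^ 2)

/-- Length of a path with respect to the metric `G`. -/
def pathLength (G : (Fin n → ℝ) → Matrix (Fin n) (Fin n) ℝ)
    (γ : ℝ → (Fin n → ℝ)) : ℝ :=
  ∫ s in (0:ℝ)..1, Real.sqrt (∑ i, ∑ j, G (γ s) i j * deriv γ s i * deriv γ s j)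

/-- Riemannian distance: infimum of lengths of C¹ paths. -/
def riemDist (G : (Fin n → ℝ) → Matrix (Fin n) (Fin n) ℝ)
    (x y : Fin n → ℝ) : ℝ :=
  sInf {L : ℝ | ∃ γ : ℝ → (Fin n → ℝ),
    ContDiffOn ℝ 1 γ (Icc 0 1) ∧ γ 0 = x ∧ γ 1 = y ∧ L = pathLength G γ}

/-- Metric ball. -/
def rBall (G : (Fin n → ℝ) → Matrix (Fin n) (Fin n) ℝ)
    (x₀ : Fin n → ℝ) (r : ℝ) : Set (Fin n → ℝ) :=
  {x | riemDist G x₀ x < r}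

/-- Completeness of `(ℝⁿ, riemDist G)`. -/
def riemComplete (G : (Fin n → ℝ) → Matrix (Fin n) (Fin n) ℝ) : Prop :=
  ∀ u : ℕ → (Fin n → ℝ),
    (∀ ε > (0:ℝ), ∃ N, ∀ p ≥ N, ∀ q ≥ N, riemDist G (u p) (u q) < ε) →
    ∃ x, ∀ ε > (0:ℝ), ∃ N, ∀ p ≥ N, riemDist G (u p) x < ε

/-- Riemannian volume of a set. -/
def riemVol (G : (Fin n → ℝ) → Matrix (Fin n) (Fin n) ℝ)
    (S : Set (Fin n → ℝ)) : ℝ :=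
  ∫ x in S, Real.sqrt ((G x).det)

/-- A smooth (time-independent) Riemannian metric. -/
def SmoothMetric (G : (Fin n → ℝ) → Matrix (Fin n) (Fin n) ℝ) : Prop :=
  (∀ i j, ContDiff ℝ (⊤ : ℕ∞) (fun x => G x i j)) ∧ ∀ x, (G x).IsSymm ∧ (G x).PosDef

/-- A smooth time-dependent metric over the time interval `I`. -/
def SmoothMetricFamily (g : (Fin n → ℝ) → ℝ → Matrix (Fin n) (Fin n) ℝ)
    (I : Set ℝ) : Prop :=
  (∀ i j, ContDiffOn ℝ (⊤ : ℕ∞) (fun p : (Fin n → ℝ) × ℝ => g p.1 p.2 i j) (univ ×ˢ I)) ∧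
  ∀ x : Fin n → ℝ, ∀ t ∈ I, (g x t).IsSymm ∧ (g x t).PosDef

/-- The Ricci flow equation `∂ₜ g = -2 Ric` over the time interval `I`. -/
def IsRicciFlow (g : (Fin n → ℝ) → ℝ → Matrix (Fin n) (Fin n) ℝ)
    (I : Set ℝ) : Prop :=
  ∀ x : Fin n → ℝ, ∀ t ∈ I, ∀ j k,
    derivWithin (fun s => g x s j k) I t = -2 * ricci (fun y => g y t) x j k

/-- `lam ≥ mu ≥ nu` are the eigenvalues of the 3×3 matrix `M`
(characterized via the characteristic polynomial). -/
def IsEigTriple (M : Matrix (Fin 3) (Fin 3) ℝ) (lam mu nu : ℝ) : Prop :=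
  nu ≤ mu ∧ mu ≤ lam ∧
  ∀ z : ℝ, (z • (1 : Matrix (Fin 3) (Fin 3) ℝ) - M).det = (z - lam) * (z - mu) * (z - nu)

/-- Hamilton's curvature operator `g^{il}(R g_{lj} - 2 R_{lj})` in dimension 3. -/
def curvOp (G : (Fin 3 → ℝ) → Matrix (Fin 3) (Fin 3) ℝ) (x : Fin 3 → ℝ) :
    Matrix (Fin 3) (Fin 3) ℝ :=
  Matrix.of fun i j => ∑ l, (G x)⁻¹ i l * (scalarCurv G x * G x l j - 2 * ricci G x l j)

section Proof

set_option maxSynthPendingDepth 3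

section RealAnalysis

/-- Linear ODEs with continuous coefficients on `[0,1]` have global solutions. -/
theorem exists_linear_ode_solution {m : ℕ} (A : ℝ → (Fin m → ℝ) →L[ℝ] (Fin m → ℝ))
    (hA : ContinuousOn A (Icc 0 1)) (y₀ : Fin m → ℝ) :
    ∃ y : ℝ → (Fin m → ℝ), y 0 = y₀ ∧
      ∀ s ∈ Icc (0:ℝ) 1, HasDerivWithinAt y (A s (y s)) (Icc 0 1) s := by
  obtain ⟨C, hC⟩ := (isCompact_Icc.image_of_continuousOn hA).isBounded.exists_norm_le
  have hC' : ∀ s ∈ Icc (0:ℝ) 1, ‖A s‖ ≤ C := fun s hs => hC _ (mem_image_of_mem _ hs)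
  have hC0 : 0 ≤ C := (norm_nonneg _).trans (hC' 0 (by simp))
  set ρ : ℝ := ‖y₀‖ * Real.exp C with hρ
  have hρ0 : 0 ≤ ρ := by positivity
  let χ : (Fin m → ℝ) → (Fin m → ℝ) := fun y i => max (-ρ) (min ρ (y i))
  have hχL : ∀ y z, ‖χ y - χ z‖ ≤ ‖y - z‖ := by
    intro y z
    refine (pi_norm_le_iff_of_nonneg (norm_nonneg _)).2 fun i => ?_
    refine le_trans ?_ (norm_le_pi_norm (y - z) i)
    simp only [χ, Pi.sub_apply, Real.norm_eq_abs]
    refine (abs_max_sub_max_le_max _ _ _ _).trans ?_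
    refine max_le (by simp) ((abs_min_sub_min_le_max _ _ _ _).trans ?_)
    exact max_le (by simp) le_rfl
  have hχb : ∀ y, ‖χ y‖ ≤ ρ := by
    intro y
    refine (pi_norm_le_iff_of_nonneg hρ0).2 fun i => ?_
    simp only [χ, Real.norm_eq_abs]
    rw [abs_le]
    exact ⟨le_max_left _ _, max_le (by linarith) (min_le_left _ _)⟩
  have hχid : ∀ y, ‖y‖ ≤ ρ → χ y = y := by
    intro y hy
    ext i
    have h1 := abs_le.1 ((norm_le_pi_norm y i).trans hy)
    simp [χ, min_eq_right h1.2, max_eq_right h1.1]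
  have hbound : ∀ s ∈ Icc (0:ℝ) 1, ∀ y, ‖A s (χ y)‖ ≤ C * ρ := fun s hs y =>
    (A s).le_of_opNorm_le_of_le (hC' s hs) (hχb y)
  have hpl : IsPicardLindelof (fun s y => A s (χ y)) (⟨0, by simp⟩ : Icc (0:ℝ) 1) y₀
      (C * ρ).toNNReal 0 (C * ρ).toNNReal C.toNNReal := by
    refine ⟨?_, ?_, ?_, ?_⟩
    · intro s hs
      refine LipschitzWith.lipschitzOnWith (LipschitzWith.of_dist_le_mul fun y z => ?_)
      rw [dist_eq_norm, dist_eq_norm, ← map_sub, Real.coe_toNNReal _ hC0]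
      exact (A s).le_of_opNorm_le_of_le (hC' s hs) (hχL y z)
    · intro y _
      exact hA.clm_apply continuousOn_const
    · intro s hs y _
      rw [Real.coe_toNNReal _ (by positivity)]
      exact hbound s hs y
    · simp
  obtain ⟨y, hy0, hy⟩ := hpl.exists_eq_forall_mem_Icc_hasDerivWithinAt₀
  refine ⟨y, hy0, fun s hs => ?_⟩
  have hcont : ContinuousOn y (Icc 0 1) := fun s hs => (hy s hs).continuousWithinAt
  have hχle : ∀ z, ‖χ z‖ ≤ ‖z‖ := by
    intro z
    have h := hχL z 0
    rwa [hχid 0 (by simpa using hρ0), sub_zero, sub_zero] at h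
  have hgr := norm_le_gronwallBound_of_norm_deriv_right_le (δ := ‖y₀‖) (K := C) (ε := 0)
    (f' := fun s => A s (χ (y s))) hcont
    (fun x hx => (hy x ⟨hx.1, hx.2.le⟩).mono_of_mem_nhdsWithin (Icc_mem_nhdsGE_of_mem hx))
    (by simpa using (congrArg norm hy0).le)
    (fun x hx => by
      rw [add_zero]
      exact (A x).le_of_opNorm_le_of_le (hC' x ⟨hx.1, hx.2.le⟩) (hχle _)) s hs
  have hle : ‖y s‖ ≤ ρ := by
    refine hgr.trans ?_
    rw [gronwallBound_ε0, hρ]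
    have : C * (s - 0) ≤ C := by nlinarith [hs.2]
    gcongr
  simpa [hχid _ hle] using hy s hs

/-- `d₁` and `d₂` are the first two derivatives at `0` of `f`. -/
def HasTwoJet (f : ℝ → ℝ) (d₁ d₂ : ℝ) : Prop :=
  ∃ d : ℝ → ℝ, (∀ᶠ r in nhds 0, HasDerivAt f (d r) r) ∧ d 0 = d₁ ∧ HasDerivAt d d₂ 0

theorem uniform_taylor_aux {P : Type*} [NormedAddCommGroup P] [NormedSpace ℝ P]
    {F : ℝ × P → ℝ} {f₁ f₂ : P → ℝ} {Z : Set P} {z₀ : P} (hF : ContDiffAt ℝ 2 F (0, z₀))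
    (hjet : ∀ z ∈ Z, HasTwoJet (fun r => F (r, z)) (f₁ z) (f₂ z)) {e : ℝ} (he : 0 < e) :
    ∃ N ∈ nhds z₀, ∃ ε > 0, ∃ B, ∀ z ∈ N, z ∈ Z → |f₁ z| ≤ B ∧ |f₂ z| ≤ B ∧
      ∀ r, |r| ≤ ε → |F (r, z) - F (0, z) - r * f₁ z - r ^ 2 / 2 * f₂ z| ≤ e * r ^ 2 := by
  set h₁ : ℝ × P → ℝ := fun p => fderiv ℝ F p (1, 0) with hh₁
  set h₂ : ℝ × P → ℝ := fun p => fderiv ℝ (fderiv ℝ F) p (1, 0) (1, 0) with hh₂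
  have hF1 : ContDiffAt ℝ 1 (fderiv ℝ F) (0, z₀) := hF.fderiv_right (by norm_num)
  have hF2 : ContinuousAt (fderiv ℝ (fderiv ℝ F)) (0, z₀) :=
    (hF1.fderiv_right (m := 0) (by norm_num)).continuousAt
  have hc1 : ContinuousAt h₁ (0, z₀) := hF1.continuousAt.clm_apply continuousAt_const
  have hc2 : ContinuousAt h₂ (0, z₀) :=
    (hF2.clm_apply continuousAt_const).clm_apply continuousAt_const
  have ev1 : ∀ᶠ p in nhds ((0:ℝ), z₀), HasDerivAt (fun r => F (r, p.2)) (h₁ p) p.1 := by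
    filter_upwards [hF.eventually (by simp)] with p hp
    have h := (hp.differentiableAt (by norm_num)).hasFDerivAt
    have h' : HasDerivAt (fun r : ℝ => (r, p.2)) ((1:ℝ), (0:P)) p.1 :=
      (hasDerivAt_id p.1).prodMk (hasDerivAt_const _ _)
    exact HasFDerivAt.comp_hasDerivAt (f := fun r : ℝ => (r, p.2)) p.1 h h'
  have ev2 : ∀ᶠ p in nhds ((0:ℝ), z₀), HasDerivAt (fun r => h₁ (r, p.2)) (h₂ p) p.1 := by
    filter_upwards [hF1.eventually (by simp)] with p hp
    have h := (hp.differentiableAt (by norm_num)).hasFDerivAt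
    have h' : HasDerivAt (fun r : ℝ => (r, p.2)) ((1:ℝ), (0:P)) p.1 :=
      (hasDerivAt_id p.1).prodMk (hasDerivAt_const _ _)
    have h3 := HasFDerivAt.comp_hasDerivAt (f := fun r : ℝ => (r, p.2)) p.1 h h'
    simpa using h3.clm_apply (hasDerivAt_const p.1 ((1:ℝ), (0:P)))
  have ev3 : ∀ᶠ p in nhds ((0:ℝ), z₀), |h₂ p - h₂ (0, z₀)| < e / 2 := by
    have := Metric.continuousAt_iff'.1 hc2 (e / 2) (by positivity)
    simpa [Real.dist_eq] using this
  have ev4 : ∀ᶠ p in nhds ((0:ℝ), z₀), |h₁ p - h₁ (0, z₀)| < 1 := by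
    have := Metric.continuousAt_iff'.1 hc1 1 one_pos
    simpa [Real.dist_eq] using this
  have ev := ev1.and (ev2.and (ev3.and ev4))
  rw [nhds_prod_eq] at ev
  obtain ⟨p, hp, q, hq, hpq⟩ := Filter.eventually_prod_iff.1 ev
  obtain ⟨ρ, hρ, hρp⟩ := Metric.eventually_nhds_iff.1 hp
  refine ⟨{z | q z}, hq, ρ / 2, by positivity,
    max (|h₁ (0, z₀)| + 1) (|h₂ (0, z₀)| + e / 2), fun z hz hzZ => ?_⟩
  have H : ∀ r, |r| ≤ ρ / 2 → HasDerivAt (fun r => F (r, z)) (h₁ (r, z)) r ∧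
      HasDerivAt (fun r => h₁ (r, z)) (h₂ (r, z)) r ∧ |h₂ (r, z) - h₂ (0, z₀)| < e / 2 ∧
      |h₁ (r, z) - h₁ (0, z₀)| < 1 := fun r hr =>
    hpq (hρp (by simpa [Real.dist_eq] using lt_of_le_of_lt hr (by linarith))) hz
  have H0 := H 0 (by simp; positivity)
  obtain ⟨d, hd, hd0, hd2⟩ := hjet z hzZ
  have hdh : d =ᶠ[nhds 0] fun r => h₁ (r, z) := by
    filter_upwards [hd, Metric.ball_mem_nhds (0:ℝ) (half_pos hρ)] with r hr hr'
    exact hr.unique (H r (by simpa [Real.dist_eq] using (Metric.mem_ball.1 hr').le)).1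
  have e1 : f₁ z = h₁ (0, z) := by rw [← hd0]; exact hdh.eq_of_nhds
  have e2 : f₂ z = h₂ (0, z) := hd2.unique (H0.2.1.congr_of_eventuallyEq hdh)
  refine ⟨?_, ?_, ?_⟩
  · rw [e1]
    refine le_max_of_le_left ?_
    have := abs_sub_abs_le_abs_sub (h₁ (0, z)) (h₁ (0, z₀))
    linarith [H0.2.2.2]
  · rw [e2]
    refine le_max_of_le_right ?_
    have := abs_sub_abs_le_abs_sub (h₂ (0, z)) (h₂ (0, z₀))
    linarith [H0.2.2.1]
  · rw [e1, e2]
    have k1 : ∀ r, |r| ≤ ρ / 2 → |h₁ (r, z) - h₁ (0, z) - r * h₂ (0, z)| ≤ e * |r| := by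
      intro r hr
      have := Convex.norm_image_sub_le_of_norm_hasDerivWithin_le
        (f := fun s => h₁ (s, z) - s * h₂ (0, z)) (f' := fun s => h₂ (s, z) - h₂ (0, z))
        (s := Icc (-(ρ / 2)) (ρ / 2)) (C := e) (x := 0) (y := r)
        (fun s hs => by
          have h := (H s (abs_le.2 hs)).2.1.fun_sub ((hasDerivAt_id s).mul_const (h₂ (0, z)))
          exact (h.congr_deriv (by ring)).hasDerivWithinAt)
        (fun s hs => by
          have a := (H s (abs_le.2 hs)).2.2.1
          have b := H0.2.2.1
          rw [Real.norm_eq_abs]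
          rw [abs_lt] at a b
          rw [abs_le]; constructor <;> linarith)
        (convex_Icc _ _) (by constructor <;> linarith) (abs_le.1 hr)
      simp only [Real.norm_eq_abs, sub_zero, zero_mul] at this
      convert this using 2
      ring
    intro r hr
    have := Convex.norm_image_sub_le_of_norm_hasDerivWithin_le
      (f := fun s => F (s, z) - s * h₁ (0, z) - s ^ 2 / 2 * h₂ (0, z))
      (f' := fun s => h₁ (s, z) - h₁ (0, z) - s * h₂ (0, z))
      (s := Icc (-|r|) (|r|)) (C := e * |r|) (x := 0) (y := r)
      (fun s hs => by
        have h := ((H s ((abs_le.2 hs).trans hr)).1.fun_sub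
          ((hasDerivAt_id s).mul_const (h₁ (0, z)))).fun_sub
          (((hasDerivAt_pow 2 s).div_const 2).mul_const (h₂ (0, z)))
        exact (h.congr_deriv (by norm_num)).hasDerivWithinAt)
      (fun s hs => by
        rw [Real.norm_eq_abs]
        refine (k1 s ((abs_le.2 hs).trans hr)).trans ?_
        have := abs_le.2 hs
        gcongr)
      (convex_Icc _ _) (by simp) ⟨neg_abs_le r, le_abs_self r⟩
    simp only [Real.norm_eq_abs, sub_zero, zero_mul] at this
    rw [mul_assoc, ← sq, sq_abs] at this
    refine le_trans (le_of_eq ?_) this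
    congr 1
    ring

/-- Second order Taylor expansion, uniformly over a compact set of parameters. -/
theorem uniform_taylor {P : Type*} [NormedAddCommGroup P] [NormedSpace ℝ P]
    {F : ℝ × P → ℝ} {f₁ f₂ : P → ℝ} {Z : Set P} (hZ : IsCompact Z)
    (hF : ∀ z ∈ Z, ContDiffAt ℝ 2 F (0, z))
    (hjet : ∀ z ∈ Z, HasTwoJet (fun r => F (r, z)) (f₁ z) (f₂ z)) {e : ℝ} (he : 0 < e) :
    ∃ ε > 0, ∃ B, ∀ z ∈ Z, |f₁ z| ≤ B ∧ |f₂ z| ≤ B ∧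
      ∀ r, |r| ≤ ε → |F (r, z) - F (0, z) - r * f₁ z - r ^ 2 / 2 * f₂ z| ≤ e * r ^ 2 := by
  have := hZ.induction_on (p := fun S => ∃ ε > 0, ∃ B, ∀ z ∈ S, z ∈ Z → |f₁ z| ≤ B ∧ |f₂ z| ≤ B ∧
      ∀ r, |r| ≤ ε → |F (r, z) - F (0, z) - r * f₁ z - r ^ 2 / 2 * f₂ z| ≤ e * r ^ 2)
    ⟨1, one_pos, 0, by simp⟩
    (fun s t hst ⟨ε, hε, B, h⟩ => ⟨ε, hε, B, fun z hz => h z (hst hz)⟩)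
    (fun s t ⟨ε, hε, B, h⟩ ⟨ε', hε', B', h'⟩ => ⟨min ε ε', lt_min hε hε', max B B', by
      rintro z (hz | hz) hzZ
      · obtain ⟨a, b, c⟩ := h z hz hzZ
        exact ⟨a.trans (le_max_left _ _), b.trans (le_max_left _ _),
          fun r hr => c r (hr.trans (min_le_left _ _))⟩
      · obtain ⟨a, b, c⟩ := h' z hz hzZ
        exact ⟨a.trans (le_max_right _ _), b.trans (le_max_right _ _),
          fun r hr => c r (hr.trans (min_le_right _ _))⟩⟩)
    (fun z hz => by
      obtain ⟨N, hN, h⟩ := uniform_taylor_aux (hF z hz) hjet he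
      exact ⟨N, mem_nhdsWithin_of_mem_nhds hN, h⟩)
  obtain ⟨ε, hε, B, h⟩ := this
  exact ⟨ε, hε, B, fun z hz => h z hz hz⟩

end RealAnalysis

section AbstractConnection

variable {E : Type*} [NormedAddCommGroup E] [NormedSpace ℝ E]

/-- The curvature operator of the connection with Christoffel map `Γ`. -/
def curvOf (Γ : E → E →L[ℝ] E →L[ℝ] E) (x a b c : E) : E :=
  fderiv ℝ Γ x a b c - fderiv ℝ Γ x b a c + Γ x a (Γ x b c) - Γ x b (Γ x a c)

/-- The covariant derivative of the curvature operator. -/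
def covCurvOf (Γ : E → E →L[ℝ] E →L[ℝ] E) (x a b c d : E) : E :=
  fderiv ℝ (fun y => curvOf Γ y b c d) x a + Γ x a (curvOf Γ x b c d)
    - curvOf Γ x (Γ x a b) c d - curvOf Γ x b (Γ x a c) d - curvOf Γ x b c (Γ x a d)

/-- `Γ` is a torsion free connection compatible with the metric `g`. -/
structure LeviCivita (g : E → E →L[ℝ] E →L[ℝ] ℝ) (Γ : E → E →L[ℝ] E →L[ℝ] E) : Prop where
  smooth_g : ContDiff ℝ (⊤ : ℕ∞) g
  smooth_Γ : ContDiff ℝ (⊤ : ℕ∞) Γ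
  g_symm : ∀ x a b, g x a b = g x b a
  Γ_symm : ∀ x a b, Γ x a b = Γ x b a
  compat : ∀ x w a b, fderiv ℝ g x w a b = g x (Γ x w a) b + g x a (Γ x w b)

variable {g : E → E →L[ℝ] E →L[ℝ] ℝ} {Γ : E → E →L[ℝ] E →L[ℝ] E}

theorem fderiv_clm_apply₂ {F H K : Type*} [NormedAddCommGroup F] [NormedSpace ℝ F]
    [NormedAddCommGroup H] [NormedSpace ℝ H] [NormedAddCommGroup K] [NormedSpace ℝ K]
    {B : E → F →L[ℝ] H →L[ℝ] K} {u : E → F} {v : E → H} {x : E}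
    (hB : DifferentiableAt ℝ B x) (hu : DifferentiableAt ℝ u x) (hv : DifferentiableAt ℝ v x)
    (w : E) :
    fderiv ℝ (fun y => B y (u y) (v y)) x w
      = fderiv ℝ B x w (u x) (v x) + B x (fderiv ℝ u x w) (v x) + B x (u x) (fderiv ℝ v x w) := by
  have h1 : HasFDerivAt (fun y => B y (u y)) _ x := hB.hasFDerivAt.clm_apply hu.hasFDerivAt
  have h2 : HasFDerivAt (fun y => B y (u y) (v y)) _ x := h1.clm_apply hv.hasFDerivAt
  rw [h2.fderiv]
  simp
  abel

theorem curvOf_antisymm (Γ : E → E →L[ℝ] E →L[ℝ] E) (x a b c : E) :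
    curvOf Γ x a b c = - curvOf Γ x b a c := by
  simp only [curvOf]; abel

theorem covCurvOf_antisymm (Γ : E → E →L[ℝ] E →L[ℝ] E) (x a b c d : E) :
    covCurvOf Γ x a b c d = - covCurvOf Γ x a c b d := by
  have s2 : ∀ x u v w, curvOf Γ x u v w = - curvOf Γ x v u w := curvOf_antisymm Γ
  unfold covCurvOf
  have h1 : (fun y => curvOf Γ y b c d) = fun y => - curvOf Γ y c b d := funext fun y => s2 y b c d
  rw [h1, s2 x b c d, s2 x (Γ x a b) c d, s2 x b (Γ x a c) d, s2 x b c (Γ x a d), fderiv_fun_neg]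
  simp only [map_neg, neg_apply]
  abel

namespace LeviCivita

variable (h : LeviCivita g Γ)
include h

theorem differentiable_g : Differentiable ℝ g := h.smooth_g.differentiable (by simp)

theorem differentiable_Γ : Differentiable ℝ Γ := h.smooth_Γ.differentiable (by simp)

theorem smooth_fderiv_Γ : ContDiff ℝ (⊤ : ℕ∞) (fderiv ℝ Γ) :=
  h.smooth_Γ.fderiv_right (by simp)

theorem differentiable_Γ_apply (a b : E) : Differentiable ℝ (fun y => Γ y a b) := fun y =>
  ((h.differentiable_Γ y).clm_apply (differentiableAt_const a)).clm_apply (differentiableAt_const b)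

theorem fderiv_Γ_apply (x w a b : E) :
    fderiv ℝ (fun y => Γ y a b) x w = fderiv ℝ Γ x w a b := by
  rw [fderiv_clm_apply₂ (h.differentiable_Γ x) (differentiableAt_const a)
    (differentiableAt_const b)]
  simp

theorem fderiv_Γ_symm (x w a b : E) : fderiv ℝ Γ x w a b = fderiv ℝ Γ x w b a := by
  rw [← h.fderiv_Γ_apply, ← h.fderiv_Γ_apply]
  simp_rw [fun y => h.Γ_symm y a b]

theorem fderiv_g_pair {u v : E → E} {x : E} (hu : DifferentiableAt ℝ u x)
    (hv : DifferentiableAt ℝ v x) (w : E) :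
    fderiv ℝ (fun y => g y (u y) (v y)) x w
      = g x (fderiv ℝ u x w + Γ x w (u x)) (v x) + g x (u x) (fderiv ℝ v x w + Γ x w (v x)) := by
  rw [fderiv_clm_apply₂ (h.differentiable_g x) hu hv, h.compat]
  simp only [map_add, add_apply]
  ring

/-- The second derivative of the metric. -/
theorem fderiv_fderiv_g (x z w a b : E) :
    fderiv ℝ (fderiv ℝ g) x z w a b
      = g x (fderiv ℝ Γ x z w a + Γ x z (Γ x w a)) b + g x (Γ x w a) (Γ x z b)
        + g x (Γ x z a) (Γ x w b) + g x a (fderiv ℝ Γ x z w b + Γ x z (Γ x w b)) := by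
  have hd : DifferentiableAt ℝ (fderiv ℝ g) x :=
    (h.smooth_g.fderiv_right (m := 1) (by norm_cast)).differentiable (by simp) x
  have h1 : fderiv ℝ (fun y => fderiv ℝ g y w a b) x z = fderiv ℝ (fderiv ℝ g) x z w a b := by
    have hw : DifferentiableAt ℝ (fun y => fderiv ℝ g y w) x :=
      hd.clm_apply (differentiableAt_const w)
    rw [fderiv_clm_apply₂ hw (differentiableAt_const a) (differentiableAt_const b)]
    rw [fderiv_clm_apply hd (differentiableAt_const w)]
    simp
  rw [← h1]
  simp_rw [h.compat]
  rw [fderiv_fun_add]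
  · rw [add_apply,
      h.fderiv_g_pair (h.differentiable_Γ_apply w a x) (differentiableAt_const b),
      h.fderiv_g_pair (differentiableAt_const a) (h.differentiable_Γ_apply w b x)]
    simp only [h.fderiv_Γ_apply, fderiv_fun_const, Pi.zero_apply, zero_apply, zero_add]
    ring
  · exact ((h.differentiable_g x).clm_apply (h.differentiable_Γ_apply w a x)).clm_apply
      (differentiableAt_const b)
  · exact ((h.differentiable_g x).clm_apply (differentiableAt_const a)).clm_apply
      (h.differentiable_Γ_apply w b x)

theorem curv_skew (x a b c d : E) :
    g x (curvOf Γ x a b c) d + g x c (curvOf Γ x a b d) = 0 := by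
  have hs : fderiv ℝ (fderiv ℝ g) x a b = fderiv ℝ (fderiv ℝ g) x b a :=
    (h.smooth_g.contDiffAt.isSymmSndFDerivAt (by simp; norm_cast)) a b
  have h1 := congrArg (fun L : E →L[ℝ] E →L[ℝ] ℝ => L c d) hs
  simp only [h.fderiv_fderiv_g] at h1
  simp only [curvOf, map_add, map_sub, add_apply,
    sub_apply] at h1 ⊢
  linarith

theorem curv_bianchi (x a b c : E) :
    curvOf Γ x a b c + curvOf Γ x b c a + curvOf Γ x c a b = 0 := by
  simp only [curvOf]
  rw [h.fderiv_Γ_symm x a c b, h.fderiv_Γ_symm x b a c, h.fderiv_Γ_symm x c b a,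
    h.Γ_symm x a c, h.Γ_symm x b a, h.Γ_symm x c b]
  abel

theorem differentiable_curv (b c d : E) : Differentiable ℝ (fun y => curvOf Γ y b c d) := by
  intro y
  have hd : DifferentiableAt ℝ (fderiv ℝ Γ) y := h.smooth_fderiv_Γ.differentiable (by simp) y
  have hG := h.differentiable_Γ y
  unfold curvOf
  have c1 : ∀ v : E, DifferentiableAt ℝ (fun _ : E => v) y := fun v => differentiableAt_const v
  exact ((((hd.clm_apply (c1 b)).clm_apply (c1 c)).clm_apply (c1 d)).sub
    (((hd.clm_apply (c1 c)).clm_apply (c1 b)).clm_apply (c1 d))).add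
    ((hG.clm_apply (c1 b)).clm_apply (h.differentiable_Γ_apply c d y)) |>.sub
    ((hG.clm_apply (c1 c)).clm_apply (h.differentiable_Γ_apply b d y))

theorem fderiv_curv (x a b c d : E) :
    fderiv ℝ (fun y => curvOf Γ y b c d) x a
      = fderiv ℝ (fderiv ℝ Γ) x a b c d - fderiv ℝ (fderiv ℝ Γ) x a c b d
        + fderiv ℝ Γ x a b (Γ x c d) + Γ x b (fderiv ℝ Γ x a c d)
        - fderiv ℝ Γ x a c (Γ x b d) - Γ x c (fderiv ℝ Γ x a b d) := by
  have hd : DifferentiableAt ℝ (fderiv ℝ Γ) x := h.smooth_fderiv_Γ.differentiable (by simp) x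
  have hG := h.differentiable_Γ x
  have c1 : ∀ v : E, DifferentiableAt ℝ (fun _ : E => v) x := fun v => differentiableAt_const v
  have d3 : ∀ b c d : E, HasFDerivAt (fun y => fderiv ℝ Γ y b c d)
      (fderiv ℝ (fun y => fderiv ℝ Γ y b c d) x) x := fun b c d =>
    (((hd.clm_apply (c1 b)).clm_apply (c1 c)).clm_apply (c1 d)).hasFDerivAt
  have d4 : ∀ b c d : E, HasFDerivAt (fun y => Γ y b (Γ y c d))
      (fderiv ℝ (fun y => Γ y b (Γ y c d)) x) x := fun b c d =>
    ((hG.clm_apply (c1 b)).clm_apply (h.differentiable_Γ_apply c d x)).hasFDerivAt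
  have e3 : ∀ b c d : E, fderiv ℝ (fun y => fderiv ℝ Γ y b c d) x a
      = fderiv ℝ (fderiv ℝ Γ) x a b c d := by
    intro b c d
    rw [fderiv_clm_apply₂ (hd.clm_apply (c1 b)) (c1 c) (c1 d), fderiv_clm_apply hd (c1 b)]
    simp
  have e4 : ∀ b c d : E, fderiv ℝ (fun y => Γ y b (Γ y c d)) x a
      = fderiv ℝ Γ x a b (Γ x c d) + Γ x b (fderiv ℝ Γ x a c d) := by
    intro b c d
    rw [fderiv_clm_apply₂ hG (c1 b) (h.differentiable_Γ_apply c d x), h.fderiv_Γ_apply]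
    simp
  have := (((d3 b c d).sub (d3 c b d)).add (d4 b c d)).sub (d4 c b d)
  have e : fderiv ℝ (fun y => curvOf Γ y b c d) x = _ := this.fderiv
  rw [e]
  simp only [sub_apply, add_apply, e3, e4]
  abel

theorem covCurv_bianchi (x a b c d : E) :
    covCurvOf Γ x a b c d + covCurvOf Γ x b c a d + covCurvOf Γ x c a b d = 0 := by
  have hs : ∀ a b, fderiv ℝ (fderiv ℝ Γ) x a b = fderiv ℝ (fderiv ℝ Γ) x b a :=
    (h.smooth_Γ.contDiffAt.isSymmSndFDerivAt (by simp; norm_cast))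
  have s1 := h.Γ_symm x
  have s2 : ∀ u v w, curvOf Γ x u v w = - curvOf Γ x v u w := curvOf_antisymm Γ x
  simp only [covCurvOf, h.fderiv_curv]
  rw [s1 b a, s1 c a, s1 c b, s2 c (Γ x a b) d, s2 a (Γ x b c) d, s2 b (Γ x a c) d]
  rw [hs b a, hs c a, hs c b]
  simp only [curvOf, map_add, map_sub]
  abel

theorem covCurv_skew (x a b c d e : E) :
    g x (covCurvOf Γ x a b c d) e + g x d (covCurvOf Γ x a b c e) = 0 := by
  have h0 : (fun y => g y (curvOf Γ y b c d) e + g y d (curvOf Γ y b c e)) = fun _ => 0 :=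
    funext fun y => h.curv_skew y b c d e
  have h1 := congrArg (fun f => fderiv ℝ f x a) h0
  rw [fderiv_fun_add, add_apply,
      h.fderiv_g_pair (h.differentiable_curv b c d x) (differentiableAt_const e),
      h.fderiv_g_pair (differentiableAt_const d) (h.differentiable_curv b c e x)] at h1
  · have k1 := h.curv_skew x (Γ x a b) c d e
    have k2 := h.curv_skew x b (Γ x a c) d e
    have k3 := h.curv_skew x b c (Γ x a d) e
    have k4 := h.curv_skew x b c d (Γ x a e)
    simp only [fderiv_fun_const, Pi.zero_apply, zero_apply, zero_add] at h1
    simp only [covCurvOf, map_add, map_sub, add_apply,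
      sub_apply] at h1 ⊢
    linarith
  · exact ((h.differentiable_g x).clm_apply (h.differentiable_curv b c d x)).clm_apply
      (differentiableAt_const e)
  · exact ((h.differentiable_g x).clm_apply (differentiableAt_const d)).clm_apply
      (h.differentiable_curv b c e x)

end LeviCivita

end AbstractConnection

section Frames

/-- Coordinate vectors. -/
abbrev Vec (n : ℕ) := Fin n → ℝ

/-- Bilinear forms on `Vec n`. -/
abbrev Bil (n : ℕ) := Vec n →L[ℝ] Vec n →L[ℝ] ℝ

/-- Bilinear maps on `Vec n` with values in `Vec n`. -/
abbrev Conn (n : ℕ) := Vec n →L[ℝ] Vec n →L[ℝ] Vec n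

variable {n : ℕ}

/-- The `i`-th coordinate vector. -/
abbrev bv (i : Fin n) : Vec n := Pi.single i 1

theorem sum_smul_bv (v : Vec n) : ∑ i, v i • bv i = v := by
  ext j
  simp [Finset.sum_apply, Pi.single_apply]

/-- The bilinear map with prescribed values on coordinate vectors, as a linear function of
these values. -/
def bilinOf {F : Type*} [NormedAddCommGroup F] [NormedSpace ℝ F] [FiniteDimensional ℝ F] :
    (Fin n → Fin n → F) →L[ℝ] (Vec n →L[ℝ] Vec n →L[ℝ] F) :=
  LinearMap.toContinuousLinearMap
    { toFun := fun B => ∑ i, ∑ j,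
        (ContinuousLinearMap.proj (R := ℝ) (φ := fun _ : Fin n => ℝ) i).smulRight
          ((ContinuousLinearMap.proj (R := ℝ) (φ := fun _ : Fin n => ℝ) j).smulRight (B i j))
      map_add' := by
        intro B C
        ext a b
        simp [Finset.sum_add_distrib]
      map_smul' := by
        intro r B
        ext a b
        simp [Finset.smul_sum, smul_comm r] }

theorem bilinOf_apply {F : Type*} [NormedAddCommGroup F] [NormedSpace ℝ F]
    [FiniteDimensional ℝ F] (B : Fin n → Fin n → F) (a b : Vec n) :
    bilinOf B a b = ∑ i, ∑ j, a i • b j • B i j := by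
  simp [bilinOf]

theorem bilinOf_bv {F : Type*} [NormedAddCommGroup F] [NormedSpace ℝ F]
    [FiniteDimensional ℝ F] (B : Fin n → Fin n → F) (i j : Fin n) :
    bilinOf B (bv i) (bv j) = B i j := by
  simp [bilinOf_apply, Pi.single_apply]

theorem bilin_expand {F : Type*} [NormedAddCommGroup F] [NormedSpace ℝ F]
    (B : Vec n →L[ℝ] Vec n →L[ℝ] F) (a b : Vec n) :
    B a b = ∑ i, ∑ j, a i • b j • B (bv i) (bv j) := by
  conv_lhs => rw [← sum_smul_bv a, ← sum_smul_bv b]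
  simp only [map_sum, map_smul, sum_apply, smul_apply, Finset.smul_sum]
  rw [Finset.sum_comm]
  exact Finset.sum_congr rfl fun i _ => Finset.sum_congr rfl fun j _ => smul_comm _ _ _

/-- The coordinate trace of an endomorphism. -/
def ctr (L : Vec n → Vec n) : ℝ := ∑ i, L (bv i) i

theorem ctr_eq_trace {L : Vec n → Vec n} (hL : IsLinearMap ℝ L) :
    ctr L = LinearMap.trace ℝ (Vec n) (hL.mk' L) := by
  rw [LinearMap.trace_eq_matrix_trace ℝ (Pi.basisFun ℝ (Fin n))]
  simp [ctr, Matrix.trace]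

theorem ctr_comp_comm (L M : Vec n →L[ℝ] Vec n) :
    ctr (fun a => L (M a)) = ctr (fun a => M (L a)) := by
  have h1 : IsLinearMap ℝ (fun a => L (M a)) := (L.comp M).toLinearMap.isLinear
  have h2 : IsLinearMap ℝ (fun a => M (L a)) := (M.comp L).toLinearMap.isLinear
  rw [ctr_eq_trace h1, ctr_eq_trace h2]
  exact LinearMap.trace_mul_comm ℝ L.toLinearMap M.toLinearMap

theorem ctr_add (L M : Vec n → Vec n) : ctr (fun a => L a + M a) = ctr L + ctr M := by
  simp [ctr, Finset.sum_add_distrib]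

theorem ctr_sub (L M : Vec n → Vec n) : ctr (fun a => L a - M a) = ctr L - ctr M := by
  simp [ctr, Finset.sum_sub_distrib]

/-- `F` is an orthonormal frame for `B`. -/
def IsFrame (B : Bil n) (F : Fin n → Vec n) : Prop :=
  ∀ i j, B (F i) (F j) = if i = j then 1 else 0

/-- The Gram matrix of a bilinear form. -/
def gram (B : Bil n) : Matrix (Fin n) (Fin n) ℝ := Matrix.of fun i j => B (bv i) (bv j)

/-- The trace of the bilinear form `S` with respect to `B`. -/
def mtr {F : Type*} [NormedAddCommGroup F] [NormedSpace ℝ F] (B : Bil n)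
    (S : Vec n →L[ℝ] Vec n →L[ℝ] F) : F :=
  ∑ j, ∑ k, (gram B)⁻¹ j k • S (bv j) (bv k)

open scoped ComplexOrder MatrixOrder Matrix.Norms.L2Operator in
theorem exists_eq_transpose_mul_self {A : Matrix (Fin n) (Fin n) ℝ} (hA : A.PosDef) :
    ∃ P : Matrix (Fin n) (Fin n) ℝ, A = Pᴴ * P :=
  CStarAlgebra.nonneg_iff_eq_star_mul_self.mp hA.posSemidef.nonneg

theorem exists_isFrame {B : Bil n} (hB : (gram B).PosDef) : ∃ F, IsFrame B F := by
  obtain ⟨P, hP⟩ := exists_eq_transpose_mul_self hB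
  have hdet : IsUnit P.det := by
    have h1 := hB.det_pos
    rw [hP, Matrix.det_mul] at h1
    refine isUnit_iff_ne_zero.2 fun h0 => ?_
    simp [h0] at h1
  have h2 : (P⁻¹)ᵀ * gram B * P⁻¹ = 1 := by
    rw [hP, Matrix.conjTranspose_eq_transpose_of_trivial, ← Matrix.mul_assoc, Matrix.mul_assoc,
      Matrix.mul_nonsing_inv _ hdet, Matrix.mul_one, ← Matrix.transpose_mul,
      Matrix.mul_nonsing_inv _ hdet, Matrix.transpose_one]
  refine ⟨fun i k => P⁻¹ k i, fun i j => ?_⟩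
  have h3 := congrFun (congrFun h2 i) j
  rw [Matrix.one_apply] at h3
  rw [← h3, bilin_expand]
  simp only [Matrix.mul_apply, Matrix.transpose_apply, gram, Matrix.of_apply, Finset.sum_mul,
    smul_eq_mul]
  rw [Finset.sum_comm]
  refine Finset.sum_congr rfl fun k _ => Finset.sum_congr rfl fun l _ => ?_
  ring

namespace IsFrame

variable {B : Bil n} {F : Fin n → Vec n}

theorem matrix_eq (hF : IsFrame B F) :
    Matrix.of F * gram B * (Matrix.of F)ᵀ = 1 := by
  ext i j
  rw [Matrix.one_apply, ← hF i j, bilin_expand]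
  simp only [Matrix.mul_apply, Matrix.transpose_apply, gram, Matrix.of_apply, Finset.sum_mul,
    smul_eq_mul]
  rw [Finset.sum_comm]
  refine Finset.sum_congr rfl fun k _ => Finset.sum_congr rfl fun l _ => ?_
  ring

theorem gram_inv (hF : IsFrame B F) : (gram B)⁻¹ = (Matrix.of F)ᵀ * Matrix.of F := by
  have h1 := hF.matrix_eq
  rw [Matrix.mul_assoc] at h1
  have h2 := mul_eq_one_comm.1 h1
  rw [Matrix.mul_assoc] at h2
  exact Matrix.inv_eq_right_inv h2

theorem gram_mul_inv (hF : IsFrame B F) : gram B * (gram B)⁻¹ = 1 := by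
  have h1 := hF.matrix_eq
  rw [Matrix.mul_assoc] at h1
  have h2 := mul_eq_one_comm.1 h1
  rw [Matrix.mul_assoc] at h2
  rw [hF.gram_inv, h2]

theorem expand (hF : IsFrame B F) (v : Vec n) : ∑ k, B v (F k) • F k = v := by
  have h1 := hF.gram_mul_inv
  rw [hF.gram_inv] at h1
  ext j
  have h2 : ∀ i, ∑ k, B (bv i) (F k) * F k j = if i = j then 1 else 0 := by
    intro i
    have h3 := congrFun (congrFun h1 i) j
    rw [Matrix.one_apply] at h3
    rw [← h3, ← Matrix.mul_assoc]
    simp only [Matrix.mul_apply, Matrix.transpose_apply, Matrix.of_apply]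
    refine Finset.sum_congr rfl fun k _ => ?_
    congr 1
    conv_lhs => rw [← sum_smul_bv (F k)]
    simp [gram, mul_comm]
  conv_lhs => rw [← sum_smul_bv v]
  simp only [map_sum, map_smul, sum_apply, smul_apply, Finset.sum_apply, Pi.smul_apply,
    smul_eq_mul, Finset.sum_mul]
  rw [Finset.sum_comm]
  simp only [mul_assoc, ← Finset.mul_sum, h2]
  simp

theorem sum_mul_apply (hF : IsFrame B F) {W : Type*} [NormedAddCommGroup W] [NormedSpace ℝ W]
    (L : Vec n →L[ℝ] W) (v : Vec n) : ∑ k, B v (F k) • L (F k) = L v := by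
  conv_rhs => rw [← hF.expand v]
  simp

theorem mtr_eq (hF : IsFrame B F) {W : Type*} [NormedAddCommGroup W] [NormedSpace ℝ W]
    (S : Vec n →L[ℝ] Vec n →L[ℝ] W) : mtr B S = ∑ k, S (F k) (F k) := by
  simp only [mtr, hF.gram_inv, Matrix.mul_apply, Matrix.transpose_apply, Matrix.of_apply,
    Finset.sum_smul]
  simp_rw [fun k => bilin_expand S (F k) (F k), smul_smul]
  rw [Finset.sum_comm]
  simp_rw [Finset.sum_comm (s := Finset.univ) (t := Finset.univ)
    (f := fun k i => ∑ j, (F k i * F k j) • S (bv i) (bv j))]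
  rw [Finset.sum_comm]
  refine Finset.sum_congr rfl fun i _ => ?_
  rw [Finset.sum_comm]

theorem ctr_eq (hF : IsFrame B F) {L : Vec n → Vec n} (hL : IsLinearMap ℝ L) :
    ctr L = ∑ k, B (L (F k)) (F k) := by
  set M : Vec n →L[ℝ] Vec n := (hL.mk' L).toContinuousLinearMap with hM
  have hML : ∀ v, M v = L v := fun v => rfl
  have h1 : ∀ i, L (bv i) i = ∑ k, B (bv i) (F k) * M (F k) i := by
    intro i
    have := hF.sum_mul_apply M (bv i)
    rw [← hML, ← this]
    simp
  simp only [ctr, h1]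
  rw [Finset.sum_comm]
  refine Finset.sum_congr rfl fun k _ => ?_
  rw [← hML]
  conv_rhs => rw [← sum_smul_bv (M (F k))]
  simp [mul_comm]

end IsFrame

end Frames

section RicciIdentities

variable {n : ℕ}

section InverseMatrix

attribute [local instance] Matrix.linftyOpNormedRing Matrix.linftyOpNormedAlgebra

theorem hasDerivAt_inv_entry {M : ℝ → Matrix (Fin n) (Fin n) ℝ} {M' : Matrix (Fin n) (Fin n) ℝ}
    {r : ℝ} (hM : ∀ i j, HasDerivAt (fun s => M s i j) (M' i j) r) (hu : IsUnit (M r))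
    (j k : Fin n) :
    HasDerivAt (fun s => (M s)⁻¹ j k) ((-((M r)⁻¹ * M' * (M r)⁻¹)) j k) r := by
  have h1 : HasDerivAt M M' r := by
    have e : M = fun s => ∑ i, ∑ j, M s i j • Matrix.single i j (1:ℝ) := by
      funext s
      conv_lhs => rw [Matrix.matrix_eq_sum_single (M s)]
      simp
    rw [e]
    refine (HasDerivAt.fun_sum fun i _ => HasDerivAt.fun_sum fun j _ =>
      (hM i j).smul_const (Matrix.single i j (1:ℝ))).congr_deriv ?_
    conv_rhs => rw [Matrix.matrix_eq_sum_single M']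
    simp
  obtain ⟨U, hU⟩ := hu
  have h2 : HasFDerivAt Ring.inverse _ (M r) := hU ▸ hasFDerivAt_ringInverse (𝕜 := ℝ) U
  have h3 := h2.comp_hasDerivAt r h1
  have h4 := ((Matrix.entryLinearMap ℝ ℝ j k).toContinuousLinearMap).hasFDerivAt.comp_hasDerivAt
    r h3
  have e : (fun s => (M s)⁻¹ j k)
      = (Matrix.entryLinearMap ℝ ℝ j k).toContinuousLinearMap ∘ Ring.inverse ∘ M := by
    funext s
    simp [Matrix.nonsing_inv_eq_ringInverse]
  rw [e]
  refine h4.congr_deriv ?_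
  have e2 : (↑U⁻¹ : Matrix (Fin n) (Fin n) ℝ) = (M r)⁻¹ := by
    rw [← hU, Matrix.coe_units_inv]
  simp only [neg_apply, ContinuousLinearMap.mulLeftRight_apply, e2]
  rfl

end InverseMatrix

/-- The derivative of the metric trace along a curve of bilinear forms. -/
theorem IsFrame.hasDerivAt_mtr {W : Type*} [NormedAddCommGroup W] [NormedSpace ℝ W]
    {B : ℝ → Bil n} {B' : Bil n} {S : ℝ → Vec n →L[ℝ] Vec n →L[ℝ] W}
    {S' : Vec n →L[ℝ] Vec n →L[ℝ] W} {r : ℝ} {F : Fin n → Vec n} (hF : IsFrame (B r) F)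
    (hB : HasDerivAt B B' r) (hS : HasDerivAt S S' r) :
    HasDerivAt (fun s => mtr (B s) (S s))
      (∑ k, S' (F k) (F k) - ∑ k, ∑ l, B' (F k) (F l) • S r (F k) (F l)) r := by
  have hu : IsUnit (gram (B r)) := IsUnit.of_mul_eq_one _ hF.gram_mul_inv
  have hM : ∀ i j, HasDerivAt (fun s => gram (B s) i j) (gram B' i j) r := by
    intro i j
    have h1 := (hB.clm_apply (hasDerivAt_const r (bv i))).clm_apply (hasDerivAt_const r (bv j))
    simpa [gram] using h1
  have hS' : ∀ j k, HasDerivAt (fun s => S s (bv j) (bv k)) (S' (bv j) (bv k)) r := by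
    intro i j
    have h1 := (hS.clm_apply (hasDerivAt_const r (bv i))).clm_apply (hasDerivAt_const r (bv j))
    simpa using h1
  have h2 := HasDerivAt.fun_sum (u := Finset.univ) fun j _ =>
    HasDerivAt.fun_sum (u := Finset.univ) fun k _ =>
      (hasDerivAt_inv_entry hM hu j k).smul (hS' j k)
  refine h2.congr_deriv ?_
  simp only [Finset.sum_add_distrib, Matrix.neg_apply, neg_smul, Finset.sum_neg_distrib]
  rw [← sub_eq_add_neg, ← hF.mtr_eq S']
  congr 1
  have e1 : ∀ k l, B' (F k) (F l) = (Matrix.of F * gram B' * (Matrix.of F)ᵀ) k l := by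
    intro k l
    rw [bilin_expand]
    simp only [Matrix.mul_apply, Matrix.transpose_apply, gram, Matrix.of_apply, Finset.sum_mul,
      smul_eq_mul]
    rw [Finset.sum_comm]
    refine Finset.sum_congr rfl fun k _ => Finset.sum_congr rfl fun l _ => ?_
    ring
  have e2 : (gram (B r))⁻¹ * gram B' * (gram (B r))⁻¹
      = (Matrix.of F)ᵀ * (Matrix.of F * gram B' * (Matrix.of F)ᵀ) * Matrix.of F := by
    rw [hF.gram_inv]
    simp only [Matrix.mul_assoc]
  simp only [e1, e2]
  set N := Matrix.of F * gram B' * (Matrix.of F)ᵀ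
  have e3 : ∀ i j, ((Matrix.of F)ᵀ * N * Matrix.of F) i j
      = ∑ k, ∑ l, N k l * (F k i * F l j) := by
    intro i j
    simp only [Matrix.mul_apply, Matrix.transpose_apply, Matrix.of_apply, Finset.sum_mul]
    rw [Finset.sum_comm]
    refine Finset.sum_congr rfl fun k _ => Finset.sum_congr rfl fun l _ => ?_
    ring
  have e4 : ∀ k l, S r (F k) (F l) = ∑ i, ∑ j, (F k i * F l j) • S r (bv i) (bv j) := by
    intro k l
    rw [bilin_expand]
    simp only [smul_smul]
  simp only [e3, e4, Finset.sum_smul, Finset.smul_sum, smul_smul]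
  have c : ∀ f : Fin n → Fin n → Fin n → Fin n → W,
      ∑ i, ∑ j, ∑ k, ∑ l, f i j k l = ∑ k, ∑ l, ∑ i, ∑ j, f i j k l := by
    intro f
    rw [Finset.sum_congr rfl fun i _ => Finset.sum_comm, Finset.sum_comm]
    refine Finset.sum_congr rfl fun k _ => ?_
    rw [Finset.sum_congr rfl fun i _ => Finset.sum_comm, Finset.sum_comm]
  exact c _

theorem bilinOf_eq {W : Type*} [NormedAddCommGroup W] [NormedSpace ℝ W] [FiniteDimensional ℝ W]
    {T : Vec n → Vec n → W} (h₁ : ∀ c, IsLinearMap ℝ fun b => T b c)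
    (h₂ : ∀ b, IsLinearMap ℝ (T b)) (b c : Vec n) :
    bilinOf (fun j k => T (bv j) (bv k)) b c = T b c := by
  have e : T b c = ∑ j, b j • T (bv j) c := by
    calc T b c = (h₁ c).mk' _ (∑ j, b j • bv j) := by rw [sum_smul_bv]; rfl
      _ = _ := by simp
  rw [bilinOf_apply, e]
  refine Finset.sum_congr rfl fun j _ => ?_
  rw [← Finset.smul_sum]
  congr 1
  calc ∑ k, c k • T (bv j) (bv k) = (h₂ (bv j)).mk' _ (∑ k, c k • bv k) := by simp
    _ = _ := by rw [sum_smul_bv]; rfl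

/-- The Ricci form of a connection. -/
def ricOf (Γ : Vec n → Conn n) (x : Vec n) : Bil n :=
  bilinOf fun j k => ctr fun a => curvOf Γ x a (bv j) (bv k)

theorem curvOf_linear₁ (Γ : Vec n → Conn n) (x b c : Vec n) :
    IsLinearMap ℝ fun a => curvOf Γ x a b c := by
  constructor
  · intro a a'
    simp only [curvOf, map_add, add_apply]
    abel
  · intro r a
    simp only [curvOf, map_smul, smul_apply, smul_sub, smul_add]

theorem curvOf_linear₂ (Γ : Vec n → Conn n) (x a c : Vec n) :
    IsLinearMap ℝ fun b => curvOf Γ x a b c := by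
  constructor
  · intro a a'
    simp only [curvOf, map_add, add_apply]
    abel
  · intro r a
    simp only [curvOf, map_smul, smul_apply, smul_sub, smul_add]

theorem curvOf_linear₃ (Γ : Vec n → Conn n) (x a b : Vec n) :
    IsLinearMap ℝ fun c => curvOf Γ x a b c := by
  constructor
  · intro a a'
    simp only [curvOf, map_add]
    abel
  · intro r a
    simp only [curvOf, map_smul, smul_sub, smul_add]

theorem ricOf_apply (Γ : Vec n → Conn n) (x b c : Vec n) :
    ricOf Γ x b c = ctr fun a => curvOf Γ x a b c := by
  refine bilinOf_eq (T := fun b c => ctr fun a => curvOf Γ x a b c) (fun c => ?_) (fun b => ?_) b c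
  · constructor
    · intro u v
      rw [← ctr_add]
      exact congrArg ctr (funext fun a => (curvOf_linear₂ Γ x a c).map_add u v)
    · intro r u
      simp_rw [fun a => (curvOf_linear₂ Γ x a c).map_smul r u]
      simp [ctr, Finset.mul_sum]
  · constructor
    · intro u v
      rw [← ctr_add]
      exact congrArg ctr (funext fun a => (curvOf_linear₃ Γ x a b).map_add u v)
    · intro r u
      simp_rw [fun a => (curvOf_linear₃ Γ x a b).map_smul r u]
      simp [ctr, Finset.mul_sum]

theorem contDiff_bilinOf {W : Type*} [NormedAddCommGroup W] [NormedSpace ℝ W]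
    [FiniteDimensional ℝ W] {k : WithTop ℕ∞} :
    ContDiff ℝ k fun B : Fin n → Fin n → W => bilinOf B :=
  (bilinOf (n := n) (F := W)).contDiff

/-- The covariant derivative of the Ricci form. -/
def covRicOf (Γ : Vec n → Conn n) (x a b c : Vec n) : ℝ :=
  fderiv ℝ (ricOf Γ) x a b c - ricOf Γ x (Γ x a b) c - ricOf Γ x b (Γ x a c)

/-- The scalar curvature of a metric with connection `Γ`. -/
def scalOf (g : Vec n → Bil n) (Γ : Vec n → Conn n) (x : Vec n) : ℝ := mtr (g x) (ricOf Γ x)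

namespace LeviCivita

variable {g : Vec n → Bil n} {Γ : Vec n → Conn n} (h : LeviCivita g Γ)
include h

theorem differentiable_ricOf : Differentiable ℝ (ricOf Γ) := by
  intro x
  refine ((contDiff_bilinOf (k := 1)).differentiable (by simp) _).comp x ?_
  refine differentiableAt_pi.2 fun j => differentiableAt_pi.2 fun k => ?_
  unfold ctr
  refine DifferentiableAt.fun_sum fun i _ => ?_
  exact differentiableAt_pi.1 (h.differentiable_curv (bv i) (bv j) (bv k) x) i

theorem fderiv_ricOf (x a b c : Vec n) : fderiv ℝ (ricOf Γ) x a b c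
    = ctr fun v => fderiv ℝ (fun y => curvOf Γ y v b c) x a := by
  have h1 : fderiv ℝ (ricOf Γ) x a b c = fderiv ℝ (fun y => ricOf Γ y b c) x a := by
    rw [fderiv_clm_apply₂ (h.differentiable_ricOf x) (differentiableAt_const b)
      (differentiableAt_const c)]
    simp
  rw [h1]
  simp_rw [ricOf_apply, ctr]
  have hd := fun i => differentiableAt_pi.1 (h.differentiable_curv (bv i) b c x) i
  rw [fderiv_fun_sum fun i _ => hd i]
  simp only [sum_apply]
  refine Finset.sum_congr rfl fun i _ => ?_
  have := (hasFDerivAt_pi'.1 (h.differentiable_curv (bv i) b c x).hasFDerivAt i).fderiv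
  rw [this]
  rfl

theorem covCurv_linear₂ (x a c d : Vec n) : IsLinearMap ℝ fun b => covCurvOf Γ x a b c d := by
  constructor
  · intro b b'
    simp only [covCurvOf, h.fderiv_curv]
    simp only [curvOf, map_add, map_sub, add_apply]
    abel
  · intro r b
    simp only [covCurvOf, h.fderiv_curv]
    simp only [curvOf, map_add, map_sub, map_smul, smul_apply, smul_sub,
      smul_add]

theorem covRic_eq_ctr (x a b c : Vec n) :
    covRicOf Γ x a b c = ctr fun v => covCurvOf Γ x a v b c := by
  have h1 : IsLinearMap ℝ fun v => curvOf Γ x v b c := curvOf_linear₁ Γ x b c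
  have h2 := ctr_comp_comm (Γ x a) (h1.mk' _).toContinuousLinearMap
  simp only [LinearMap.coe_toContinuousLinearMap', IsLinearMap.mk'_apply] at h2
  simp only [covCurvOf, covRicOf, h.fderiv_ricOf, ricOf_apply]
  rw [ctr_sub, ctr_sub, ctr_sub, ctr_add, h2]
  ring

theorem curv_pair (x a b c d : Vec n) :
    g x (curvOf Γ x a b c) d = g x (curvOf Γ x c d a) b := by
  have B := fun a b c d => congrArg (fun v => g x v d) (h.curv_bianchi x a b c)
  have S := h.curv_skew x
  have A := fun a b c d => congrArg (fun v => g x v d) (curvOf_antisymm Γ x a b c)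
  have Y := h.g_symm x
  simp only [map_add, map_neg, map_zero, add_apply, neg_apply, zero_apply] at B A
  have S2 : ∀ a b c d, g x (curvOf Γ x a b c) d = - g x (curvOf Γ x a b d) c := by
    intro a b c d
    rw [Y (curvOf Γ x a b d) c]
    linarith [S a b c d]
  linarith [B a b c d, B b c d a, B c d a b, B d a b c, S2 b c a d, A c a b d, S2 b c d a,
    S2 d b c a, A c d b a, S2 d a c b, A a c d b, S2 a c d b, A c a b d, S2 c d a b,
    S2 d a b c, A b d a c, S2 b d a c, S2 a b d c, A d a b c, A d b c a, A d b a c, S2 c a b d]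

theorem ricOf_symm (hpos : ∀ x, (gram (g x)).PosDef) (x b c : Vec n) :
    ricOf Γ x b c = ricOf Γ x c b := by
  obtain ⟨F, hF⟩ := exists_isFrame (hpos x)
  rw [ricOf_apply, ricOf_apply, hF.ctr_eq (curvOf_linear₁ Γ x b c),
    hF.ctr_eq (curvOf_linear₁ Γ x c b)]
  refine Finset.sum_congr rfl fun k _ => ?_
  have h1 := h.curv_pair x (F k) b c (F k)
  have h2 := congrArg (fun v => g x v b) (curvOf_antisymm Γ x c (F k) (F k))
  have h3 := h.curv_skew x (F k) c (F k) b
  have h4 := h.g_symm x (F k) (curvOf Γ x (F k) c b)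
  simp only [map_neg, neg_apply] at h2
  linarith

theorem sum_curv_eq_neg_ricOf {x : Vec n} {F : Fin n → Vec n} (hF : IsFrame (g x) F) (u : Vec n) :
    ∑ k, g x (curvOf Γ x (F k) u (F k)) u = - ricOf Γ x u u := by
  rw [ricOf_apply, hF.ctr_eq (curvOf_linear₁ Γ x u u), ← Finset.sum_neg_distrib]
  refine Finset.sum_congr rfl fun k _ => ?_
  have h3 := h.curv_skew x (F k) u (F k) u
  have h4 := h.g_symm x (F k) (curvOf Γ x (F k) u u)
  linarith

theorem hasDerivAt_scalOf {x : Vec n} {F : Fin n → Vec n} (hF : IsFrame (g x) F) (a : Vec n) :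
    HasDerivAt (fun s : ℝ => scalOf g Γ (x + s • a)) (∑ k, covRicOf Γ x a (F k) (F k)) 0 := by
  have hl : HasDerivAt (fun s : ℝ => x + s • a) a 0 := by
    simpa using ((hasDerivAt_id (0:ℝ)).smul_const a).const_add x
  have hx : x + (0:ℝ) • a = x := by simp
  have h1 : HasDerivAt (fun s : ℝ => g (x + s • a)) (fderiv ℝ g x a) 0 :=
    (h.differentiable_g x).hasFDerivAt.comp_hasDerivAt_of_eq (0:ℝ) hl hx.symm
  have h2 : HasDerivAt (fun s : ℝ => ricOf Γ (x + s • a)) (fderiv ℝ (ricOf Γ) x a) 0 :=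
    (h.differentiable_ricOf x).hasFDerivAt.comp_hasDerivAt_of_eq (0:ℝ) hl hx.symm
  have h3 := IsFrame.hasDerivAt_mtr (F := F) (by rw [hx]; exact hF) h1 h2
  refine h3.congr_deriv ?_
  rw [hx]
  simp only [covRicOf, Finset.sum_sub_distrib, h.compat, smul_eq_mul, add_mul,
    Finset.sum_add_distrib]
  have e1 : ∀ k, ∑ l, g x (Γ x a (F k)) (F l) * ricOf Γ x (F k) (F l)
      = ricOf Γ x (F k) (Γ x a (F k)) := fun k =>
    hF.sum_mul_apply (ricOf Γ x (F k)) (Γ x a (F k))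
  have e2 : ∀ l, ∑ k, g x (F k) (Γ x a (F l)) * ricOf Γ x (F k) (F l)
      = ricOf Γ x (Γ x a (F l)) (F l) := fun l => by
    simp_rw [h.g_symm x (F _) (Γ x a (F l))]
    exact hF.sum_mul_apply ((ricOf Γ x).flip (F l)) (Γ x a (F l))
  rw [Finset.sum_congr rfl fun k _ => e1 k, Finset.sum_comm,
    Finset.sum_congr rfl fun k _ => e2 k]
  ring

theorem contracted_bianchi {x : Vec n} {F : Fin n → Vec n} (hF : IsFrame (g x) F) (a : Vec n) :
    ∑ k, covRicOf Γ x a (F k) (F k) = 2 * ∑ k, covRicOf Γ x (F k) a (F k) := by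
  have e : ∀ a b c, covRicOf Γ x a b c = ∑ k, g x (covCurvOf Γ x a (F k) b c) (F k) := by
    intro a b c
    rw [h.covRic_eq_ctr, hF.ctr_eq (h.covCurv_linear₂ x a b c)]
  have key : ∀ k l, g x (covCurvOf Γ x a (F k) (F l) (F l)) (F k)
      = g x (covCurvOf Γ x (F k) (F l) a (F k)) (F l)
        + g x (covCurvOf Γ x (F l) (F k) a (F l)) (F k) := by
    intro k l
    have b := congrArg (fun v => g x v (F k)) (h.covCurv_bianchi x a (F k) (F l) (F l))
    have s := h.covCurv_skew x (F k) (F l) a (F l) (F k)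
    have s' := h.g_symm x (F l) (covCurvOf Γ x (F k) (F l) a (F k))
    have t := congrArg (fun v => g x v (F k)) (covCurvOf_antisymm Γ x (F l) a (F k) (F l))
    simp only [map_add, map_neg, map_zero, add_apply, neg_apply, zero_apply] at b t
    linarith
  simp_rw [e, two_mul]
  rw [Finset.sum_comm]
  simp_rw [key, Finset.sum_add_distrib]
  congr 1
  rw [Finset.sum_comm]

end LeviCivita

end RicciIdentities

section EvolutionAlgebra

variable {n : ℕ}

theorem ctr_sum {ι : Type*} (s : Finset ι) (L : ι → Vec n → Vec n) :
    ctr (fun a => ∑ k ∈ s, L k a) = ∑ k ∈ s, ctr (L k) := by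
  simp only [ctr, Finset.sum_apply]
  rw [Finset.sum_comm]

theorem gram_posDef_eq_zero {B : Bil n} {F : Fin n → Vec n} (hF : IsFrame B F) {v : Vec n}
    (hv : ∀ c, B v c = 0) : v = 0 := by
  rw [← hF.expand v]
  simp [hv]

/-- The variation of the Ricci form when the connection varies with velocity `A`. -/
def ricVar (Γ A : Vec n → Conn n) (x b c : Vec n) : ℝ :=
  ctr fun a => fderiv ℝ A x a b c - fderiv ℝ A x b a c + A x a (Γ x b c) + Γ x a (A x b c)
    - A x b (Γ x a c) - Γ x b (A x a c)

namespace LeviCivita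

variable {g : Vec n → Bil n} {Γ : Vec n → Conn n} (h : LeviCivita g Γ)
include h

theorem covRicOf_symm (hpos : ∀ x, (gram (g x)).PosDef) (x a b c : Vec n) :
    covRicOf Γ x a b c = covRicOf Γ x a c b := by
  have hs := h.ricOf_symm hpos
  have h1 : ∀ b c, fderiv ℝ (ricOf Γ) x a b c = fderiv ℝ (fun y => ricOf Γ y b c) x a := by
    intro b c
    rw [fderiv_clm_apply₂ (h.differentiable_ricOf x) (differentiableAt_const b)
      (differentiableAt_const c)]
    simp
  simp only [covRicOf]
  rw [h1 b c, h1 c b, hs x (Γ x a b) c, hs x b (Γ x a c)]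
  simp_rw [fun y => hs y b c]
  ring

theorem fderiv_scalOf (hR : Differentiable ℝ (scalOf g Γ)) {x : Vec n} {F : Fin n → Vec n}
    (hF : IsFrame (g x) F) (a : Vec n) :
    fderiv ℝ (scalOf g Γ) x a = ∑ k, covRicOf Γ x a (F k) (F k) := by
  have hl : HasDerivAt (fun s : ℝ => x + s • a) a 0 := by
    simpa using ((hasDerivAt_id (0:ℝ)).smul_const a).const_add x
  have h1 := (hR x).hasFDerivAt.comp_hasDerivAt_of_eq (0:ℝ) hl (by simp)
  exact h1.unique (h.hasDerivAt_scalOf hF a)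

variable (hpos : ∀ x, (gram (g x)).PosDef) (hR : ContDiff ℝ 2 (scalOf g Γ))
  {A : Vec n → Conn n} (hA : Differentiable ℝ A) (hAs : ∀ x a b, A x a b = A x b a)
  (hAg : ∀ x a b c, g x (A x a b) c
    = -(covRicOf Γ x a b c + covRicOf Γ x b a c - covRicOf Γ x c a b))
include hpos hR hAg

theorem ctr_flowVelocity (y c : Vec n) :
    ctr (fun a => A y a c) = - fderiv ℝ (scalOf g Γ) y c := by
  obtain ⟨F, hF⟩ := exists_isFrame (hpos y)
  have hl : IsLinearMap ℝ fun a => A y a c := ((A y).flip c).toLinearMap.isLinear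
  rw [hF.ctr_eq hl, h.fderiv_scalOf (hR.differentiable (by simp)) hF, ← Finset.sum_neg_distrib]
  refine Finset.sum_congr rfl fun k _ => ?_
  rw [hAg, h.covRicOf_symm hpos y (F k) (F k) c]
  ring

omit hR in
theorem mtr_flowVelocity (y : Vec n) : mtr (g y) (A y) = 0 := by
  obtain ⟨F, hF⟩ := exists_isFrame (hpos y)
  refine gram_posDef_eq_zero hF fun c => ?_
  have h1 := h.contracted_bianchi hF c
  rw [hF.mtr_eq, map_sum, sum_apply]
  simp only [hAg, Finset.sum_neg_distrib, Finset.sum_sub_distrib, Finset.sum_add_distrib, h1]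
  simp only [fun k => h.covRicOf_symm hpos y (F k) (F k) c]
  ring

include hA

theorem ctr_fderiv_flowVelocity (x b c : Vec n) :
    ctr (fun a => fderiv ℝ A x b a c) = - fderiv ℝ (fderiv ℝ (scalOf g Γ)) x b c := by
  have h0 : (fun y => ctr (fun a => A y a c)) = fun y => - fderiv ℝ (scalOf g Γ) y c :=
    funext fun y => h.ctr_flowVelocity hpos hR hAg y c
  have hd : DifferentiableAt ℝ (fderiv ℝ (scalOf g Γ)) x :=
    (hR.fderiv_right (m := 1) (by norm_num)).differentiable (by simp) x
  have hAd : ∀ a, DifferentiableAt ℝ (fun y => A y a c) x := fun a =>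
    ((hA x).clm_apply (differentiableAt_const a)).clm_apply (differentiableAt_const c)
  have h1 : HasFDerivAt (fun y => ctr (fun a => A y a c))
      (∑ i, (ContinuousLinearMap.proj (R := ℝ) (φ := fun _ : Fin n => ℝ) i).comp
        (fderiv ℝ (fun y => A y (bv i) c) x)) x :=
    HasFDerivAt.fun_sum fun i _ => hasFDerivAt_pi'.1 (hAd (bv i)).hasFDerivAt i
  have h2 : HasFDerivAt (fun y => - fderiv ℝ (scalOf g Γ) y c)
      (-((fderiv ℝ (fderiv ℝ (scalOf g Γ)) x).flip c)) x := by
    refine ((hd.hasFDerivAt.clm_apply (hasFDerivAt_const c x)).congr_fderiv ?_).fun_neg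
    ext v
    simp
  have h3 := congrArg (fun L : Vec n →L[ℝ] ℝ => L b) ((h0 ▸ h1).unique h2)
  have e : ∀ a, fderiv ℝ (fun y => A y a c) x b = fderiv ℝ A x b a c := by
    intro a
    rw [fderiv_clm_apply₂ (hA x) (differentiableAt_const a) (differentiableAt_const c)]
    simp
  simpa [ctr, e] using h3

include hAs

omit hR in
theorem sum_fderiv_flowVelocity {x : Vec n} {F : Fin n → Vec n} (hF : IsFrame (g x) F)
    (a : Vec n) :
    ∑ k, fderiv ℝ A x a (F k) (F k) = (2:ℝ) • ∑ k, A x (F k) (Γ x a (F k)) := by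
  have hl : HasDerivAt (fun s : ℝ => x + s • a) a 0 := by
    simpa using ((hasDerivAt_id (0:ℝ)).smul_const a).const_add x
  have hx : x + (0:ℝ) • a = x := by simp
  have h1 : HasDerivAt (fun s : ℝ => g (x + s • a)) (fderiv ℝ g x a) 0 :=
    (h.differentiable_g x).hasFDerivAt.comp_hasDerivAt_of_eq (0:ℝ) hl hx.symm
  have h2 : HasDerivAt (fun s : ℝ => A (x + s • a)) (fderiv ℝ A x a) 0 :=
    (hA x).hasFDerivAt.comp_hasDerivAt_of_eq (0:ℝ) hl hx.symm
  have h3 := IsFrame.hasDerivAt_mtr (F := F) (by rw [hx]; exact hF) h1 h2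
  simp_rw [h.mtr_flowVelocity hpos hAg] at h3
  have h4 := h3.unique (hasDerivAt_const (0:ℝ) (0 : Vec n))
  rw [hx] at h4
  simp only [h.compat, add_smul, Finset.sum_add_distrib] at h4
  have e1 : ∀ k, ∑ l, g x (Γ x a (F k)) (F l) • A x (F k) (F l) = A x (F k) (Γ x a (F k)) :=
    fun k => hF.sum_mul_apply (A x (F k)) (Γ x a (F k))
  have e2 : ∀ l, ∑ k, g x (F k) (Γ x a (F l)) • A x (F k) (F l)
      = A x (F l) (Γ x a (F l)) := fun l => by
    simp_rw [h.g_symm x (F _) (Γ x a (F l)), hAs x (F _) (F l)]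
    exact hF.sum_mul_apply (A x (F l)) (Γ x a (F l))
  rw [Finset.sum_congr rfl fun k _ => e1 k,
    Finset.sum_comm (f := fun k l => g x (F k) (Γ x a (F l)) • A x (F k) (F l)),
    Finset.sum_congr rfl fun k _ => e2 k] at h4
  rw [two_smul]
  exact sub_eq_zero.1 h4

theorem sum_ricVar {x : Vec n} {F : Fin n → Vec n} (hF : IsFrame (g x) F) :
    ∑ k, ricVar Γ A x (F k) (F k)
      = ∑ k, (fderiv ℝ (fderiv ℝ (scalOf g Γ)) x (F k) (F k)
          - fderiv ℝ (scalOf g Γ) x (Γ x (F k) (F k))) := by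
  have t1 : ∑ k, ctr (fun a => fderiv ℝ A x a (F k) (F k))
      = 2 * ∑ k, ctr (fun a => A x (F k) (Γ x (F k) a)) := by
    rw [← ctr_sum, ← ctr_sum]
    have : (fun a => ∑ k, fderiv ℝ A x a (F k) (F k))
        = fun a => (2:ℝ) • ∑ k, A x (F k) (Γ x (F k) a) := by
      funext a
      rw [h.sum_fderiv_flowVelocity hpos hA hAs hAg hF a]
      simp_rw [h.Γ_symm x a]
    rw [this]
    simp [ctr, Finset.mul_sum]
  have t2 := fun k => h.ctr_fderiv_flowVelocity hpos hR hA hAg x (F k) (F k)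
  have t3 := fun k => h.ctr_flowVelocity hpos hR hAg x (Γ x (F k) (F k))
  have t4 : ∑ k, ctr (fun a => Γ x a (A x (F k) (F k))) = 0 := by
    rw [← ctr_sum]
    have : (fun a => ∑ k, Γ x a (A x (F k) (F k))) = fun _ => 0 := by
      funext a
      rw [← map_sum, ← hF.mtr_eq, h.mtr_flowVelocity hpos hAg, map_zero]
    rw [this]
    simp [ctr]
  have t5 : ∀ k, ctr (fun a => A x (F k) (Γ x a (F k))) = ctr (fun a => A x (F k) (Γ x (F k) a)) :=
    fun k => by simp_rw [h.Γ_symm x _ (F k)]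
  have t6 : ∀ k, ctr (fun a => Γ x (F k) (A x a (F k))) = ctr (fun a => A x (F k) (Γ x (F k) a)) :=
    fun k => by
      simp_rw [hAs x _ (F k)]
      exact ctr_comp_comm (Γ x (F k)) (A x (F k))
  simp only [ricVar]
  simp only [ctr_sub, ctr_add, Finset.sum_sub_distrib, Finset.sum_add_distrib, t1, t2, t3, t4, t5,
    t6, Finset.sum_neg_distrib]
  ring

end LeviCivita

end EvolutionAlgebra

section Coordinates

variable {n : ℕ}

/-- The bilinear form of a metric given by its matrix. -/
def metB (G : Vec n → Matrix (Fin n) (Fin n) ℝ) (x : Vec n) : Bil n := bilinOf fun i j => G x i j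

/-- The Christoffel map of a metric given by its matrix. -/
def chrB (G : Vec n → Matrix (Fin n) (Fin n) ℝ) (x : Vec n) : Conn n :=
  bilinOf fun i j k => christoffel G x k i j

theorem gram_metB (G : Vec n → Matrix (Fin n) (Fin n) ℝ) (x : Vec n) : gram (metB G x) = G x := by
  ext i j
  simp only [gram, metB, Matrix.of_apply, bilinOf_bv]

theorem linear_eq_zero {f : Vec n → ℝ} (hf : IsLinearMap ℝ f) (h0 : ∀ i, f (bv i) = 0)
    (a : Vec n) : f a = 0 := by
  calc f a = hf.mk' _ (∑ j, a j • bv j) := by rw [sum_smul_bv]; rfl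
    _ = 0 := by simp [h0]

theorem trilinear_eq_zero {f : Vec n → Vec n → Vec n → ℝ}
    (h₁ : ∀ b c, IsLinearMap ℝ fun a => f a b c) (h₂ : ∀ a c, IsLinearMap ℝ fun b => f a b c)
    (h₃ : ∀ a b, IsLinearMap ℝ fun c => f a b c)
    (h0 : ∀ i j k, f (bv i) (bv j) (bv k) = 0) (a b c : Vec n) : f a b c = 0 :=
  linear_eq_zero (h₁ b c) (fun i => linear_eq_zero (h₂ (bv i) c) (fun j =>
    linear_eq_zero (h₃ (bv i) (bv j)) (h0 i j) c) b) a

variable {G : Vec n → Matrix (Fin n) (Fin n) ℝ}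

theorem metB_symm (hG : ∀ x, (G x).IsSymm) (x a b : Vec n) : metB G x a b = metB G x b a := by
  simp only [metB, bilinOf_apply]
  rw [Finset.sum_comm]
  refine Finset.sum_congr rfl fun i _ => Finset.sum_congr rfl fun j _ => ?_
  rw [(hG x).apply, smul_comm]

theorem fderiv_metB_bv {x : Vec n} (hd : DifferentiableAt ℝ (metB G) x) (i j k : Fin n) :
    fderiv ℝ (metB G) x (bv i) (bv j) (bv k) = pd (fun y => G y j k) i x := by
  have h1 := fderiv_clm_apply₂ hd (differentiableAt_const (bv j)) (differentiableAt_const (bv k))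
    (bv i)
  simp only [metB, bilinOf_bv, fderiv_fun_const, Pi.zero_apply, zero_apply, map_zero,
    add_zero] at h1
  exact h1.symm

theorem fderiv_metB_symm (hG : ∀ x, (G x).IsSymm) {x : Vec n} (hd : DifferentiableAt ℝ (metB G) x)
    (a b c : Vec n) : fderiv ℝ (metB G) x a b c = fderiv ℝ (metB G) x a c b := by
  have h1 := fun b c => fderiv_clm_apply₂ hd (differentiableAt_const b) (differentiableAt_const c) a
  simp only [fderiv_fun_const, Pi.zero_apply, zero_apply, map_zero, add_zero] at h1
  rw [← h1, ← h1]
  simp_rw [fun y => metB_symm hG y b c]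

/-- The Koszul formula. -/
theorem koszul (hG : ∀ x, (G x).IsSymm) {x : Vec n} (hu : IsUnit (G x))
    (hd : DifferentiableAt ℝ (metB G) x) (a b c : Vec n) :
    2 * metB G x (chrB G x a b) c
      = fderiv ℝ (metB G) x a b c + fderiv ℝ (metB G) x b a c - fderiv ℝ (metB G) x c a b := by
  rw [← sub_eq_zero]
  refine trilinear_eq_zero (f := fun a b c => 2 * metB G x (chrB G x a b) c
    - (fderiv ℝ (metB G) x a b c + fderiv ℝ (metB G) x b a c - fderiv ℝ (metB G) x c a b))
    ?_ ?_ ?_ ?_ a b c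
  · intro b c
    constructor
    · intro u v
      simp only [map_add, add_apply]
      ring
    · intro r u
      simp only [map_smul, smul_apply, smul_eq_mul]
      ring
  · intro b c
    constructor
    · intro u v
      simp only [map_add, add_apply]
      ring
    · intro r u
      simp only [map_smul, smul_apply, smul_eq_mul]
      ring
  · intro b c
    constructor
    · intro u v
      simp only [map_add, add_apply]
      ring
    · intro r u
      simp only [map_smul, smul_apply, smul_eq_mul]
      ring
  · intro i j k
    simp only [fderiv_metB_bv hd]
    have e1 : metB G x (chrB G x (bv i) (bv j)) (bv k)
        = ∑ m, G x k m * christoffel G x m i j := by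
      rw [chrB, bilinOf_bv, metB_symm hG, metB, bilinOf_apply]
      simp [Pi.single_apply, mul_comm]
    have e2 : ∑ m, G x k m * christoffel G x m i j = (1/2) * (pd (fun y => G y j k) i x
        + pd (fun y => G y i k) j x - pd (fun y => G y i j) k x) := by
      set w : Fin n → ℝ := fun l => pd (fun y => G y j l) i x + pd (fun y => G y i l) j x
        - pd (fun y => G y i j) l x with hw
      have e3 : (fun m => christoffel G x m i j) = (1/2 : ℝ) • ((G x)⁻¹ *ᵥ w) := by
        funext m
        simp [christoffel, hw, Matrix.mulVec, dotProduct]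
      have e4 : ∑ m, G x k m * christoffel G x m i j
          = (G x *ᵥ (fun m => christoffel G x m i j)) k := rfl
      rw [e4, e3, Matrix.mulVec_smul, Matrix.mulVec_mulVec,
        Matrix.mul_nonsing_inv _ ((Matrix.isUnit_iff_isUnit_det _).1 hu), Matrix.one_mulVec]
      simp [hw]
    rw [e1, e2]
    ring

theorem leviCivita_of_smooth (hG : ∀ x, (G x).IsSymm) (hu : ∀ x, IsUnit (G x))
    (h₁ : ContDiff ℝ (⊤ : ℕ∞) (metB G)) (h₂ : ContDiff ℝ (⊤ : ℕ∞) (chrB G)) :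
    LeviCivita (metB G) (chrB G) where
  smooth_g := h₁
  smooth_Γ := h₂
  g_symm := metB_symm hG
  Γ_symm := by
    intro x a b
    simp only [chrB, bilinOf_apply]
    rw [Finset.sum_comm]
    refine Finset.sum_congr rfl fun i _ => Finset.sum_congr rfl fun j _ => ?_
    rw [smul_comm]
    congr 2
    funext k
    simp only [christoffel]
    congr 1
    refine Finset.sum_congr rfl fun l _ => ?_
    have : (fun y => G y i j) = fun y => G y j i := funext fun y => (hG y).apply _ _
    rw [this]
    ring
  compat := by
    intro x w a b
    have hd := h₁.differentiable (by simp) x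
    have k1 := koszul hG (hu x) hd w a b
    have k2 := koszul hG (hu x) hd w b a
    have s1 := fderiv_metB_symm hG hd w a b
    have s2 := fderiv_metB_symm hG hd a w b
    have s3 := fderiv_metB_symm hG hd b w a
    have s4 := metB_symm hG x a (chrB G x w b)
    linarith

theorem ricci_eq_ricOf {x : Vec n} (hd : DifferentiableAt ℝ (chrB G) x) (j k : Fin n) :
    ricci G x j k = ricOf (chrB G) x (bv j) (bv k) := by
  have h1 : ∀ i j k l : Fin n, fderiv ℝ (chrB G) x (bv i) (bv j) (bv k) l
      = pd (fun y => christoffel G y l j k) i x := by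
    intro i j k l
    have h1 := fderiv_clm_apply₂ hd (differentiableAt_const (bv j)) (differentiableAt_const (bv k))
      (bv i)
    simp only [chrB, bilinOf_bv, fderiv_fun_const, Pi.zero_apply, zero_apply, map_zero,
      add_zero] at h1
    have hd' : DifferentiableAt ℝ (fun y => chrB G y (bv j) (bv k)) x :=
      (hd.clm_apply (differentiableAt_const _)).clm_apply (differentiableAt_const _)
    simp only [chrB, bilinOf_bv] at hd'
    have h2 := (hasFDerivAt_pi'.1 hd'.hasFDerivAt l).fderiv
    simp only [pd]
    rw [h2]
    exact (congrFun h1 l).symm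
  have h3 : ∀ (i j k l : Fin n), chrB G x (bv i) (chrB G x (bv j) (bv k)) l
      = ∑ p, christoffel G x l i p * christoffel G x p j k := by
    intro i j k l
    simp only [chrB, bilinOf_bv]
    rw [bilinOf_apply, Finset.sum_apply, Finset.sum_eq_single i]
    · simp [mul_comm]
    · intro c _ hc
      simp [hc]
    · simp
  rw [ricOf_apply]
  simp only [ricci, ctr, curvOf, Pi.sub_apply, Pi.add_apply, h1, h3, Finset.sum_sub_distrib]
  rw [← Finset.sum_sub_distrib]
  refine Finset.sum_congr rfl fun i _ => ?_
  ring

theorem scalarCurv_eq_scalOf {x : Vec n} (hd : DifferentiableAt ℝ (chrB G) x) :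
    scalarCurv G x = scalOf (metB G) (chrB G) x := by
  simp only [scalarCurv, scalOf, mtr, gram_metB, ricci_eq_ricOf hd, smul_eq_mul]

end Coordinates

section SpaceTime

variable {n : ℕ}

/-- The closed space-time slab. -/
abbrev slab (n : ℕ) (T : ℝ) : Set (Vec n × ℝ) := univ ×ˢ Icc 0 T

variable {T : ℝ} {W : Type*} [NormedAddCommGroup W] [NormedSpace ℝ W]

theorem uniqueDiffOn_slab (hT : 0 < T) : UniqueDiffOn ℝ (slab n T) :=
  uniqueDiffOn_univ.prod (uniqueDiffOn_Icc hT)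

theorem fderiv_slice_eq {f : Vec n × ℝ → W}
    (hf : ContDiffOn ℝ (⊤ : ℕ∞) f (slab n T)) {p : Vec n × ℝ} (hp : p ∈ slab n T) :
    fderiv ℝ (fun y => f (y, p.2)) p.1
      = (fderivWithin ℝ f (slab n T) p).comp (ContinuousLinearMap.inl ℝ (Vec n) ℝ) := by
  have h1 := (hf.differentiableOn (by simp) p hp).hasFDerivWithinAt
  have h2 : HasFDerivWithinAt (fun y : Vec n => (y, p.2)) (ContinuousLinearMap.inl ℝ (Vec n) ℝ)
      univ p.1 := (hasFDerivAt_prodMk_left p.1 p.2).hasFDerivWithinAt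
  have h3 := HasFDerivWithinAt.comp p.1 (t := slab n T) h1 h2
    (fun y _ => ⟨mem_univ _, hp.2⟩)
  rw [hasFDerivWithinAt_univ] at h3
  exact h3.fderiv

theorem contDiffOn_fderiv_slice {f : Vec n × ℝ → W} (hT : 0 < T)
    (hf : ContDiffOn ℝ (⊤ : ℕ∞) f (slab n T)) :
    ContDiffOn ℝ (⊤ : ℕ∞) (fun p : Vec n × ℝ => fderiv ℝ (fun y => f (y, p.2)) p.1)
      (slab n T) := by
  have h1 : ContDiffOn ℝ (⊤ : ℕ∞) (fderivWithin ℝ f (slab n T)) (slab n T) :=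
    hf.fderivWithin (uniqueDiffOn_slab hT) (by simp)
  exact (h1.clm_comp contDiffOn_const).congr fun p hp => fderiv_slice_eq hf hp

theorem contDiff_slice {f : Vec n × ℝ → W} (hf : ContDiffOn ℝ (⊤ : ℕ∞) f (slab n T)) {t : ℝ}
    (ht : t ∈ Icc 0 T) : ContDiff ℝ (⊤ : ℕ∞) fun y => f (y, t) := by
  rw [← contDiffOn_univ]
  exact hf.comp (contDiff_id.prodMk contDiff_const).contDiffOn fun y _ => ⟨mem_univ _, ht⟩

theorem contDiffAt_of_slab {f : Vec n × ℝ → W} (hf : ContDiffOn ℝ (⊤ : ℕ∞) f (slab n T)) {t : ℝ}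
    (ht : t ∈ Ioo 0 T) (x : Vec n) : ContDiffAt ℝ (⊤ : ℕ∞) f (x, t) :=
  hf.contDiffAt (prod_mem_nhds Filter.univ_mem (Icc_mem_nhds ht.1 ht.2))

section InverseMatrix

attribute [local instance] Matrix.linftyOpNormedRing Matrix.linftyOpNormedAlgebra

theorem contDiffOn_inv_entry {P : Type*} [NormedAddCommGroup P] [NormedSpace ℝ P]
    {M : P → Matrix (Fin n) (Fin n) ℝ} {S : Set P}
    (hM : ∀ i j, ContDiffOn ℝ (⊤ : ℕ∞) (fun p => M p i j) S) (hu : ∀ p ∈ S, IsUnit (M p))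
    (j k : Fin n) : ContDiffOn ℝ (⊤ : ℕ∞) (fun p => (M p)⁻¹ j k) S := by
  have h1 : ContDiffOn ℝ (⊤ : ℕ∞) M S := by
    have e : M = fun p => ∑ i, ∑ j, M p i j • Matrix.single i j (1:ℝ) := by
      funext p
      conv_lhs => rw [Matrix.matrix_eq_sum_single (M p)]
      simp
    rw [e]
    exact ContDiffOn.sum fun i _ => ContDiffOn.sum fun j _ => (hM i j).smul contDiffOn_const
  have h2 : ContDiffOn ℝ (⊤ : ℕ∞) (fun p => Ring.inverse (M p)) S := by
    intro p hp
    obtain ⟨U, hU⟩ := hu p hp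
    have h3 : ContDiffAt ℝ (⊤ : ℕ∞) Ring.inverse (M p) := hU ▸ contDiffAt_ringInverse ℝ U
    exact h3.comp_contDiffWithinAt p (h1 p hp)
  have h4 := ((Matrix.entryLinearMap ℝ ℝ j k).toContinuousLinearMap).contDiff.comp_contDiffOn h2
  refine h4.congr fun p _ => ?_
  rw [Matrix.nonsing_inv_eq_ringInverse]
  rfl

end InverseMatrix

/-- Time and space derivatives commute. -/
theorem hasDerivAt_fderiv_slice {f : Vec n × ℝ → W} {x : Vec n} {t : ℝ}
    (hf : ∀ y, ContDiffAt ℝ (⊤ : ℕ∞) f (y, t)) :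
    Differentiable ℝ (fun y => deriv (fun s => f (y, s)) t) ∧
    HasDerivAt (fun s => fderiv ℝ (fun y => f (y, s)) x)
      (fderiv ℝ (fun y => deriv (fun s => f (y, s)) t) x) t := by
  have hd2 : ∀ y, DifferentiableAt ℝ (fderiv ℝ f) (y, t) := fun y =>
    ((hf y).fderiv_right (m := 1) (by norm_cast)).differentiableAt (by simp)
  have e1 : (fun y => deriv (fun s => f (y, s)) t) = fun y => fderiv ℝ f (y, t) (0, 1) := by
    funext y
    have h1 := ((hf y).differentiableAt (by simp)).hasFDerivAt
    have h2 : HasDerivAt (fun s : ℝ => (y, s)) ((0, 1) : Vec n × ℝ) t :=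
      (hasDerivAt_const t y).prodMk (hasDerivAt_id t)
    exact (h1.comp_hasDerivAt t h2).deriv
  have h3 : ∀ y, HasFDerivAt (fun y => fderiv ℝ f (y, t) (0, 1))
      (((fderiv ℝ (fderiv ℝ f) (y, t)).flip (0, 1)).comp (ContinuousLinearMap.inl ℝ (Vec n) ℝ))
      y := by
    intro y
    have h4 := ((hd2 y).hasFDerivAt.clm_apply (hasFDerivAt_const ((0, 1) : Vec n × ℝ) (y, t)))
    have h5 := h4.comp y (f := fun e : Vec n => (e, t)) (hasFDerivAt_prodMk_left y t)
    refine h5.congr_fderiv ?_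
    ext v
    simp
  rw [e1]
  refine ⟨fun y => (h3 y).differentiableAt, ?_⟩
  have h6 : (fun s => fderiv ℝ (fun y => f (y, s)) x)
      =ᶠ[nhds t] fun s => (fderiv ℝ f (x, s)).comp (ContinuousLinearMap.inl ℝ (Vec n) ℝ) := by
    have hc : ContinuousAt (fun s : ℝ => (x, s)) t := by fun_prop
    have h1 := hc.eventually (((hf x).of_le (m := 1) (by norm_cast)).eventually (by simp))
    filter_upwards [h1] with s hs
    have h7 := (hs.differentiableAt (by simp)).hasFDerivAt
    exact (h7.comp x (f := fun e : Vec n => (e, s)) (hasFDerivAt_prodMk_left x s)).fderiv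
  have h8 : HasDerivAt (fun s : ℝ => (x, s)) ((0, 1) : Vec n × ℝ) t :=
    (hasDerivAt_const t x).prodMk (hasDerivAt_id t)
  have h9 := (hd2 x).hasFDerivAt.comp_hasDerivAt t h8
  have h10 := h9.clm_comp (hasDerivAt_const t (ContinuousLinearMap.inl ℝ (Vec n) ℝ))
  refine (h10.congr_of_eventuallyEq h6).congr_deriv ?_
  rw [(h3 x).fderiv]
  have hs := ((hf x).of_le (m := 2) (by norm_cast)).isSymmSndFDerivAt (by simp)
  ext v
  simp
  exact hs (0, 1) (v, 0)

end SpaceTime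

section Flow

variable {n : ℕ} {T : ℝ}

/-- A smooth Ricci flow on the closed slab, with its Christoffel map. -/
structure FlowData (T : ℝ) (B : Vec n × ℝ → Bil n) (Γ : Vec n × ℝ → Conn n) : Prop where
  smooth_B : ContDiffOn ℝ (⊤ : ℕ∞) B (slab n T)
  smooth_Γ : ContDiffOn ℝ (⊤ : ℕ∞) Γ (slab n T)
  leviCivita : ∀ t ∈ Icc 0 T, LeviCivita (fun y => B (y, t)) (fun y => Γ (y, t))
  posDef : ∀ x, ∀ t ∈ Icc 0 T, (gram (B (x, t))).PosDef
  flow : ∀ x, ∀ t ∈ Ioo 0 T,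
    HasDerivAt (fun s => B (x, s)) ((-2 : ℝ) • ricOf (fun y => Γ (y, t)) x) t

/-- The Ricci form in space-time. -/
def ricST (Γ : Vec n × ℝ → Conn n) (p : Vec n × ℝ) : Bil n := ricOf (fun y => Γ (y, p.2)) p.1

/-- The scalar curvature in space-time. -/
def scalST (B : Vec n × ℝ → Bil n) (Γ : Vec n × ℝ → Conn n) (p : Vec n × ℝ) : ℝ :=
  scalOf (fun y => B (y, p.2)) (fun y => Γ (y, p.2)) p.1

/-- The Laplacian of `f` in the frame `F` for the connection `Γ`. -/
def lapOf (Γ : Conn n) (f : Vec n → ℝ) (F : Fin n → Vec n) (x : Vec n) : ℝ :=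
  ∑ k, (fderiv ℝ (fderiv ℝ f) x (F k) (F k) - fderiv ℝ f x (Γ (F k) (F k)))

namespace FlowData

variable {B : Vec n × ℝ → Bil n} {Γ : Vec n × ℝ → Conn n} (h : FlowData T B Γ)
include h

theorem smooth_dΓ (hT : 0 < T) : ContDiffOn ℝ (⊤ : ℕ∞)
    (fun p : Vec n × ℝ => fderiv ℝ (fun y => Γ (y, p.2)) p.1) (slab n T) :=
  contDiffOn_fderiv_slice hT h.smooth_Γ

theorem smooth_ric (hT : 0 < T) : ContDiffOn ℝ (⊤ : ℕ∞) (ricST Γ) (slab n T) := by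
  unfold ricST ricOf
  refine (contDiff_bilinOf (k := ((⊤ : ℕ∞) : WithTop ℕ∞))).comp_contDiffOn ?_
  refine contDiffOn_pi.2 fun j => contDiffOn_pi.2 fun k => ?_
  unfold ctr
  refine ContDiffOn.sum fun i _ => ?_
  have h1 : ContDiffOn ℝ (⊤ : ℕ∞)
      (fun p : Vec n × ℝ => curvOf (fun y => Γ (y, p.2)) p.1 (bv i) (bv j) (bv k)) (slab n T) := by
    unfold curvOf
    have hd := h.smooth_dΓ hT
    have hΓ := h.smooth_Γ
    have c : ∀ v : Vec n, ContDiffOn ℝ (⊤ : ℕ∞) (fun _ : Vec n × ℝ => v) (slab n T) :=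
      fun v => contDiffOn_const
    exact ((((((hd.clm_apply (c _)).clm_apply (c _)).clm_apply (c _)).sub
      (((hd.clm_apply (c _)).clm_apply (c _)).clm_apply (c _))).add
      ((hΓ.clm_apply (c _)).clm_apply ((hΓ.clm_apply (c _)).clm_apply (c _))))).sub
      ((hΓ.clm_apply (c _)).clm_apply ((hΓ.clm_apply (c _)).clm_apply (c _)))
  exact contDiffOn_pi.1 h1 i

theorem smooth_scal (hT : 0 < T) : ContDiffOn ℝ (⊤ : ℕ∞) (scalST B Γ) (slab n T) := by
  unfold scalST scalOf mtr
  have c : ∀ v : Vec n, ContDiffOn ℝ (⊤ : ℕ∞) (fun _ : Vec n × ℝ => v) (slab n T) :=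
    fun v => contDiffOn_const
  refine ContDiffOn.sum fun i _ => ContDiffOn.sum fun j _ => ?_
  have h1 := contDiffOn_inv_entry (M := fun p : Vec n × ℝ => gram (B p)) (S := slab n T)
    (fun i j => (by
      simp only [gram, Matrix.of_apply]
      exact (h.smooth_B.clm_apply (c _)).clm_apply (c _)))
    (fun p hp => (h.posDef p.1 p.2 hp.2).isUnit) i j
  exact h1.smul (((h.smooth_ric hT).clm_apply (c _)).clm_apply (c _))

theorem evolution (hT : 0 < T) {x : Vec n} {t : ℝ} (ht : t ∈ Ioo 0 T) {F : Fin n → Vec n}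
    (hF : IsFrame (B (x, t)) F) :
    HasDerivAt (fun s => scalST B Γ (x, s))
      (2 * ∑ k, ∑ l, ricST Γ (x, t) (F k) (F l) ^ 2
        + lapOf (Γ (x, t)) (fun y => scalST B Γ (y, t)) F x) t := by
  have htI : t ∈ Icc 0 T := Ioo_subset_Icc_self ht
  have hL := h.leviCivita t htI
  have hpos : ∀ x, (gram (B (x, t))).PosDef := fun x => h.posDef x t htI
  have hR : ContDiff ℝ 2 (scalOf (fun y => B (y, t)) (fun y => Γ (y, t))) :=
    (contDiff_slice (h.smooth_scal hT) htI).of_le (by norm_cast)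
  obtain ⟨hA, hA'⟩ := hasDerivAt_fderiv_slice (x := x) (fun y => contDiffAt_of_slab h.smooth_Γ ht y)
  set A : Vec n → Conn n := fun y => deriv (fun s => Γ (y, s)) t with hAdef
  have hAt : ∀ y, HasDerivAt (fun s => Γ (y, s)) (A y) t := fun y => by
    have h1 := (contDiffAt_of_slab h.smooth_Γ ht y).differentiableAt (by simp)
    have h2 : DifferentiableAt ℝ (fun s : ℝ => (y, s)) t := by fun_prop
    exact (h1.comp t h2).hasDerivAt
  have hev : ∀ᶠ s in nhds t, s ∈ Icc 0 T := Icc_mem_nhds ht.1 ht.2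
  have hAv : ∀ y a b, HasDerivAt (fun s => Γ (y, s) a b) (A y a b) t := fun y a b => by
    simpa using ((hAt y).clm_apply (hasDerivAt_const t a)).clm_apply (hasDerivAt_const t b)
  have hAs : ∀ y a b, A y a b = A y b a := fun y a b => by
    refine (hAv y a b).unique ((hAv y b a).congr_of_eventuallyEq ?_)
    filter_upwards [hev] with s hs
    exact (h.leviCivita s hs).Γ_symm y a b
  have hBv : ∀ y a b, HasDerivAt (fun s => B (y, s) a b)
      (-2 * ricOf (fun y => Γ (y, t)) y a b) t := fun y a b => by
    simpa using ((h.flow y t ht).clm_apply (hasDerivAt_const t a)).clm_apply (hasDerivAt_const t b)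
  have hdB : ∀ y a b c, HasDerivAt (fun s => fderiv ℝ (fun y => B (y, s)) y a b c)
      (-2 * fderiv ℝ (ricOf fun y => Γ (y, t)) y a b c) t := by
    intro y a b c
    have h1 := (hasDerivAt_fderiv_slice (x := y)
      (fun y => contDiffAt_of_slab h.smooth_B ht y)).2
    have e1 : (fun y => deriv (fun s => B (y, s)) t)
        = (-2 : ℝ) • ricOf fun y => Γ (y, t) := funext fun y => (h.flow y t ht).deriv
    rw [e1, fderiv_const_smul (hL.differentiable_ricOf y)] at h1
    simpa using ((h1.clm_apply (hasDerivAt_const t a)).clm_apply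
      (hasDerivAt_const t b)).clm_apply (hasDerivAt_const t c)
  have hAg : ∀ y a b c, B (y, t) (A y a b) c = -(covRicOf (fun y => Γ (y, t)) y a b c
      + covRicOf (fun y => Γ (y, t)) y b a c - covRicOf (fun y => Γ (y, t)) y c a b) := by
    intro y a b c
    have h1 : HasDerivAt (fun s => 2 * B (y, s) (Γ (y, s) a b) c)
        (2 * (-2 * ricOf (fun y => Γ (y, t)) y (Γ (y, t) a b) c + B (y, t) (A y a b) c)) t := by
      have h2 := ((h.flow y t ht).clm_apply (hAv y a b)).clm_apply (hasDerivAt_const t c)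
      refine (h2.const_mul 2).congr_deriv ?_
      simp
    have h3 := ((hdB y a b c).fun_add (hdB y b a c)).fun_sub (hdB y c a b)
    have h4 := h1.unique (h3.congr_of_eventuallyEq (by
      filter_upwards [hev] with s hs
      have hLs := h.leviCivita s hs
      simp only [hLs.compat]
      have s1 : ∀ a b, B (y, s) a b = B (y, s) b a := hLs.g_symm y
      have s2 : ∀ a b, Γ (y, s) a b = Γ (y, s) b a := hLs.Γ_symm y
      rw [s1 (Γ (y, s) c a) b, s1 b (Γ (y, s) a c), s1 a (Γ (y, s) c b), s2 c a, s2 c b, s2 b a,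
        s1 b (Γ (y, s) a c), s1 a (Γ (y, s) b c)]
      ring))
    have s1 := hL.ricOf_symm hpos y
    have s2 := hL.Γ_symm y
    simp only [covRicOf] at s2 ⊢
    rw [s1 b (Γ (y, t) a c), s1 a (Γ (y, t) b c), s1 a (Γ (y, t) c b), s2 c a, s2 c b, s2 b a]
    linarith
  have hS : ∃ S', HasDerivAt (fun s => ricOf (fun y => Γ (y, s)) x) S' t := by
    have h1 := (contDiffAt_of_slab (h.smooth_ric hT) ht x).differentiableAt (by simp)
    have h2 : DifferentiableAt ℝ (fun s : ℝ => (x, s)) t := by fun_prop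
    exact ⟨_, (h1.comp t h2).hasDerivAt⟩
  obtain ⟨S', hS⟩ := hS
  have hSv : ∀ b c, S' b c = ricVar (fun y => Γ (y, t)) A x b c := by
    intro b c
    have h1 : HasDerivAt (fun s => ricOf (fun y => Γ (y, s)) x b c) (S' b c) t := by
      simpa using (hS.clm_apply (hasDerivAt_const t b)).clm_apply (hasDerivAt_const t c)
    simp only [ricOf_apply] at h1
    refine h1.unique ?_
    unfold ricVar ctr
    refine HasDerivAt.fun_sum fun i _ => ?_
    have hd : ∀ a b c, HasDerivAt (fun s => fderiv ℝ (fun y => Γ (y, s)) x a b c)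
        (fderiv ℝ A x a b c) t := fun a b c => by
      simpa using ((hA'.clm_apply (hasDerivAt_const t a)).clm_apply
        (hasDerivAt_const t b)).clm_apply (hasDerivAt_const t c)
    have hq : ∀ a b c, HasDerivAt (fun s => Γ (x, s) a (Γ (x, s) b c))
        (A x a (Γ (x, t) b c) + Γ (x, t) a (A x b c)) t := fun a b c => by
      simpa using ((hAt x).clm_apply (hasDerivAt_const t a)).clm_apply (hAv x b c)
    have h5 : HasDerivAt (fun s => curvOf (fun y => Γ (y, s)) x (bv i) b c) _ t :=
      (((hd (bv i) b c).fun_sub (hd b (bv i) c)).fun_add (hq (bv i) b c)).fun_sub (hq b (bv i) c)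
    refine (hasDerivAt_pi.1 h5 i).congr_deriv ?_
    simp only [Pi.add_apply, Pi.sub_apply]
    ring
  have hfin := IsFrame.hasDerivAt_mtr hF (h.flow x t ht) hS
  have hsum := hL.sum_ricVar hpos hR hA hAs hAg hF
  refine hfin.congr_deriv ?_
  simp only [hSv]
  rw [hsum]
  unfold lapOf scalST
  simp only [smul_apply, smul_eq_mul, ricST, Finset.mul_sum]
  rw [add_comm, sub_eq_add_neg, ← Finset.sum_neg_distrib]
  simp only [← Finset.sum_neg_distrib]
  congr 1
  refine Finset.sum_congr rfl fun k _ => Finset.sum_congr rfl fun l _ => ?_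
  ring

/-- The evolution inequality for the scalar curvature. -/
theorem evolution_ge (hT : 0 < T) {x : Vec n} {t : ℝ} (ht : t ∈ Ioo 0 T) {F : Fin n → Vec n}
    (hF : IsFrame (B (x, t)) F) :
    2 / n * scalST B Γ (x, t) ^ 2 + lapOf (Γ (x, t)) (fun y => scalST B Γ (y, t)) F x
      ≤ deriv (fun s => scalST B Γ (x, s)) t := by
  rw [(h.evolution hT ht hF).deriv]
  refine add_le_add_left ?_ _
  have e : scalST B Γ (x, t) = ∑ k, ricST Γ (x, t) (F k) (F k) := hF.mtr_eq _
  have h1 : (∑ k, ricST Γ (x, t) (F k) (F k)) ^ 2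
      ≤ n * ∑ k, ricST Γ (x, t) (F k) (F k) ^ 2 := by
    simpa using sq_sum_le_card_mul_sum_sq (s := Finset.univ)
      (f := fun k => ricST Γ (x, t) (F k) (F k))
  have h2 : ∑ k, ricST Γ (x, t) (F k) (F k) ^ 2
      ≤ ∑ k, ∑ l, ricST Γ (x, t) (F k) (F l) ^ 2 := by
    refine Finset.sum_le_sum fun k _ => ?_
    exact Finset.single_le_sum (f := fun l => ricST Γ (x, t) (F k) (F l) ^ 2)
      (fun l _ => sq_nonneg _) (Finset.mem_univ k)
  have h0 : 0 ≤ ∑ k, ricST Γ (x, t) (F k) (F k) ^ 2 := Finset.sum_nonneg fun _ _ => sq_nonneg _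
  rw [e]
  rcases Nat.eq_zero_or_pos n with rfl | hn
  · simp
  · have hn' : (0:ℝ) < n := by exact_mod_cast hn
    calc 2 / (n:ℝ) * (∑ k, ricST Γ (x, t) (F k) (F k)) ^ 2
        ≤ 2 / n * (n * ∑ k, ricST Γ (x, t) (F k) (F k) ^ 2) := by gcongr
      _ = 2 * ∑ k, ricST Γ (x, t) (F k) (F k) ^ 2 := by field_simp
      _ ≤ _ := by gcongr

end FlowData

end Flow

section FromMatrices

variable {n : ℕ} {T : ℝ} {g : Vec n → ℝ → Matrix (Fin n) (Fin n) ℝ}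

/-- The metric in space-time as a bilinear form. -/
def metST (g : Vec n → ℝ → Matrix (Fin n) (Fin n) ℝ) (p : Vec n × ℝ) : Bil n :=
  metB (fun y => g y p.2) p.1

/-- The Christoffel map in space-time. -/
def chrST (g : Vec n → ℝ → Matrix (Fin n) (Fin n) ℝ) (p : Vec n × ℝ) : Conn n :=
  chrB (fun y => g y p.2) p.1

theorem contDiffOn_metST (hg : SmoothMetricFamily g (Icc 0 T)) :
    ContDiffOn ℝ (⊤ : ℕ∞) (metST g) (slab n T) :=
  (contDiff_bilinOf (k := ((⊤ : ℕ∞) : WithTop ℕ∞))).comp_contDiffOn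
    (contDiffOn_pi.2 fun i => contDiffOn_pi.2 fun j => hg.1 i j)

theorem contDiffOn_chrST (hT : 0 < T) (hg : SmoothMetricFamily g (Icc 0 T)) :
    ContDiffOn ℝ (⊤ : ℕ∞) (chrST g) (slab n T) := by
  refine (contDiff_bilinOf (k := ((⊤ : ℕ∞) : WithTop ℕ∞))).comp_contDiffOn ?_
  refine contDiffOn_pi.2 fun i => contDiffOn_pi.2 fun j => contDiffOn_pi.2 fun k => ?_
  unfold christoffel
  have hp : ∀ i j k, ContDiffOn ℝ (⊤ : ℕ∞)
      (fun p : Vec n × ℝ => pd (fun y => g y p.2 i j) k p.1) (slab n T) := fun i j k =>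
    (contDiffOn_fderiv_slice hT (hg.1 i j)).clm_apply contDiffOn_const
  refine contDiffOn_const.mul (ContDiffOn.sum fun l _ => ?_)
  have h1 := contDiffOn_inv_entry (M := fun p : Vec n × ℝ => g p.1 p.2) (S := slab n T)
    (fun i j => hg.1 i j) (fun p hp => (hg.2 p.1 p.2 hp.2).2.isUnit) k l
  exact h1.mul (((hp _ _ _).add (hp _ _ _)).sub (hp _ _ _))

theorem flowData_of_ricciFlow (hT : 0 < T) (hg : SmoothMetricFamily g (Icc 0 T))
    (hflow : IsRicciFlow g (Icc 0 T)) : FlowData T (metST g) (chrST g) where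
  smooth_B := contDiffOn_metST hg
  smooth_Γ := contDiffOn_chrST hT hg
  leviCivita := fun t ht => leviCivita_of_smooth (fun x => (hg.2 x t ht).1)
    (fun x => (hg.2 x t ht).2.isUnit) (contDiff_slice (contDiffOn_metST hg) ht)
    (contDiff_slice (contDiffOn_chrST hT hg) ht)
  posDef := fun x t ht => by
    simp only [metST, gram_metB]
    exact (hg.2 x t ht).2
  flow := by
    intro x t ht
    have htI := Ioo_subset_Icc_self ht
    have hΓ : DifferentiableAt ℝ (chrB fun y => g y t) x :=
      (contDiff_slice (contDiffOn_chrST hT hg) htI).differentiable (by simp) x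
    have h1 : HasDerivAt (fun s => (fun i j => g x s i j : Fin n → Fin n → ℝ))
        (fun i j => -2 * ricci (fun y => g y t) x i j) t := by
      refine hasDerivAt_pi.2 fun i => hasDerivAt_pi.2 fun j => ?_
      have h2 := (contDiffAt_of_slab (hg.1 i j) ht x).differentiableAt (by simp)
      have h3 : DifferentiableAt ℝ (fun s : ℝ => (x, s)) t := by fun_prop
      have h4 := (h2.comp t h3).hasDerivAt
      refine h4.congr_deriv ?_
      rw [← hflow x t htI i j, derivWithin_of_mem_nhds (Icc_mem_nhds ht.1 ht.2)]
      rfl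
    have h5 := (bilinOf (n := n) (F := ℝ)).hasFDerivAt.comp_hasDerivAt t h1
    refine h5.congr_deriv ?_
    ext a b
    rw [bilinOf_apply, smul_apply, smul_apply, bilin_expand (ricOf (fun y => chrST g (y, t)) x)]
    simp only [ricci_eq_ricOf hΓ, smul_eq_mul, Finset.mul_sum]
    refine Finset.sum_congr rfl fun i _ => Finset.sum_congr rfl fun j _ => ?_
    change a i * (b j * (-2 * ricOf (chrB fun y => g y t) x (bv i) (bv j)))
      = -2 * (a i * (b j * ricOf (chrB fun y => g y t) x (bv i) (bv j)))
    ring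

theorem scalST_eq_scalarCurv (hT : 0 < T) (hg : SmoothMetricFamily g (Icc 0 T)) (x : Vec n)
    {t : ℝ} (ht : t ∈ Icc 0 T) :
    scalST (metST g) (chrST g) (x, t) = scalarCurv (fun y => g y t) x :=
  (scalarCurv_eq_scalOf
    ((contDiff_slice (contDiffOn_chrST hT hg) ht).differentiable (by simp) x)).symm

end FromMatrices

section Paths

variable {n : ℕ}

/-- `γ` is a continuously differentiable path with velocity `v`. -/
def IsPath (γ v : ℝ → Vec n) : Prop :=
  (∀ s ∈ Icc (0:ℝ) 1, HasDerivWithinAt γ (v s) (Icc 0 1) s) ∧ ContinuousOn v (Icc 0 1)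

/-- The speed of a path. -/
def speed (B : Vec n → Bil n) (γ v : ℝ → Vec n) (s : ℝ) : ℝ := Real.sqrt (B (γ s) (v s) (v s))

/-- `ℓ` is the arc length function of the path `γ`. -/
def IsArcLength (B : Vec n → Bil n) (γ v : ℝ → Vec n) (ℓ : ℝ → ℝ) : Prop :=
  ℓ 0 = 0 ∧ ∀ s ∈ Icc (0:ℝ) 1, HasDerivWithinAt ℓ (speed B γ v s) (Icc 0 1) s

/-- There is a path of length `L` from `x` to `y`. -/
def Reach (B : Vec n → Bil n) (x y : Vec n) (L : ℝ) : Prop :=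
  ∃ γ v ℓ, IsPath γ v ∧ IsArcLength B γ v ℓ ∧ γ 0 = x ∧ γ 1 = y ∧ ℓ 1 = L

theorem zero_mem_unit : (0:ℝ) ∈ Icc (0:ℝ) 1 := ⟨le_rfl, zero_le_one⟩

theorem one_mem_unit : (1:ℝ) ∈ Icc (0:ℝ) 1 := ⟨zero_le_one, le_rfl⟩

variable {B : Vec n → Bil n} {γ v : ℝ → Vec n} {ℓ : ℝ → ℝ}

theorem IsPath.continuousOn (hγ : IsPath γ v) : ContinuousOn γ (Icc 0 1) :=
  fun s hs => (hγ.1 s hs).continuousWithinAt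

theorem IsPath.continuousOn_speed (hB : Continuous B) (hγ : IsPath γ v) :
    ContinuousOn (speed B γ v) (Icc 0 1) :=
  (((hB.comp_continuousOn hγ.continuousOn).clm_apply hγ.2).clm_apply hγ.2).sqrt

theorem hasDerivWithinAt_primitive {f : ℝ → ℝ} (hf : ContinuousOn f (Icc 0 1)) {s : ℝ}
    (hs : s ∈ Icc (0:ℝ) 1) :
    HasDerivWithinAt (fun s => ∫ u in (0:ℝ)..s, f u) (f s) (Icc 0 1) s := by
  have h1 : IntervalIntegrable f volume 0 s :=
    (hf.mono (by rw [uIcc_of_le hs.1]; exact Icc_subset_Icc_right hs.2)).intervalIntegrable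
  have : Fact (s ∈ Icc (0:ℝ) 1) := ⟨hs⟩
  exact intervalIntegral.integral_hasDerivWithinAt_right h1
    (hf.stronglyMeasurableAtFilter_nhdsWithin measurableSet_Icc s) (hf s hs)

theorem IsPath.exists_arcLength (hB : Continuous B) (hγ : IsPath γ v) :
    ∃ ℓ, IsArcLength B γ v ℓ :=
  ⟨fun s => ∫ u in (0:ℝ)..s, speed B γ v u, by simp, fun _ hs =>
    hasDerivWithinAt_primitive (hγ.continuousOn_speed hB) hs⟩

theorem IsArcLength.eq_integral (hB : Continuous B) (hγ : IsPath γ v)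
    (hℓ : IsArcLength B γ v ℓ) : ℓ 1 = ∫ s in (0:ℝ)..1, speed B γ v s := by
  have hc := hγ.continuousOn_speed hB
  rw [intervalIntegral.integral_eq_sub_of_hasDerivAt_of_le zero_le_one (f := ℓ)
    (fun s hs => (hℓ.2 s hs).continuousWithinAt)
    (fun s hs => (hℓ.2 s (Ioo_subset_Icc_self hs)).hasDerivAt (Icc_mem_nhds hs.1 hs.2))
    (hc.mono (by rw [uIcc_of_le zero_le_one])).intervalIntegrable, hℓ.1, sub_zero]

theorem hasDerivWithinAt_Ici_of_Icc {F : Type*} [NormedAddCommGroup F] [NormedSpace ℝ F]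
    {f : ℝ → F} {f' : F} {s : ℝ} (hs : s ∈ Ico (0:ℝ) 1)
    (h : HasDerivWithinAt f f' (Icc 0 1) s) : HasDerivWithinAt f f' (Ici s) s :=
  h.mono_of_mem_nhdsWithin (Filter.mem_of_superset (Icc_mem_nhdsGE hs.2)
    (Icc_subset_Icc_left hs.1))

/-- Comparison of a function with a bound for its derivative. -/
theorem norm_le_of_deriv_le {F : Type*} [NormedAddCommGroup F] [NormedSpace ℝ F]
    {f f' : ℝ → F} {b b' : ℝ → ℝ} {r : ℝ} (hr : r ∈ Icc (0:ℝ) 1)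
    (hf : ∀ s ∈ Icc (0:ℝ) 1, HasDerivWithinAt f (f' s) (Icc 0 1) s)
    (hb : ∀ s ∈ Icc (0:ℝ) 1, HasDerivWithinAt b (b' s) (Icc 0 1) s)
    (h0 : ‖f 0‖ ≤ b 0) (h : ∀ s ∈ Icc 0 r, ‖f' s‖ ≤ b' s) : ‖f r‖ ≤ b r := by
  have hsub : Icc 0 r ⊆ Icc (0:ℝ) 1 := Icc_subset_Icc_right hr.2
  have hsub' : Ico 0 r ⊆ Ico (0:ℝ) 1 := Ico_subset_Ico_right hr.2
  exact image_norm_le_of_norm_deriv_right_le_deriv_boundary' (a := 0) (b := r)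
    (fun s hs => ((hf s (hsub hs)).mono hsub).continuousWithinAt)
    (fun s hs => hasDerivWithinAt_Ici_of_Icc (hsub' hs) (hf s (hsub (Ico_subset_Icc_self hs))))
    h0 (fun s hs => ((hb s (hsub hs)).mono hsub).continuousWithinAt)
    (fun s hs => hasDerivWithinAt_Ici_of_Icc (hsub' hs) (hb s (hsub (Ico_subset_Icc_self hs))))
    (fun s hs => h s (Ico_subset_Icc_self hs)) ⟨hr.1, le_rfl⟩

theorem IsPath.comp (hγ : IsPath γ v) {φ φ' : ℝ → ℝ}
    (hφ : ∀ s ∈ Icc (0:ℝ) 1, HasDerivWithinAt φ (φ' s) (Icc 0 1) s)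
    (hφ' : ContinuousOn φ' (Icc 0 1)) (hm : MapsTo φ (Icc 0 1) (Icc 0 1)) :
    IsPath (fun s => γ (φ s)) (fun s => φ' s • v (φ s)) := by
  refine ⟨fun s hs => (hγ.1 (φ s) (hm hs)).scomp s (hφ s hs) hm, ?_⟩
  exact hφ'.smul (hγ.2.comp (fun s hs => (hφ s hs).continuousWithinAt) hm)

theorem sqrt_quad_smul (Q : Bil n) (r : ℝ) (v : Vec n) :
    Real.sqrt (Q (r • v) (r • v)) = |r| * Real.sqrt (Q v v) := by
  rw [← Real.sqrt_sq_eq_abs, ← Real.sqrt_mul (sq_nonneg r)]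
  congr 1
  simp only [map_smul, smul_apply, smul_eq_mul]
  ring

theorem reach_subpath (hγ : IsPath γ v) (hℓ : IsArcLength B γ v ℓ) {a b : ℝ} (ha : 0 ≤ a)
    (hab : a ≤ b) (hb : b ≤ 1) : Reach B (γ a) (γ b) (ℓ b - ℓ a) := by
  have hφ : ∀ s ∈ Icc (0:ℝ) 1,
      HasDerivWithinAt (fun s => a + s * (b - a)) (b - a) (Icc 0 1) s := fun s _ => by
    simpa using (((hasDerivAt_id s).mul_const (b - a)).const_add a).hasDerivWithinAt
  have hm : MapsTo (fun s => a + s * (b - a)) (Icc 0 1) (Icc 0 1) := by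
    intro s hs
    have h0 : 0 ≤ b - a := by linarith
    constructor
    · have := mul_nonneg hs.1 h0
      simp only
      linarith
    · have := mul_le_mul_of_nonneg_right hs.2 h0
      simp only
      linarith
  refine ⟨_, _, fun s => ℓ (a + s * (b - a)) - ℓ a, hγ.comp hφ continuousOn_const hm, ⟨?_, ?_⟩,
    ?_, ?_, ?_⟩
  · simp
  · intro s hs
    refine (((hℓ.2 _ (hm hs)).scomp s (hφ s hs) hm).sub_const _).congr_deriv ?_
    simp only [speed, sqrt_quad_smul, smul_eq_mul]
    rw [abs_of_nonneg (by linarith)]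
  · simp
  · simp
  · simp

theorem Reach.symm {x y : Vec n} {L : ℝ} (h : Reach B x y L) : Reach B y x L := by
  obtain ⟨γ, v, ℓ, hγ, hℓ, rfl, rfl, rfl⟩ := h
  have hφ : ∀ s ∈ Icc (0:ℝ) 1,
      HasDerivWithinAt (fun s => 1 - s) (-1) (Icc 0 1) s := fun s _ =>
    ((hasDerivAt_id s).const_sub 1).hasDerivWithinAt
  have hm : MapsTo (fun s : ℝ => 1 - s) (Icc 0 1) (Icc 0 1) := fun s hs =>
    ⟨by simp only; linarith [hs.2], by simp only; linarith [hs.1]⟩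
  refine ⟨_, _, fun s => ℓ 1 - ℓ (1 - s), hγ.comp hφ continuousOn_const hm, ⟨?_, ?_⟩,
    ?_, ?_, ?_⟩
  · simp
  · intro s hs
    refine (((hℓ.2 _ (hm hs)).scomp s (hφ s hs) hm).const_sub _).congr_deriv ?_
    simp only [speed, sqrt_quad_smul, smul_eq_mul]
    simp
  · simp
  · simp
  · simp [hℓ.1]

theorem hasDerivAt_posPart_sq (x : ℝ) :
    HasDerivAt (fun x : ℝ => max 0 x ^ 2) (2 * max 0 x) x := by
  rcases lt_trichotomy x 0 with hx | rfl | hx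
  · have h1 : (fun x : ℝ => max 0 x ^ 2) =ᶠ[nhds x] fun _ => 0 := by
      filter_upwards [Iio_mem_nhds hx] with y hy
      simp [max_eq_left (le_of_lt (mem_Iio.1 hy))]
    refine ((hasDerivAt_const x (0:ℝ)).congr_of_eventuallyEq h1).congr_deriv ?_
    rw [max_eq_left hx.le]
    simp
  · rw [hasDerivAt_iff_isLittleO_nhds_zero]
    have h1 : (fun h : ℝ => h ^ 2) =o[nhds 0] fun h : ℝ => h := by
      simpa using Asymptotics.isLittleO_pow_pow (𝕜 := ℝ) (m := 1) (n := 2) (by norm_num)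
    refine (Asymptotics.IsBigO.of_bound 1 ?_).trans_isLittleO h1
    refine Filter.Eventually.of_forall fun h => ?_
    simp only [zero_add, max_self, mul_zero, smul_zero, sub_zero, ne_eq, OfNat.ofNat_ne_zero,
      not_false_eq_true, zero_pow, Real.norm_eq_abs, one_mul, abs_pow]
    have : |max 0 h| ≤ |h| := by
      rw [abs_of_nonneg (le_max_left 0 h)]
      exact max_le (abs_nonneg h) (le_abs_self h)
    gcongr
  · have h1 : (fun x : ℝ => max 0 x ^ 2) =ᶠ[nhds x] fun x => x ^ 2 := by
      filter_upwards [Ioi_mem_nhds hx] with y hy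
      rw [max_eq_right (le_of_lt hy)]
    refine ((hasDerivAt_pow 2 x).congr_of_eventuallyEq h1).congr_deriv ?_
    rw [max_eq_right hx.le]
    simp

theorem Reach.trans {x y z : Vec n} {L M : ℝ} (h₁ : Reach B x y L) (h₂ : Reach B y z M) :
    Reach B x z (L + M) := by
  obtain ⟨γ₁, v₁, ℓ₁, hγ₁, hℓ₁, rfl, rfl, rfl⟩ := h₁
  obtain ⟨γ₂, v₂, ℓ₂, hγ₂, hℓ₂, hy, rfl, rfl⟩ := h₂
  set φ : ℝ → ℝ := fun s => 1 - max 0 (1 - 2 * s) ^ 2 with hφdef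
  set ψ : ℝ → ℝ := fun s => max 0 (2 * s - 1) ^ 2 with hψdef
  set φ' : ℝ → ℝ := fun s => 4 * max 0 (1 - 2 * s) with hφ'def
  set ψ' : ℝ → ℝ := fun s => 4 * max 0 (2 * s - 1) with hψ'def
  have hφ : ∀ s ∈ Icc (0:ℝ) 1, HasDerivWithinAt φ (φ' s) (Icc 0 1) s := fun s _ => by
    have h1 : HasDerivAt (fun s : ℝ => 1 - 2 * s) (-2) s := by
      simpa using ((hasDerivAt_id s).const_mul 2).const_sub 1
    refine ((((hasDerivAt_posPart_sq (1 - 2 * s)).comp s h1).const_sub 1).congr_deriv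
      ?_).hasDerivWithinAt
    simp only [hφ'def]
    ring
  have hψ : ∀ s ∈ Icc (0:ℝ) 1, HasDerivWithinAt ψ (ψ' s) (Icc 0 1) s := fun s _ => by
    have h1 : HasDerivAt (fun s : ℝ => 2 * s - 1) 2 s := by
      simpa using ((hasDerivAt_id s).const_mul 2).sub_const 1
    refine (((hasDerivAt_posPart_sq (2 * s - 1)).comp s h1).congr_deriv ?_).hasDerivWithinAt
    simp only [hψ'def]
    ring
  have hφm : MapsTo φ (Icc 0 1) (Icc 0 1) := fun s hs => by
    have h1 : max 0 (1 - 2 * s) ≤ 1 := max_le zero_le_one (by linarith [hs.1])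
    have h2 := pow_le_one₀ (n := 2) (le_max_left 0 (1 - 2 * s)) h1
    exact ⟨by simp only [hφdef]; linarith, by simp only [hφdef]; nlinarith⟩
  have hψm : MapsTo ψ (Icc 0 1) (Icc 0 1) := fun s hs => by
    have h1 : max 0 (2 * s - 1) ≤ 1 := max_le zero_le_one (by linarith [hs.2])
    have h2 := pow_le_one₀ (n := 2) (le_max_left 0 (2 * s - 1)) h1
    exact ⟨by simp only [hψdef]; positivity, h2⟩
  have hφc : ContinuousOn φ' (Icc 0 1) := by simp only [hφ'def]; fun_prop
  have hψc : ContinuousOn ψ' (Icc 0 1) := by simp only [hψ'def]; fun_prop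
  have hp₁ := hγ₁.comp hφ hφc hφm
  have hp₂ := hγ₂.comp hψ hψc hψm
  refine ⟨fun s => γ₁ (φ s) + γ₂ (ψ s) - γ₁ 1, fun s => φ' s • v₁ (φ s) + ψ' s • v₂ (ψ s),
    fun s => ℓ₁ (φ s) + ℓ₂ (ψ s), ⟨fun s hs => ((hp₁.1 s hs).fun_add (hp₂.1 s hs)).sub_const _,
      hp₁.2.add hp₂.2⟩, ⟨?_, fun s hs => ?_⟩, ?_, ?_, ?_⟩
  · simp [hφdef, hψdef, hℓ₁.1, hℓ₂.1]
  · have h1 := ((hℓ₁.2 _ (hφm hs)).scomp s (hφ s hs) hφm).fun_add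
      ((hℓ₂.2 _ (hψm hs)).scomp s (hψ s hs) hψm)
    refine h1.congr_deriv ?_
    have hφ0 : 0 ≤ φ' s := by simp only [hφ'def]; positivity
    have hψ0 : 0 ≤ ψ' s := by simp only [hψ'def]; positivity
    simp only [speed, smul_eq_mul]
    rcases le_total s (1/2) with h | h
    · have e1 : ψ s = 0 := by simp only [hψdef]; rw [max_eq_left (by linarith)]; simp
      have e2 : ψ' s = 0 := by simp only [hψ'def]; rw [max_eq_left (by linarith)]; simp
      rw [e1, e2, hy, zero_smul, add_zero, add_sub_cancel_right, sqrt_quad_smul,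
        abs_of_nonneg hφ0]
      ring
    · have e1 : φ s = 1 := by simp only [hφdef]; rw [max_eq_left (by linarith)]; simp
      have e2 : φ' s = 0 := by simp only [hφ'def]; rw [max_eq_left (by linarith)]; simp
      rw [e1, e2, zero_smul, zero_add, add_sub_cancel_left, sqrt_quad_smul, abs_of_nonneg hψ0]
      ring
  · simp [hφdef, hψdef, hy]
  · have e : max (0:ℝ) (1 - 2 * 1) = 0 := max_eq_left (by norm_num)
    have e' : max (0:ℝ) (2 * 1 - 1) = 1 := by norm_num
    simp only [hφdef, hψdef, e, e']
    simp
  · have e : max (0:ℝ) (1 - 2 * 1) = 0 := max_eq_left (by norm_num)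
    have e' : max (0:ℝ) (2 * 1 - 1) = 1 := by norm_num
    simp only [hφdef, hψdef, e, e']
    simp

end Paths

section HopfRinow

variable {n : ℕ} {B : Vec n → Bil n}

/-- The points which can be reached from `x` along paths of length less than `r`. -/
def reachBall (B : Vec n → Bil n) (x : Vec n) (r : ℝ) : Set (Vec n) := {y | ∃ L < r, Reach B x y L}

/-- Completeness with respect to path lengths. -/
def PathComplete (B : Vec n → Bil n) : Prop :=
  ∀ u : ℕ → Vec n, (∀ ε > (0:ℝ), ∃ N, ∀ p ≥ N, ∀ q ≥ N, u q ∈ reachBall B (u p) ε) →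
    ∃ x, ∀ ε > (0:ℝ), ∃ N, ∀ p ≥ N, x ∈ reachBall B (u p) ε

theorem IsPath.line (x w : Vec n) : IsPath (fun s => x + s • w) fun _ => w :=
  ⟨fun s _ => by
    simpa using (((hasDerivAt_id s).smul_const w).const_add x).hasDerivWithinAt,
    continuousOn_const⟩

theorem reach_refl (x : Vec n) : Reach B x x 0 := by
  refine ⟨_, _, fun _ => 0, IsPath.line x 0, ⟨rfl, fun s _ => ?_⟩, ?_, ?_, rfl⟩
  · simpa [speed] using hasDerivWithinAt_const s (Icc (0:ℝ) 1) (0:ℝ)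
  · simp
  · simp

theorem speed_nonneg (B : Vec n → Bil n) (γ v : ℝ → Vec n) (s : ℝ) : 0 ≤ speed B γ v s :=
  Real.sqrt_nonneg _

theorem eventually_reach (hB : Continuous B) (y : Vec n) {ε : ℝ} (hε : 0 < ε) :
    ∀ᶠ z in nhds y, z ∈ reachBall B y ε := by
  obtain ⟨C, hC⟩ := (isCompact_closedBall y 1).exists_bound_of_continuousOn hB.continuousOn
  have hC0 : 0 ≤ C := (norm_nonneg _).trans (hC y (Metric.mem_closedBall_self zero_le_one))
  have h1 : ∀ᶠ z in nhds y, ‖z - y‖ < min 1 (ε / (Real.sqrt C + 1)) := by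
    have : 0 < min 1 (ε / (Real.sqrt C + 1)) := lt_min one_pos (by positivity)
    filter_upwards [Metric.ball_mem_nhds y this] with z hz
    rwa [Metric.mem_ball, dist_eq_norm] at hz
  filter_upwards [h1] with z hz
  have hz1 := hz.trans_le (min_le_left _ _)
  have hz2 := hz.trans_le (min_le_right _ _)
  have hp := IsPath.line y (z - y)
  obtain ⟨ℓ, hℓ⟩ := hp.exists_arcLength hB
  refine ⟨ℓ 1, ?_, _, _, ℓ, hp, hℓ, by simp, by simp, rfl⟩
  have hb : ∀ s ∈ Icc (0:ℝ) 1, HasDerivWithinAt (fun s => s * (Real.sqrt C * ‖z - y‖))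
      (Real.sqrt C * ‖z - y‖) (Icc 0 1) s := fun s _ => by
    simpa using ((hasDerivAt_id s).mul_const (Real.sqrt C * ‖z - y‖)).hasDerivWithinAt
  have h2 := norm_le_of_deriv_le one_mem_unit hℓ.2 hb (by simp [hℓ.1]) fun s hs => by
    rw [Real.norm_of_nonneg (speed_nonneg _ _ _ _)]
    have h3 : y + s • (z - y) ∈ Metric.closedBall y 1 := by
      rw [Metric.mem_closedBall, dist_eq_norm, add_sub_cancel_left, norm_smul,
        Real.norm_of_nonneg hs.1]
      nlinarith [norm_nonneg (z - y), hs.1, hs.2]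
    refine Real.sqrt_le_iff.2 ⟨by positivity, ?_⟩
    rw [mul_pow, Real.sq_sqrt hC0]
    calc B (y + s • (z - y)) (z - y) (z - y)
        ≤ ‖B (y + s • (z - y)) (z - y) (z - y)‖ := le_abs_self _
      _ ≤ ‖B (y + s • (z - y))‖ * ‖z - y‖ * ‖z - y‖ := ContinuousLinearMap.le_opNorm₂ _ _ _
      _ ≤ C * ‖z - y‖ * ‖z - y‖ := by gcongr; exact hC _ h3
      _ = C * ‖z - y‖ ^ 2 := by ring
  have h4 : ℓ 1 ≤ Real.sqrt C * ‖z - y‖ := by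
    have := (le_abs_self _).trans h2
    simpa using this
  have h5 : ‖z - y‖ * (Real.sqrt C + 1) < ε := (lt_div_iff₀ (by positivity)).1 hz2
  nlinarith [norm_nonneg (z - y)]

theorem exists_lower_bound {X : Type*} [TopologicalSpace X] {B : X → Bil n} {K : Set X}
    (hB : ContinuousOn B K) (hpos : ∀ x ∈ K, ∀ v, v ≠ 0 → 0 < B x v v) (hK : IsCompact K) :
    ∃ c > 0, ∀ y ∈ K, ∀ v, c * ‖v‖ ≤ Real.sqrt (B y v v) := by
  have hS : IsCompact (K ×ˢ Metric.sphere (0 : Vec n) 1) := hK.prod (isCompact_sphere 0 1)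
  have hf : ContinuousOn (fun p : X × Vec n => Real.sqrt (B p.1 p.2 p.2))
      (K ×ˢ Metric.sphere (0 : Vec n) 1) :=
    (((hB.comp continuousOn_fst fun p hp => hp.1).clm_apply continuousOn_snd).clm_apply
      continuousOn_snd).sqrt
  have key : ∃ c > 0, ∀ p ∈ K ×ˢ Metric.sphere (0 : Vec n) 1,
      c ≤ Real.sqrt (B p.1 p.2 p.2) := by
    rcases (K ×ˢ Metric.sphere (0 : Vec n) 1).eq_empty_or_nonempty with h | h
    · exact ⟨1, one_pos, fun p hp => absurd hp (by rw [h]; exact notMem_empty p)⟩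
    · obtain ⟨p, hp, hmin⟩ := hS.exists_isMinOn h hf
      refine ⟨_, Real.sqrt_pos.2 (hpos p.1 hp.1 p.2 ?_), fun q hq => hmin hq⟩
      intro h0
      have := hp.2
      rw [h0] at this
      simp at this
  obtain ⟨c, hc, hcb⟩ := key
  refine ⟨c, hc, fun y hy v => ?_⟩
  rcases eq_or_ne v 0 with rfl | hv
  · simp
  · have hn : 0 < ‖v‖ := norm_pos_iff.2 hv
    have h1 := hcb (y, ‖v‖⁻¹ • v) ⟨hy, by simp [norm_smul, hn.ne']⟩
    simp only [sqrt_quad_smul, abs_of_nonneg (inv_nonneg.2 hn.le)] at h1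
    rwa [inv_mul_eq_div, le_div_iff₀ hn] at h1

/-- A path which cannot touch the boundary of a ball remains in the ball. -/
theorem IsPath.mem_ball {γ v : ℝ → Vec n} (hγ : IsPath γ v) {x : Vec n} {ρ : ℝ}
    (h : ∀ s ∈ Icc (0:ℝ) 1, (∀ u ∈ Icc 0 s, γ u ∈ Metric.closedBall x ρ) →
      γ s ∈ Metric.ball x ρ) (h0 : γ 0 ∈ Metric.ball x ρ) :
    ∀ s ∈ Icc (0:ℝ) 1, γ s ∈ Metric.ball x ρ := by
  by_contra hcon
  push Not at hcon
  obtain ⟨s₀, hs₀, hbad⟩ := hcon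
  set Z : Set ℝ := Icc (0:ℝ) 1 ∩ γ ⁻¹' {y | ρ ≤ dist y x} with hZ
  have hZc : IsClosed Z := hγ.continuousOn.preimage_isClosed_of_isClosed isClosed_Icc
    (isClosed_le continuous_const (by fun_prop))
  have hZk : IsCompact Z := isCompact_Icc.of_isClosed_subset hZc inter_subset_left
  obtain ⟨s, hs, hleast⟩ := hZk.exists_isLeast ⟨s₀, hs₀, by simpa using hbad⟩
  have hlt : ∀ u ∈ Ico 0 s, γ u ∈ Metric.ball x ρ := by
    intro u hu
    by_contra hu'
    have hu1 : u ∈ Icc (0:ℝ) 1 := ⟨hu.1, hu.2.le.trans hs.1.2⟩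
    have : s ≤ u := hleast ⟨hu1, by simpa using hu'⟩
    exact absurd hu.2 (not_lt.2 this)
  have hs0 : 0 < s := by
    rcases hs.1.1.eq_or_lt with h1 | h1
    · exfalso
      have h2 : ρ ≤ dist (γ s) x := hs.2
      rw [← h1] at h2
      exact absurd h0 (by simpa using h2)
    · exact h1
  have hle : γ s ∈ Metric.closedBall x ρ := by
    have hcl : s ∈ closure (Ico 0 s) := by
      rw [closure_Ico hs0.ne]
      exact ⟨hs0.le, le_rfl⟩
    have hcw : ContinuousWithinAt γ (Ico 0 s) s :=
      (hγ.continuousOn s hs.1).mono fun u hu => ⟨hu.1, hu.2.le.trans hs.1.2⟩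
    have := hcw.mem_closure hcl (fun u hu => Metric.ball_subset_closedBall (hlt u hu))
    rwa [Metric.isClosed_closedBall.closure_eq] at this
  have hfin := h s hs.1 fun u hu => by
    rcases hu.2.eq_or_lt with h1 | h1
    · rw [h1]
      exact hle
    · exact Metric.ball_subset_closedBall (hlt u ⟨hu.1, h1⟩)
  exact absurd hfin (by simpa using hs.2)

theorem IsArcLength.monotoneOn {γ v : ℝ → Vec n} {ℓ : ℝ → ℝ} (hℓ : IsArcLength B γ v ℓ) :
    MonotoneOn ℓ (Icc 0 1) :=
  monotoneOn_of_hasDerivWithinAt_nonneg (convex_Icc 0 1)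
    (f' := speed B γ v) (fun u hu => (hℓ.2 u hu).continuousWithinAt)
    (fun u hu => (hℓ.2 u (interior_subset hu)).mono interior_subset)
    fun _ _ => speed_nonneg _ _ _ _

theorem exists_reachBall_subset (hB : Continuous B) (hpos : ∀ x v, v ≠ 0 → 0 < B x v v)
    (x : Vec n) : ∃ r > 0, Bornology.IsBounded (reachBall B x r) := by
  obtain ⟨c, hc, hcb⟩ := exists_lower_bound hB.continuousOn (fun x _ => hpos x)
    (isCompact_closedBall x 1)
  refine ⟨c, hc, (Metric.isBounded_ball (x := x) (r := 1)).subset ?_⟩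
  rintro y ⟨L, hL, γ, v, ℓ, hγ, hℓ, h0, rfl, rfl⟩
  refine hγ.mem_ball (fun s hs hin => ?_) (by simp [h0]) 1 one_mem_unit
  have h1 := norm_le_of_deriv_le hs (fun u hu => ((hγ.1 u hu).sub_const x))
    (fun u hu => ((hℓ.2 u hu).const_mul c⁻¹)) (by simp [h0, hℓ.1]) fun u hu => by
      rw [inv_mul_eq_div, le_div_iff₀ hc, mul_comm]
      exact hcb _ (hin u hu) _
  have h2 : ℓ s ≤ ℓ 1 := hℓ.monotoneOn hs one_mem_unit hs.2
  rw [Metric.mem_ball, dist_eq_norm]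
  refine h1.trans_lt ?_
  rw [inv_mul_eq_div, div_lt_one hc]
  linarith

theorem exists_halfway (hB : Continuous B) {x : Vec n} {r : ℝ} (hr : 0 < r)
    (hx : ¬ Bornology.IsBounded (reachBall B x r)) :
    ∃ y ∈ reachBall B x r, ¬ Bornology.IsBounded (reachBall B y (3 / 4 * r)) := by
  by_contra! hcon
  have hhalf : Bornology.IsBounded (reachBall B x (r / 2)) := by
    refine (hcon x ⟨0, hr, reach_refl x⟩).subset ?_
    rintro y ⟨L, hL, hy⟩
    exact ⟨L, by linarith, hy⟩
  have hK : IsCompact (closure (reachBall B x (r / 2))) := hhalf.isCompact_closure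
  have key : Bornology.IsBounded {w | ∃ y ∈ closure (reachBall B x (r / 2)),
      w ∈ reachBall B y (r / 2)} := by
    refine hK.induction_on (p := fun S => Bornology.IsBounded
      {w | ∃ y ∈ S, w ∈ reachBall B y (r / 2)}) ?_ ?_ ?_ ?_
    · simp
    · intro S S' hSS' hS'
      exact hS'.subset fun w ⟨y, hy, hw⟩ => ⟨y, hSS' hy, hw⟩
    · intro S S' hS hS'
      refine (hS.union hS').subset ?_
      rintro w ⟨y, hy | hy, hw⟩
      · exact Or.inl ⟨y, hy, hw⟩
      · exact Or.inr ⟨y, hy, hw⟩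
    · intro y hy
      have hV := eventually_reach hB y (show 0 < r / 8 by linarith)
      refine ⟨_, mem_nhdsWithin_of_mem_nhds hV, ?_⟩
      obtain ⟨y', hy', L', hL', hxy'⟩ := mem_closure_iff_nhds.1 hy _ hV
      obtain ⟨M', hM', hyy'⟩ := hy'
      refine (hcon y ⟨_, ?_, hxy'.trans hyy'.symm⟩).subset ?_
      · linarith
      · rintro w ⟨z, ⟨M, hM, hyz⟩, N, hN, hzw⟩
        exact ⟨_, by linarith, hyz.trans hzw⟩
  refine hx (key.subset ?_)
  rintro w ⟨L, hL, γ, v, ℓ, hγ, hℓ, rfl, rfl, rfl⟩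
  have hc : ContinuousOn ℓ (Icc 0 1) := fun u hu => (hℓ.2 u hu).continuousWithinAt
  have h1 : 0 ≤ ℓ 1 := by
    rw [← hℓ.1]
    exact hℓ.monotoneOn zero_mem_unit one_mem_unit zero_le_one
  obtain ⟨s, hs, hs'⟩ := intermediate_value_Icc zero_le_one hc
    (show ℓ 1 / 2 ∈ Icc (ℓ 0) (ℓ 1) by rw [hℓ.1]; exact ⟨by linarith, by linarith⟩)
  refine ⟨γ s, subset_closure ⟨_, ?_, reach_subpath hγ hℓ le_rfl hs.1 hs.2⟩,
    _, ?_, reach_subpath hγ hℓ hs.1 hs.2 le_rfl⟩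
  · rw [hs', hℓ.1]
    linarith
  · rw [hs']
    linarith

/-- In a complete space all metric balls are bounded. -/
theorem PathComplete.isBounded_reachBall (hB : Continuous B)
    (hpos : ∀ x v, v ≠ 0 → 0 < B x v v) (hcomp : PathComplete B) (x : Vec n) {r : ℝ}
    (hr : 0 < r) : Bornology.IsBounded (reachBall B x r) := by
  by_contra hx
  have hstep : ∀ (k : ℕ) (y : Vec n), ¬ Bornology.IsBounded (reachBall B y ((3/4)^k * r)) →
      ∃ y' ∈ reachBall B y ((3/4)^k * r),
        ¬ Bornology.IsBounded (reachBall B y' ((3/4)^(k+1) * r)) := by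
    intro k y hy
    have := exists_halfway hB (show 0 < (3/4)^k * r by positivity) hy
    rw [← mul_assoc, ← pow_succ'] at this
    exact this
  choose! f hf₁ hf₂ using hstep
  set u : ℕ → Vec n := fun k => Nat.rec x (fun k y => f k y) k with hu
  have hub : ∀ k, ¬ Bornology.IsBounded (reachBall B (u k) ((3/4)^k * r)) := by
    intro k
    induction k with
    | zero =>
      change ¬ Bornology.IsBounded (reachBall B x ((3/4)^0 * r))
      simpa using hx
    | succ k ih => exact hf₂ k (u k) ih
  have hus : ∀ k, u (k+1) ∈ reachBall B (u k) ((3/4)^k * r) := fun k => hf₁ k (u k) (hub k)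
  have hum : ∀ k m, ∃ L ≤ 4 * ((3/4)^k * r) - 4 * ((3/4)^(k+m) * r), Reach B (u k) (u (k+m)) L := by
    intro k m
    induction m with
    | zero => exact ⟨0, by simp, reach_refl _⟩
    | succ m ih =>
      obtain ⟨L, hL, h1⟩ := ih
      obtain ⟨M, hM, h2⟩ := hus (k+m)
      refine ⟨L + M, ?_, h1.trans h2⟩
      rw [← add_assoc, pow_succ _ (k+m)]
      linarith
  have hlim : Filter.Tendsto (fun k : ℕ => 4 * ((3/4:ℝ)^k * r)) Filter.atTop (nhds 0) := by
    have := (tendsto_pow_atTop_nhds_zero_of_lt_one (r := (3/4:ℝ)) (by norm_num)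
      (by norm_num)).mul_const r |>.const_mul 4
    simpa using this
  have hsmall : ∀ ε > (0:ℝ), ∃ N, ∀ p ≥ N, 4 * ((3/4)^p * r) < ε := fun ε hε =>
    Filter.eventually_atTop.1 (hlim.eventually (gt_mem_nhds hε))
  obtain ⟨z, hz⟩ := hcomp u (by
    intro ε hε
    obtain ⟨N, hN⟩ := hsmall ε hε
    refine ⟨N, fun p hp q hq => ?_⟩
    rcases le_total p q with hpq | hpq
    · obtain ⟨m, rfl⟩ := Nat.exists_eq_add_of_le hpq
      obtain ⟨L, hL, h1⟩ := hum p m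
      have h2 : 0 ≤ 4 * ((3/4:ℝ)^(p+m) * r) := by positivity
      exact ⟨L, by linarith [hN p hp], h1⟩
    · obtain ⟨m, rfl⟩ := Nat.exists_eq_add_of_le hpq
      obtain ⟨L, hL, h1⟩ := hum q m
      have h2 : 0 ≤ 4 * ((3/4:ℝ)^(q+m) * r) := by positivity
      exact ⟨L, by linarith [hN q hq], h1.symm⟩)
  obtain ⟨ρ, hρ, hbd⟩ := exists_reachBall_subset hB hpos z
  obtain ⟨N₁, hN₁⟩ := hz (ρ/2) (by linarith)
  obtain ⟨N₂, hN₂⟩ := hsmall (ρ/2) (by linarith)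
  obtain ⟨L, hL, h1⟩ := hN₁ (max N₁ N₂) (le_max_left _ _)
  have h2 := hN₂ (max N₁ N₂) (le_max_right _ _)
  refine hub (max N₁ N₂) (hbd.subset ?_)
  rintro w ⟨M, hM, hw⟩
  refine ⟨_, ?_, h1.symm.trans hw⟩
  have h3 : 0 ≤ (3/4:ℝ)^(max N₁ N₂) * r := by positivity
  linarith

end HopfRinow

section Confinement

variable {n : ℕ}

theorem pathLength_eq {G : Vec n → Matrix (Fin n) (Fin n) ℝ} {γ v : ℝ → Vec n}
    (hγ : IsPath γ v) : pathLength G γ = ∫ s in (0:ℝ)..1, speed (metB G) γ v s := by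
  refine intervalIntegral.integral_congr_Ioo_of_le zero_le_one fun s hs => ?_
  have h1 : deriv γ s = v s :=
    ((hγ.1 s (Ioo_subset_Icc_self hs)).hasDerivAt (Icc_mem_nhds hs.1 hs.2)).deriv
  simp only [speed, metB, bilinOf_apply, h1, smul_eq_mul]
  congr 1
  refine Finset.sum_congr rfl fun i _ => Finset.sum_congr rfl fun j _ => ?_
  ring

theorem isPath_of_contDiffOn {γ : ℝ → Vec n} (hγ : ContDiffOn ℝ 1 γ (Icc 0 1)) :
    IsPath γ (derivWithin γ (Icc 0 1)) := by
  have h1 := (contDiffOn_one_iff_derivWithin (uniqueDiffOn_Icc zero_lt_one)).1 hγ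
  exact ⟨fun s hs => (h1.1 s hs).hasDerivWithinAt, h1.2⟩

theorem IsPath.contDiffOn {γ v : ℝ → Vec n} (hγ : IsPath γ v) : ContDiffOn ℝ 1 γ (Icc 0 1) :=
  (contDiffOn_one_iff_derivWithin (uniqueDiffOn_Icc zero_lt_one)).2
    ⟨fun s hs => (hγ.1 s hs).differentiableWithinAt, hγ.2.congr fun s hs =>
      (hγ.1 s hs).derivWithin (uniqueDiffOn_Icc zero_lt_one s hs)⟩

theorem riemDist_lt_iff {G : Vec n → Matrix (Fin n) (Fin n) ℝ} (hG : Continuous (metB G))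
    {x y : Vec n} {r : ℝ} : riemDist G x y < r ↔ y ∈ reachBall (metB G) x r := by
  constructor
  · intro h
    obtain ⟨L, ⟨γ, hγ, h0, h1, rfl⟩, hL⟩ := exists_lt_of_csInf_lt (by
      have hp := IsPath.line x (y - x)
      exact ⟨_, _, hp.contDiffOn, by simp, by simp, rfl⟩) h
    have hp := isPath_of_contDiffOn hγ
    obtain ⟨ℓ, hℓ⟩ := hp.exists_arcLength hG
    refine ⟨_, ?_, γ, _, ℓ, hp, hℓ, h0, h1, rfl⟩
    rwa [hℓ.eq_integral hG hp, ← pathLength_eq hp]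
  · rintro ⟨L, hL, γ, v, ℓ, hp, hℓ, h0, h1, rfl⟩
    refine csInf_lt_of_lt ⟨0, ?_⟩ ⟨γ, hp.contDiffOn, h0, h1, rfl⟩ ?_
    · rintro M ⟨γ, -, -, -, rfl⟩
      exact intervalIntegral.integral_nonneg zero_le_one fun s _ => Real.sqrt_nonneg _
    · rwa [pathLength_eq hp, ← hℓ.eq_integral hG hp]

theorem pathComplete_of_riemComplete {G : Vec n → Matrix (Fin n) (Fin n) ℝ}
    (hG : Continuous (metB G)) (h : riemComplete G) : PathComplete (metB G) := by
  intro u hu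
  simp only [← riemDist_lt_iff hG] at hu ⊢
  exact h u hu

/-- Paths of bounded length from a fixed point stay in a fixed ball, locally uniformly in time. -/
theorem exists_ball_forall_path {B : ℝ → Vec n → Bil n}
    (hB : Continuous fun p : ℝ × Vec n => B p.1 p.2)
    (hpos : ∀ t x v, v ≠ 0 → 0 < B t x v v) (hcomp : ∀ t, PathComplete (B t))
    {I : Set ℝ} (hI : IsCompact I) (x : Vec n) {A : ℝ} (hA : 0 < A) :
    ∃ ρ, ∀ t ∈ I, ∀ γ v ℓ, IsPath γ v → IsArcLength (B t) γ v ℓ → γ 0 = x → ℓ 1 < A →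
      ∀ s ∈ Icc (0:ℝ) 1, γ s ∈ Metric.ball x ρ := by
  have hBt : ∀ t, Continuous (B t) := fun t => hB.comp (by fun_prop : Continuous fun x => (t, x))
  refine hI.induction_on (p := fun I => ∃ ρ, ∀ t ∈ I, ∀ γ v ℓ, IsPath γ v →
    IsArcLength (B t) γ v ℓ → γ 0 = x → ℓ 1 < A → ∀ s ∈ Icc (0:ℝ) 1, γ s ∈ Metric.ball x ρ)
    ?_ ?_ ?_ ?_
  · exact ⟨0, fun t ht => absurd ht (notMem_empty t)⟩
  · rintro S S' hS ⟨ρ, h⟩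
    exact ⟨ρ, fun t ht => h t (hS ht)⟩
  · rintro S S' ⟨ρ, h⟩ ⟨ρ', h'⟩
    refine ⟨max ρ ρ', fun t ht γ v ℓ h1 h2 h3 h4 s hs => ?_⟩
    rcases ht with ht | ht
    · exact Metric.ball_subset_ball (le_max_left _ _) (h t ht γ v ℓ h1 h2 h3 h4 s hs)
    · exact Metric.ball_subset_ball (le_max_right _ _) (h' t ht γ v ℓ h1 h2 h3 h4 s hs)
  · intro t₁ _
    have hbd := (hcomp t₁).isBounded_reachBall (hBt t₁) (hpos t₁) x
      (show 0 < 2 * A by linarith)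
    obtain ⟨ρ, hρ⟩ := hbd.subset_ball x
    have hK : IsCompact (Metric.closedBall x ρ ×ˢ Metric.sphere (0 : Vec n) 1) :=
      (isCompact_closedBall x ρ).prod (isCompact_sphere 0 1)
    have hnear : ∀ᶠ t in nhds t₁, ∀ p ∈ Metric.closedBall x ρ ×ˢ Metric.sphere (0 : Vec n) 1,
        B t₁ p.1 p.2 p.2 < 4 * B t p.1 p.2 p.2 := by
      refine hK.eventually_forall_of_forall_eventually fun p hp => ?_
      have hc1 : Continuous fun q : ℝ × Vec n × Vec n => B t₁ q.2.1 q.2.2 q.2.2 :=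
        (((hBt t₁).comp (by fun_prop)).clm_apply (by fun_prop)).clm_apply (by fun_prop)
      have hc2 : Continuous fun q : ℝ × Vec n × Vec n => 4 * B q.1 q.2.1 q.2.2 q.2.2 :=
        continuous_const.mul (((hB.comp
          (by fun_prop : Continuous fun q : ℝ × Vec n × Vec n => (q.1, q.2.1))).clm_apply
          (by fun_prop)).clm_apply (by fun_prop))
      have hp2 : p.2 ≠ 0 := by
        intro h0
        have := hp.2
        rw [h0] at this
        simp at this
      have h0 := hpos t₁ p.1 p.2 hp2
      exact (hc1.tendsto (t₁, p)).eventually_lt (hc2.tendsto (t₁, p)) (by simp only; linarith)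
    refine ⟨_, mem_nhdsWithin_of_mem_nhds hnear, ρ, fun t ht γ v ℓ hγ hℓ h0 hA' => ?_⟩
    have hx : x ∈ Metric.ball x ρ := hρ ⟨0, by linarith, reach_refl x⟩
    refine hγ.mem_ball (fun s hs hin => ?_) (by rw [h0]; exact hx)
    obtain ⟨ℓ₁, hℓ₁⟩ := hγ.exists_arcLength (hBt t₁)
    have hle := norm_le_of_deriv_le hs hℓ₁.2 (fun u hu => (hℓ.2 u hu).const_mul 2)
      (by simp [hℓ.1, hℓ₁.1]) fun u hu => by
        rw [Real.norm_of_nonneg (speed_nonneg _ _ _ _), speed, speed]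
        have hq : B t₁ (γ u) (v u) (v u) ≤ 4 * B t (γ u) (v u) (v u) := by
          rcases eq_or_ne (v u) 0 with h | h
          · simp [h]
          · have hn : 0 < ‖v u‖ := norm_pos_iff.2 h
            have h1 := ht (γ u, ‖v u‖⁻¹ • v u) ⟨hin u hu, by simp [norm_smul, hn.ne']⟩
            simp only [map_smul, smul_apply, smul_eq_mul] at h1
            have h2 : (‖v u‖⁻¹ * ‖v u‖⁻¹) * B t₁ (γ u) (v u) (v u)
                < (‖v u‖⁻¹ * ‖v u‖⁻¹) * (4 * B t (γ u) (v u) (v u)) := by linarith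
            exact (lt_of_mul_lt_mul_left h2 (by positivity)).le
        rw [show (2:ℝ) = Real.sqrt 4 by
          rw [show (4:ℝ) = 2 ^ 2 by norm_num]; exact (Real.sqrt_sq zero_le_two).symm,
          ← Real.sqrt_mul (by norm_num)]
        exact Real.sqrt_le_sqrt hq
    have hmono := hℓ.monotoneOn hs one_mem_unit hs.2
    have hr := reach_subpath hγ hℓ₁ le_rfl hs.1 hs.2
    rw [h0] at hr
    refine hρ ⟨_, ?_, hr⟩
    rw [hℓ₁.1]
    have := (le_abs_self _).trans hle
    linarith

end Confinement

section VariationJets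

variable {n : ℕ}

/-- The position of the varied path. -/
def varPoint (Γ : Conn n) (x e : Vec n) (η r : ℝ) : Vec n :=
  x + (r * η) • e - (r ^ 2 / 2 * η ^ 2) • Γ e e

/-- The velocity of the varied path. -/
def varVel (Γ : Conn n) (D : Vec n →L[ℝ] Conn n) (u e : Vec n) (η ζ r : ℝ) : Vec n :=
  u + r • (ζ • e - η • Γ u e)
    - (r ^ 2 / 2) • ((2 * η * ζ) • Γ e e + η ^ 2 • (D u e e - (2:ℝ) • Γ (Γ u e) e))

theorem varPoint_zero (Γ : Conn n) (x e : Vec n) (η : ℝ) : varPoint Γ x e η 0 = x := by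
  simp [varPoint]

theorem varVel_zero (Γ : Conn n) (D : Vec n →L[ℝ] Conn n) (u e : Vec n) (η ζ : ℝ) :
    varVel Γ D u e η ζ 0 = u := by
  simp [varVel]

theorem hasDerivAt_varPoint (Γ : Conn n) (x e : Vec n) (η r : ℝ) :
    HasDerivAt (varPoint Γ x e η) (η • e - (r * η ^ 2) • Γ e e) r := by
  have h1 : HasDerivAt (fun r : ℝ => r * η) η r := by
    simpa using (hasDerivAt_id r).mul_const η
  have h2 : HasDerivAt (fun r : ℝ => r ^ 2 / 2 * η ^ 2) (r * η ^ 2) r := by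
    refine ((((hasDerivAt_id r).pow 2).div_const 2).mul_const (η ^ 2)).congr_deriv ?_
    simp
  exact ((h1.smul_const e).const_add x).sub (h2.smul_const _)

theorem hasDerivAt_varVel (Γ : Conn n) (D : Vec n →L[ℝ] Conn n) (u e : Vec n) (η ζ r : ℝ) :
    HasDerivAt (varVel Γ D u e η ζ) (ζ • e - η • Γ u e
      - r • ((2 * η * ζ) • Γ e e + η ^ 2 • (D u e e - (2:ℝ) • Γ (Γ u e) e))) r := by
  have h2 : HasDerivAt (fun r : ℝ => r ^ 2 / 2) r r := by
    refine (((hasDerivAt_id r).pow 2).div_const 2).congr_deriv ?_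
    simp
  refine (((((hasDerivAt_id r).smul_const _).const_add u).sub (h2.smul_const _))).congr_deriv ?_
  simp

namespace LeviCivita

variable {g : Vec n → Bil n} {Γ : Vec n → Conn n} (h : LeviCivita g Γ)
include h

theorem hasDerivWithinAt_apply {c p q : ℝ → Vec n} {c' p' q' : Vec n} {S : Set ℝ} {r : ℝ}
    (hc : HasDerivWithinAt c c' S r) (hp : HasDerivWithinAt p p' S r)
    (hq : HasDerivWithinAt q q' S r) :
    HasDerivWithinAt (fun r => g (c r) (p r) (q r))
      (g (c r) (p' + Γ (c r) c' (p r)) (q r) + g (c r) (p r) (q' + Γ (c r) c' (q r))) S r := by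
  have h1 : HasDerivWithinAt (fun r => g (c r)) (fderiv ℝ g (c r) c') S r :=
    (h.differentiable_g (c r)).hasFDerivAt.comp_hasDerivWithinAt r hc
  refine ((h1.clm_apply hp).clm_apply hq).congr_deriv ?_
  simp only [add_apply, h.compat, map_add]
  ring

theorem hasDerivAt_apply {c p q : ℝ → Vec n} {c' p' q' : Vec n} {r : ℝ} (hc : HasDerivAt c c' r)
    (hp : HasDerivAt p p' r) (hq : HasDerivAt q q' r) :
    HasDerivAt (fun r => g (c r) (p r) (q r))
      (g (c r) (p' + Γ (c r) c' (p r)) (q r) + g (c r) (p r) (q' + Γ (c r) c' (q r))) r := by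
  rw [← hasDerivWithinAt_univ] at *
  exact h.hasDerivWithinAt_apply hc hp hq

theorem hasTwoJet_variation (x u e : Vec n) (η ζ : ℝ) :
    HasTwoJet (fun r => g (varPoint (Γ x) x e η r) (varVel (Γ x) (fderiv ℝ Γ x) u e η ζ r)
        (varVel (Γ x) (fderiv ℝ Γ x) u e η ζ r))
      (2 * ζ * g x e u) (2 * ζ ^ 2 * g x e e + 2 * η ^ 2 * g x (curvOf Γ x e u e) u) := by
  set D := fderiv ℝ Γ x with hD
  set P := (2 * η * ζ) • Γ x e e + η ^ 2 • (D u e e - (2:ℝ) • Γ x (Γ x u e) e) with hP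
  set c := varPoint (Γ x) x e η with hc
  set p := varVel (Γ x) D u e η ζ with hp
  set c' : ℝ → Vec n := fun r => η • e - (r * η ^ 2) • Γ x e e with hc'
  set p' : ℝ → Vec n := fun r => ζ • e - η • Γ x u e - r • P with hp'
  have dc : ∀ r, HasDerivAt c (c' r) r := hasDerivAt_varPoint _ _ _ _
  have dp : ∀ r, HasDerivAt p (p' r) r := hasDerivAt_varVel _ _ _ _ _ _
  have c0 : c 0 = x := varPoint_zero _ _ _ _
  have p0 : p 0 = u := varVel_zero _ _ _ _ _ _
  set q : ℝ → Vec n := fun r => p' r + Γ (c r) (c' r) (p r) with hq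
  have q0 : q 0 = ζ • e := by
    simp only [hq, hp', hc', c0, p0, zero_smul, zero_mul, sub_zero, map_smul, smul_apply]
    rw [h.Γ_symm x e u]
    abel
  refine ⟨fun r => 2 * g (c r) (q r) (p r), ?_, ?_, ?_⟩
  · refine Filter.Eventually.of_forall fun r => ?_
    refine (h.hasDerivAt_apply (dc r) (dp r) (dp r)).congr_deriv ?_
    rw [h.g_symm _ (p r)]
    simp only [hq]
    ring
  · simp only [q0, c0, p0, map_smul, smul_apply, smul_eq_mul]
    ring
  · have dp' : HasDerivAt p' (-P) 0 := by
      simpa using ((hasDerivAt_id (0:ℝ)).smul_const P).const_sub (ζ • e - η • Γ x u e)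
    have dc' : HasDerivAt c' (-(η ^ 2 • Γ x e e)) 0 := by
      have h1 : HasDerivAt (fun r : ℝ => r * η ^ 2) (η ^ 2) 0 := by
        simpa using (hasDerivAt_id (0:ℝ)).mul_const (η ^ 2)
      exact (h1.smul_const (Γ x e e)).const_sub (η • e)
    have dΓ : HasDerivAt (fun r => Γ (c r)) (D (η • e)) 0 := by
      have h1 := (h.differentiable_Γ (c 0)).hasFDerivAt.comp_hasDerivAt 0 (dc 0)
      rw [c0] at h1
      have e : c' 0 = η • e := by simp [hc']
      rw [e] at h1
      exact h1
    have dq : HasDerivAt q (-P + (D (η • e) (c' 0) u + Γ x (-(η ^ 2 • Γ x e e)) u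
        + Γ x (c' 0) (p' 0))) 0 := by
      refine (dp'.add ((dΓ.clm_apply dc').clm_apply (dp 0))).congr_deriv ?_
      simp only [add_apply, c0, p0]
    have hd := (h.hasDerivAt_apply (dc 0) dq (dp 0)).const_mul 2
    refine hd.congr_deriv ?_
    have e1 : p' 0 + Γ x (c' 0) u = ζ • e := by
      have := q0
      simp only [hq, c0, p0] at this
      exact this
    have e2 : -P + (D (η • e) (c' 0) u + Γ x (-(η ^ 2 • Γ x e e)) u
        + Γ x (c' 0) (p' 0)) + Γ x (c' 0) (ζ • e) = η ^ 2 • curvOf Γ x e u e := by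
      have hs : D e e u = D e u e := by
        have h1 := fderiv_clm_apply₂ (h.differentiable_Γ x) (differentiableAt_const e)
          (differentiableAt_const u) e
        have h2 := fderiv_clm_apply₂ (h.differentiable_Γ x) (differentiableAt_const u)
          (differentiableAt_const e) e
        simp only [fderiv_fun_const, Pi.zero_apply, zero_apply, map_zero, add_zero] at h1 h2
        rw [hD, ← h1, ← h2]
        simp_rw [fun y => h.Γ_symm y e u]
      simp only [hP, hc', hp', curvOf, ← hD, zero_smul, zero_mul, sub_zero, map_smul, smul_apply,
        map_sub, map_neg, neg_apply, hs, h.Γ_symm x (Γ x u e) e, h.Γ_symm x (Γ x e e) u]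
      module
    rw [c0, p0, q0, e1, e2]
    simp only [map_smul, smul_apply, smul_eq_mul]
    ring

end LeviCivita

theorem hasTwoJet_comp_varPoint {f : Vec n → ℝ} (hf : ContDiff ℝ (⊤ : ℕ∞) f) (Γ : Conn n)
    (x e : Vec n) :
    HasTwoJet (fun r => f (varPoint Γ x e 1 r)) (fderiv ℝ f x e)
      (fderiv ℝ (fderiv ℝ f) x e e - fderiv ℝ f x (Γ e e)) := by
  have hd : Differentiable ℝ f := hf.differentiable (by simp)
  have hdd : Differentiable ℝ (fderiv ℝ f) :=
    (hf.fderiv_right (m := 1) (by norm_cast)).differentiable (by simp)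
  have dc := hasDerivAt_varPoint Γ x e 1
  refine ⟨fun r => fderiv ℝ f (varPoint Γ x e 1 r) ((1:ℝ) • e - (r * 1 ^ 2) • Γ e e), ?_, ?_, ?_⟩
  · exact Filter.Eventually.of_forall fun r => (hd _).hasFDerivAt.comp_hasDerivAt r (dc r)
  · simp [varPoint_zero]
  · have h1 := (hdd (varPoint Γ x e 1 0)).hasFDerivAt.comp_hasDerivAt 0 (dc 0)
    have h2 : HasDerivAt (fun r : ℝ => r * 1 ^ 2) 1 0 := by
      exact ((hasDerivAt_id (0:ℝ)).mul_const ((1:ℝ) ^ 2)).congr_deriv (by norm_num)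
    have h3 := (h2.smul_const (Γ e e)).const_sub ((1:ℝ) • e)
    refine (h1.clm_apply h3).congr_deriv ?_
    simp [varPoint_zero, sub_eq_add_neg]

theorem hasTwoJet_comp_neg_sq {f f' : ℝ → ℝ} {t : ℝ} (hf : ∀ᶠ s in nhds t, HasDerivAt f (f' s) s)
    (hc : ContinuousAt f' t) : HasTwoJet (fun r => f (t - r ^ 2)) 0 (-2 * f' t) := by
  have h0 : Filter.Tendsto (fun r : ℝ => t - r ^ 2) (nhds 0) (nhds t) := by
    have : Continuous fun r : ℝ => t - r ^ 2 := by fun_prop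
    simpa using this.tendsto 0
  refine ⟨fun r => f' (t - r ^ 2) * (-2 * r), ?_, by simp, ?_⟩
  · filter_upwards [h0.eventually hf] with r hr
    have h1 : HasDerivAt (fun r : ℝ => t - r ^ 2) (-2 * r) r := by
      simpa using ((hasDerivAt_id r).pow 2).const_sub t
    exact hr.comp r h1
  · rw [hasDerivAt_iff_tendsto_slope]
    have h1 : Filter.Tendsto (fun r => -2 * f' (t - r ^ 2)) (nhds 0) (nhds (-2 * f' t)) :=
      (hc.tendsto.comp h0).const_mul (-2)
    refine (h1.mono_left nhdsWithin_le_nhds).congr' ?_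
    filter_upwards [self_mem_nhdsWithin] with r hr
    have hr : r ≠ 0 := hr
    simp only [slope_def_field]
    field_simp
    ring

theorem hasTwoJet_quadratic {f f' : ℝ → ℝ} {f'' L a β : ℝ}
    (hf : ∀ᶠ s in nhds L, HasDerivAt f (f' s) s) (hf' : HasDerivAt f' f'' L) :
    HasTwoJet (fun r => f (L + r * a + r ^ 2 / 2 * β)) (f' L * a) (f' L * β + f'' * a ^ 2) := by
  have h1 : ∀ r : ℝ, HasDerivAt (fun r : ℝ => L + r * a + r ^ 2 / 2 * β) (a + r * β) r := by
    intro r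
    refine ((((hasDerivAt_id r).mul_const a).const_add L).add
      ((((hasDerivAt_id r).pow 2).div_const 2).mul_const β)).congr_deriv ?_
    simp
  have h0 : Filter.Tendsto (fun r : ℝ => L + r * a + r ^ 2 / 2 * β) (nhds 0) (nhds L) := by
    have := (h1 0).continuousAt.tendsto
    simpa using this
  refine ⟨fun r => f' (L + r * a + r ^ 2 / 2 * β) * (a + r * β), ?_, by simp, ?_⟩
  · filter_upwards [h0.eventually hf] with r hr
    exact hr.comp r (h1 r)
  · have e0 : L + 0 * a + 0 ^ 2 / 2 * β = L := by ring
    have h2 : HasDerivAt (fun r : ℝ => f' (L + r * a + r ^ 2 / 2 * β)) (f'' * (a + 0 * β)) 0 :=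
      HasDerivAt.comp (h₂ := f') (0:ℝ) (by rw [e0]; exact hf') (h1 0)
    have h3 : HasDerivAt (fun r : ℝ => a + r * β) β 0 := by
      simpa using ((hasDerivAt_id (0:ℝ)).mul_const β).const_add a
    refine (h2.mul h3).congr_deriv ?_
    rw [e0]
    ring

end VariationJets

section UniformVariation

variable {n : ℕ} {T : ℝ}

theorem contDiffAt_varPoint {Q : Type*} [NormedAddCommGroup Q] [NormedSpace ℝ Q] {q : Q}
    {k : WithTop ℕ∞} {Γ : Q → Conn n} {x e : Q → Vec n} {η r : Q → ℝ} (hΓ : ContDiffAt ℝ k Γ q)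
    (hx : ContDiffAt ℝ k x q) (he : ContDiffAt ℝ k e q) (hη : ContDiffAt ℝ k η q)
    (hr : ContDiffAt ℝ k r q) :
    ContDiffAt ℝ k (fun q => varPoint (Γ q) (x q) (e q) (η q) (r q)) q := by
  unfold varPoint
  exact (hx.add ((hr.mul hη).smul he)).sub
    ((((hr.pow 2).div_const 2).mul (hη.pow 2)).smul ((hΓ.clm_apply he).clm_apply he))

theorem contDiffAt_varVel {Q : Type*} [NormedAddCommGroup Q] [NormedSpace ℝ Q] {q : Q}
    {k : WithTop ℕ∞} {Γ : Q → Conn n} {D : Q → Vec n →L[ℝ] Conn n} {u e : Q → Vec n}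
    {η ζ r : Q → ℝ} (hΓ : ContDiffAt ℝ k Γ q) (hD : ContDiffAt ℝ k D q)
    (hu : ContDiffAt ℝ k u q) (he : ContDiffAt ℝ k e q) (hη : ContDiffAt ℝ k η q)
    (hζ : ContDiffAt ℝ k ζ q) (hr : ContDiffAt ℝ k r q) :
    ContDiffAt ℝ k (fun q => varVel (Γ q) (D q) (u q) (e q) (η q) (ζ q) (r q)) q := by
  unfold varVel
  have h1 : ContDiffAt ℝ k (fun q => Γ q (u q) (e q)) q := (hΓ.clm_apply hu).clm_apply he
  exact (hu.add (hr.smul ((hζ.smul he).sub (hη.smul h1)))).sub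
    (((hr.pow 2).div_const 2).smul
      ((((contDiffAt_const.mul hη).mul hζ).smul ((hΓ.clm_apply he).clm_apply he)).add
      ((hη.pow 2).smul ((((hD.clm_apply hu).clm_apply he).clm_apply he).sub
        ((contDiffAt_const (c := (2:ℝ))).smul ((hΓ.clm_apply h1).clm_apply he))))))

namespace FlowData

variable {B : Vec n × ℝ → Bil n} {Γ : Vec n × ℝ → Conn n} (h : FlowData T B Γ)
include h

theorem pos {p : Vec n × ℝ} (hp : p.2 ∈ Icc 0 T) {v : Vec n} (hv : v ≠ 0) : 0 < B p v v := by
  have h1 := (h.posDef p.1 p.2 hp).dotProduct_mulVec_pos hv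
  have h2 : B p v v = star v ⬝ᵥ (gram (B p) *ᵥ v) := by
    rw [bilin_expand]
    simp only [dotProduct, Matrix.mulVec, gram, Matrix.of_apply, Finset.mul_sum, Pi.star_apply,
      star_trivial, smul_eq_mul]
    refine Finset.sum_congr rfl fun i _ => Finset.sum_congr rfl fun j _ => ?_
    ring
  rw [h2]
  exact h1

theorem nonneg {p : Vec n × ℝ} (hp : p.2 ∈ Icc 0 T) (v : Vec n) : 0 ≤ B p v v := by
  rcases eq_or_ne v 0 with rfl | hv
  · simp
  · exact (h.pos hp hv).le

theorem exists_norm_le {K : Set (Vec n × ℝ)} (hK : IsCompact K) (hKT : K ⊆ slab n T) :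
    ∃ r, ∀ p ∈ K, ∀ v, B p v v ≤ 1 → ‖v‖ ≤ r := by
  obtain ⟨c, hc, hcb⟩ := exists_lower_bound (h.smooth_B.continuousOn.mono hKT)
    (fun p hp v hv => h.pos (hKT hp).2 hv) hK
  refine ⟨1 / c, fun p hp v hv => ?_⟩
  rw [le_div_iff₀' hc]
  exact (hcb p hp v).trans (Real.sqrt_le_one.2 hv)

theorem exists_ric_le (hT : 0 < T) {K : Set (Vec n × ℝ)} (hK : IsCompact K)
    (hKT : K ⊆ slab n T) :
    ∃ C, ∀ p ∈ K, ∀ v, B p v v ≤ 1 → |ricST Γ p v v| ≤ C := by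
  obtain ⟨r, hr⟩ := h.exists_norm_le hK hKT
  obtain ⟨C, hC⟩ := hK.exists_bound_of_continuousOn ((h.smooth_ric hT).continuousOn.mono hKT)
  refine ⟨C * r * r, fun p hp v hv => ?_⟩
  have h1 := (hr p hp v hv)
  have h2 := hC p hp
  calc |ricST Γ p v v| ≤ ‖ricST Γ p‖ * ‖v‖ * ‖v‖ := (ricST Γ p).le_opNorm₂ v v
    _ ≤ C * r * r := by
      have := (norm_nonneg _).trans h2
      have := (norm_nonneg _).trans h1
      gcongr

theorem uniform_variation (hT : 0 < T) {K : Set (Vec n)} (hK : IsCompact K) {t₁ t₂ : ℝ}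
    (ht₁ : 0 < t₁) (ht₂ : t₂ < T) {ω : ℝ} (hω : 0 < ω) :
    ∃ ε > 0, ∃ M, ∀ x ∈ K, ∀ t ∈ Icc t₁ t₂, ∀ u e : Vec n, B (x, t) u u ≤ 1 → B (x, t) e e ≤ 1 →
      ∀ η ∈ Icc (0:ℝ) 1, ∀ ζ ∈ Icc (0:ℝ) 2,
      |2 * ζ ^ 2 * B (x, t) e e
        + 2 * η ^ 2 * B (x, t) (curvOf (fun y => Γ (y, t)) x e u e) u| ≤ M ∧
      ∀ r, |r| ≤ ε →
        |B (varPoint (Γ (x, t)) x e η r, t)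
            (varVel (Γ (x, t)) (fderiv ℝ (fun y => Γ (y, t)) x) u e η ζ r)
            (varVel (Γ (x, t)) (fderiv ℝ (fun y => Γ (y, t)) x) u e η ζ r)
          - B (x, t) u u - r * (2 * ζ * B (x, t) e u)
          - r ^ 2 / 2 * (2 * ζ ^ 2 * B (x, t) e e
            + 2 * η ^ 2 * B (x, t) (curvOf (fun y => Γ (y, t)) x e u e) u)| ≤ ω * r ^ 2 := by
  have hsub : ∀ t ∈ Icc t₁ t₂, t ∈ Ioo 0 T := fun t ht => ⟨ht₁.trans_le ht.1, ht.2.trans_lt ht₂⟩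
  have hsubI : ∀ t ∈ Icc t₁ t₂, t ∈ Icc 0 T := fun t ht => Ioo_subset_Icc_self (hsub t ht)
  obtain ⟨R, hR⟩ := h.exists_norm_le (hK.prod (isCompact_Icc (a := t₁) (b := t₂)))
    (fun p hp => ⟨mem_univ _, hsubI p.2 hp.2⟩)
  set Z : Set (Vec n × ℝ × Vec n × Vec n × ℝ × ℝ) :=
    K ×ˢ Icc t₁ t₂ ×ˢ Metric.closedBall 0 R ×ˢ Metric.closedBall 0 R ×ˢ Icc 0 1 ×ˢ Icc 0 2 with hZ
  have hZc : IsCompact Z := hK.prod (isCompact_Icc.prod ((isCompact_closedBall _ _).prod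
    ((isCompact_closedBall _ _).prod (isCompact_Icc.prod isCompact_Icc))))
  set F : ℝ × (Vec n × ℝ × Vec n × Vec n × ℝ × ℝ) → ℝ := fun q =>
    B (varPoint (Γ (q.2.1, q.2.2.1)) q.2.1 q.2.2.2.2.1 q.2.2.2.2.2.1 q.1, q.2.2.1)
      (varVel (Γ (q.2.1, q.2.2.1)) (fderiv ℝ (fun y => Γ (y, q.2.2.1)) q.2.1) q.2.2.2.1 q.2.2.2.2.1
        q.2.2.2.2.2.1 q.2.2.2.2.2.2 q.1)
      (varVel (Γ (q.2.1, q.2.2.1)) (fderiv ℝ (fun y => Γ (y, q.2.2.1)) q.2.1) q.2.2.2.1 q.2.2.2.2.1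
        q.2.2.2.2.2.1 q.2.2.2.2.2.2 q.1) with hF
  have key := uniform_taylor (F := F)
    (f₁ := fun z => 2 * z.2.2.2.2.2 * B (z.1, z.2.1) z.2.2.2.1 z.2.2.1)
    (f₂ := fun z => 2 * z.2.2.2.2.2 ^ 2 * B (z.1, z.2.1) z.2.2.2.1 z.2.2.2.1
      + 2 * z.2.2.2.2.1 ^ 2 * B (z.1, z.2.1)
        (curvOf (fun y => Γ (y, z.2.1)) z.1 z.2.2.2.1 z.2.2.1 z.2.2.2.1) z.2.2.1)
    hZc ?_ ?_ hω
  · obtain ⟨ε, hε, M, hM⟩ := key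
    refine ⟨ε, hε, M, fun x hx t ht u e hu he η hη ζ hζ => ?_⟩
    have h1 := hR (x, t) ⟨hx, ht⟩ u hu
    have h2 := hR (x, t) ⟨hx, ht⟩ e he
    obtain ⟨-, h4, h5⟩ := hM (x, t, u, e, η, ζ)
      ⟨hx, ht, mem_closedBall_zero_iff.2 h1, mem_closedBall_zero_iff.2 h2, hη, hζ⟩
    refine ⟨h4, fun r hr => ?_⟩
    have h6 := h5 r hr
    simp only [hF, varPoint_zero, varVel_zero] at h6
    exact h6
  · intro z hz
    have hT' := hsub z.2.1 hz.2.1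
    have le2 : (2 : WithTop ℕ∞) ≤ ((⊤ : ℕ∞) : WithTop ℕ∞) := by norm_cast
    have p1 : ContDiffAt ℝ 2 (fun q : ℝ × (Vec n × ℝ × Vec n × Vec n × ℝ × ℝ) =>
        (q.2.1, q.2.2.1)) (0, z) := by fun_prop
    have c1 : ContDiffAt ℝ 2 (fun q : ℝ × (Vec n × ℝ × Vec n × Vec n × ℝ × ℝ) =>
        Γ (q.2.1, q.2.2.1)) (0, z) :=
      ContDiffAt.comp (g := Γ) (0, z)
        ((contDiffAt_of_slab h.smooth_Γ hT' z.1).of_le le2) p1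
    have c2 : ContDiffAt ℝ 2 (fun q : ℝ × (Vec n × ℝ × Vec n × Vec n × ℝ × ℝ) =>
        fderiv ℝ (fun y => Γ (y, q.2.2.1)) q.2.1) (0, z) :=
      ContDiffAt.comp (g := fun p : Vec n × ℝ => fderiv ℝ (fun y => Γ (y, p.2)) p.1) (0, z)
        ((contDiffAt_of_slab (h.smooth_dΓ hT) hT' z.1).of_le le2) p1
    have c3 : ContDiffAt ℝ 2 (fun q : ℝ × (Vec n × ℝ × Vec n × Vec n × ℝ × ℝ) =>
        varPoint (Γ (q.2.1, q.2.2.1)) q.2.1 q.2.2.2.2.1 q.2.2.2.2.2.1 q.1) (0, z) :=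
      contDiffAt_varPoint c1 (by fun_prop) (by fun_prop) (by fun_prop) (by fun_prop)
    have c4 := contDiffAt_varVel (u := fun q : ℝ × (Vec n × ℝ × Vec n × Vec n × ℝ × ℝ) =>
        q.2.2.2.1) (e := fun q => q.2.2.2.2.1) (η := fun q => q.2.2.2.2.2.1)
        (ζ := fun q => q.2.2.2.2.2.2) (r := fun q => q.1) c1 c2 (by fun_prop) (by fun_prop)
        (by fun_prop) (by fun_prop) (by fun_prop)
    have c5 : ContDiffAt ℝ 2 (fun q : ℝ × (Vec n × ℝ × Vec n × Vec n × ℝ × ℝ) =>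
        B (varPoint (Γ (q.2.1, q.2.2.1)) q.2.1 q.2.2.2.2.1 q.2.2.2.2.2.1 q.1, q.2.2.1)) (0, z) := by
      refine ContDiffAt.comp (g := B) (0, z) ?_ (c3.prodMk (by fun_prop))
      simp only [varPoint_zero]
      exact (contDiffAt_of_slab h.smooth_B hT' z.1).of_le le2
    exact (c5.clm_apply c4).clm_apply c4
  · intro z hz
    exact (h.leviCivita z.2.1 (hsubI z.2.1 hz.2.1)).hasTwoJet_variation z.1 z.2.2.1 z.2.2.2.1
      z.2.2.2.2.1 z.2.2.2.2.2

theorem uniform_time_variation (hT : 0 < T) {K : Set (Vec n)} (hK : IsCompact K) {t₁ t₂ : ℝ}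
    (ht₁ : 0 < t₁) (ht₂ : t₂ < T) {ω : ℝ} (hω : 0 < ω) :
    ∃ ε > 0, ∃ M, ∀ x ∈ K, ∀ t ∈ Icc t₁ t₂, ∀ u : Vec n, B (x, t) u u ≤ 1 →
      |4 * ricST Γ (x, t) u u| ≤ M ∧ ∀ r, |r| ≤ ε →
        |B (x, t - r ^ 2) u u - B (x, t) u u - r ^ 2 / 2 * (4 * ricST Γ (x, t) u u)|
          ≤ ω * r ^ 2 := by
  have hsub : ∀ t ∈ Icc t₁ t₂, t ∈ Ioo 0 T := fun t ht => ⟨ht₁.trans_le ht.1, ht.2.trans_lt ht₂⟩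
  have hsubI : ∀ t ∈ Icc t₁ t₂, t ∈ Icc 0 T := fun t ht => Ioo_subset_Icc_self (hsub t ht)
  obtain ⟨R, hR⟩ := h.exists_norm_le (hK.prod (isCompact_Icc (a := t₁) (b := t₂)))
    (fun p hp => ⟨mem_univ _, hsubI p.2 hp.2⟩)
  have le2 : (2 : WithTop ℕ∞) ≤ ((⊤ : ℕ∞) : WithTop ℕ∞) := by norm_cast
  have key := uniform_taylor
    (F := fun q : ℝ × (Vec n × ℝ × Vec n) => B (q.2.1, q.2.2.1 - q.1 ^ 2) q.2.2.2 q.2.2.2)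
    (f₁ := fun z => 0) (f₂ := fun z => 4 * ricST Γ (z.1, z.2.1) z.2.2 z.2.2)
    (Z := K ×ˢ Icc t₁ t₂ ×ˢ Metric.closedBall 0 R)
    (hK.prod (isCompact_Icc.prod (isCompact_closedBall _ _))) ?_ ?_ hω
  · obtain ⟨ε, hε, M, hM⟩ := key
    refine ⟨ε, hε, M, fun x hx t ht u hu => ?_⟩
    have h1 := hR (x, t) ⟨hx, ht⟩ u hu
    obtain ⟨-, h4, h5⟩ := hM (x, t, u) ⟨hx, ht, mem_closedBall_zero_iff.2 h1⟩
    refine ⟨h4, fun r hr => ?_⟩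
    have h6 := h5 r hr
    simp only [ne_eq, OfNat.ofNat_ne_zero, not_false_eq_true, zero_pow, sub_zero, mul_zero] at h6
    exact h6
  · intro z hz
    have c5 : ContDiffAt ℝ 2 (fun q : ℝ × (Vec n × ℝ × Vec n) =>
        B (q.2.1, q.2.2.1 - q.1 ^ 2)) (0, z) := by
      refine ContDiffAt.comp (g := B) (0, z) ?_ (by fun_prop)
      simp only [ne_eq, OfNat.ofNat_ne_zero, not_false_eq_true, zero_pow, sub_zero]
      exact (contDiffAt_of_slab h.smooth_B (hsub _ hz.2.1) z.1).of_le le2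
    exact (c5.clm_apply (by fun_prop)).clm_apply (by fun_prop)
  · intro z hz
    have ht := hsub _ hz.2.1
    have h1 := hasTwoJet_comp_neg_sq (f := fun s => B (z.1, s) z.2.2 z.2.2)
      (f' := fun s => -2 * ricST Γ (z.1, s) z.2.2 z.2.2) (t := z.2.1) ?_ ?_
    · have e : 4 * ricST Γ (z.1, z.2.1) z.2.2 z.2.2
          = -2 * (-2 * ricST Γ (z.1, z.2.1) z.2.2 z.2.2) := by ring
      simp only [e]
      exact h1
    · filter_upwards [Ioo_mem_nhds ht.1 ht.2] with s hs
      have h2 := ((h.flow z.1 s hs).clm_apply (hasDerivAt_const s z.2.2)).clm_apply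
        (hasDerivAt_const s z.2.2)
      refine h2.congr_deriv ?_
      simp [ricST]
    · have h2 : ContinuousAt (ricST Γ) (z.1, z.2.1) :=
        (contDiffAt_of_slab (h.smooth_ric hT) ht z.1).continuousAt
      have h3 : ContinuousAt (fun s => ricST Γ (z.1, s)) z.2.1 :=
        ContinuousAt.comp (g := ricST Γ) h2 (by fun_prop)
      exact continuousAt_const.mul ((h3.clm_apply continuousAt_const).clm_apply continuousAt_const)

end FlowData

theorem uniform_taylor_varPoint {Γ : Vec n × ℝ → Conn n} {f : Vec n × ℝ → ℝ}
    (hΓ : ContDiffOn ℝ (⊤ : ℕ∞) Γ (slab n T)) (hf : ContDiffOn ℝ (⊤ : ℕ∞) f (slab n T))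
    {Z : Set (Vec n × ℝ × Vec n)} (hZ : IsCompact Z) (hZT : ∀ z ∈ Z, z.2.1 ∈ Ioo 0 T)
    {ω : ℝ} (hω : 0 < ω) :
    ∃ ε > 0, ∀ z ∈ Z, ∀ r, |r| ≤ ε →
      |f (varPoint (Γ (z.1, z.2.1)) z.1 z.2.2 1 r, z.2.1) - f (z.1, z.2.1)
        - r * fderiv ℝ (fun y => f (y, z.2.1)) z.1 z.2.2
        - r ^ 2 / 2 * (fderiv ℝ (fderiv ℝ fun y => f (y, z.2.1)) z.1 z.2.2 z.2.2
          - fderiv ℝ (fun y => f (y, z.2.1)) z.1 (Γ (z.1, z.2.1) z.2.2 z.2.2))| ≤ ω * r ^ 2 := by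
  have le2 : (2 : WithTop ℕ∞) ≤ ((⊤ : ℕ∞) : WithTop ℕ∞) := by norm_cast
  have key := uniform_taylor
    (F := fun q : ℝ × (Vec n × ℝ × Vec n) =>
      f (varPoint (Γ (q.2.1, q.2.2.1)) q.2.1 q.2.2.2 1 q.1, q.2.2.1)) hZ ?_
    (fun z hz => hasTwoJet_comp_varPoint
      (contDiff_slice hf (Ioo_subset_Icc_self (hZT z hz))) (Γ (z.1, z.2.1)) z.1 z.2.2) hω
  · obtain ⟨ε, hε, M, hM⟩ := key
    refine ⟨ε, hε, fun z hz r hr => ?_⟩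
    have h6 := (hM z hz).2.2 r hr
    simp only [varPoint_zero] at h6
    exact h6
  · intro z hz
    refine ContDiffAt.comp (g := f) (0, z) ?_ ((contDiffAt_varPoint ?_ (by fun_prop) (by fun_prop)
      contDiffAt_const (by fun_prop)).prodMk (by fun_prop))
    · simp only [varPoint_zero]
      exact (contDiffAt_of_slab hf (hZT z hz) z.1).of_le le2
    · exact ContDiffAt.comp (g := Γ) (0, z)
        ((contDiffAt_of_slab hΓ (hZT z hz) z.1).of_le le2) (by fun_prop)

theorem uniform_taylor_time {f : Vec n × ℝ → ℝ} (hf : ContDiffOn ℝ (⊤ : ℕ∞) f (slab n T))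
    {Z : Set (Vec n × ℝ)} (hZ : IsCompact Z) (hZT : ∀ z ∈ Z, z.2 ∈ Ioo 0 T)
    {ω : ℝ} (hω : 0 < ω) :
    ∃ ε > 0, ∀ z ∈ Z, ∀ r, |r| ≤ ε →
      |f (z.1, z.2 - r ^ 2) - f z - r ^ 2 / 2 * (-2 * deriv (fun s => f (z.1, s)) z.2)|
        ≤ ω * r ^ 2 := by
  have le2 : (2 : WithTop ℕ∞) ≤ ((⊤ : ℕ∞) : WithTop ℕ∞) := by norm_cast
  have key := uniform_taylor
    (F := fun q : ℝ × (Vec n × ℝ) => f (q.2.1, q.2.2 - q.1 ^ 2))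
    (f₁ := fun z => 0) (f₂ := fun z => -2 * deriv (fun s => f (z.1, s)) z.2) hZ ?_ ?_ hω
  · obtain ⟨ε, hε, M, hM⟩ := key
    refine ⟨ε, hε, fun z hz r hr => ?_⟩
    have h6 := (hM z hz).2.2 r hr
    simp only [ne_eq, OfNat.ofNat_ne_zero, not_false_eq_true, zero_pow, sub_zero, mul_zero] at h6
    exact h6
  · intro z hz
    refine ContDiffAt.comp (g := f) (0, z) ?_ (by fun_prop)
    simp only [ne_eq, OfNat.ofNat_ne_zero, not_false_eq_true, zero_pow, sub_zero]
    exact (contDiffAt_of_slab hf (hZT z hz) z.1).of_le le2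
  · intro z hz
    have h1 : ContDiffAt ℝ 2 (fun s => f (z.1, s)) z.2 :=
      ContDiffAt.comp (g := f) z.2 ((contDiffAt_of_slab hf (hZT z hz) z.1).of_le le2) (by fun_prop)
    refine hasTwoJet_comp_neg_sq (f := fun s => f (z.1, s)) (f' := deriv fun s => f (z.1, s))
      (t := z.2) ?_ ?_
    · filter_upwards [h1.eventually (by simp)] with s hs
      exact (hs.differentiableAt (by simp)).hasDerivAt
    · have h2 : ContinuousAt (fun s => fderiv ℝ (fun s => f (z.1, s)) s 1) z.2 :=
        (h1.continuousAt_fderiv (by simp)).clm_apply continuousAt_const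
      exact h2

end UniformVariation

section AugmentedPaths

variable {n : ℕ}

/-- The augmented speed `√(1 + |v|²)` of a path. -/
def augSpeed (B : Vec n → Bil n) (γ v : ℝ → Vec n) (s : ℝ) : ℝ :=
  Real.sqrt (1 + B (γ s) (v s) (v s))

/-- A path from `x₀` with its augmented length function `ℓ`. -/
structure AugPath (B : Vec n → Bil n) (x₀ : Vec n) (γ v : ℝ → Vec n) (ℓ : ℝ → ℝ) : Prop where
  path : IsPath γ v
  start : γ 0 = x₀
  zero : ℓ 0 = 0
  deriv : ∀ s ∈ Icc (0:ℝ) 1, HasDerivWithinAt ℓ (augSpeed B γ v s) (Icc 0 1) s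

/-- The velocity relative to the augmented speed. -/
def unitVel (B : Vec n → Bil n) (γ v : ℝ → Vec n) (s : ℝ) : Vec n := (augSpeed B γ v s)⁻¹ • v s

/-- A cutoff function increasing from `0` to `1` on the unit interval. -/
def cutoff (l : ℝ) : ℝ := 1 - max 0 (1 - l) ^ 2

/-- The derivative of the cutoff function. -/
def cutoffDeriv (l : ℝ) : ℝ := 2 * max 0 (1 - l)

theorem hasDerivAt_cutoff (l : ℝ) : HasDerivAt cutoff (cutoffDeriv l) l := by
  have h1 : HasDerivAt (fun l : ℝ => 1 - l) (-1) l := (hasDerivAt_id l).const_sub 1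
  refine (((hasDerivAt_posPart_sq (1 - l)).comp l h1).const_sub 1).congr_deriv ?_
  simp [cutoffDeriv]

theorem continuous_cutoffDeriv : Continuous cutoffDeriv := by
  unfold cutoffDeriv
  fun_prop

theorem cutoff_zero : cutoff 0 = 0 := by simp [cutoff]

theorem cutoff_of_one_le {l : ℝ} (hl : 1 ≤ l) : cutoff l = 1 := by
  simp [cutoff, max_eq_left (sub_nonpos.2 hl)]

theorem cutoff_mem {l : ℝ} (hl : 0 ≤ l) : cutoff l ∈ Icc (0:ℝ) 1 := by
  have h1 : 0 ≤ max 0 (1 - l) := le_max_left _ _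
  have h2 : max 0 (1 - l) ≤ 1 := max_le zero_le_one (by linarith)
  exact ⟨by unfold cutoff; nlinarith, by unfold cutoff; nlinarith⟩

theorem cutoffDeriv_mem {l : ℝ} (hl : 0 ≤ l) : cutoffDeriv l ∈ Icc (0:ℝ) 2 := by
  have h1 : 0 ≤ max 0 (1 - l) := le_max_left _ _
  have h2 : max 0 (1 - l) ≤ 1 := max_le zero_le_one (by linarith)
  exact ⟨by unfold cutoffDeriv; linarith, by unfold cutoffDeriv; linarith⟩

theorem one_sub_cutoff_sq_le {l : ℝ} (hl : 0 ≤ l) : 1 - cutoff l ^ 2 ≤ cutoffDeriv l := by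
  have h1 : 0 ≤ max 0 (1 - l) := le_max_left _ _
  have h2 : max 0 (1 - l) ≤ 1 := max_le zero_le_one (by linarith)
  unfold cutoff cutoffDeriv
  nlinarith [sq_nonneg (max 0 (1 - l)), sq_nonneg (max 0 (1 - l) ^ 2)]

variable {B : Vec n → Bil n} {x₀ : Vec n} {γ v : ℝ → Vec n} {ℓ : ℝ → ℝ}

theorem augSpeed_sq (hB : ∀ x v, 0 ≤ B x v v) (s : ℝ) :
    augSpeed B γ v s ^ 2 = 1 + B (γ s) (v s) (v s) :=
  Real.sq_sqrt (by linarith [hB (γ s) (v s)])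

theorem one_le_augSpeed (hB : ∀ x v, 0 ≤ B x v v) (s : ℝ) : 1 ≤ augSpeed B γ v s :=
  Real.one_le_sqrt.2 (by linarith [hB (γ s) (v s)])

theorem augSpeed_pos (hB : ∀ x v, 0 ≤ B x v v) (s : ℝ) : 0 < augSpeed B γ v s :=
  zero_lt_one.trans_le (one_le_augSpeed hB s)

theorem IsPath.continuousOn_augSpeed (hc : Continuous B) (hγ : IsPath γ v) :
    ContinuousOn (augSpeed B γ v) (Icc 0 1) :=
  (continuousOn_const.add (((hc.comp_continuousOn hγ.continuousOn).clm_apply hγ.2).clm_apply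
    hγ.2)).sqrt

theorem IsPath.continuousOn_unitVel (hc : Continuous B) (hB : ∀ x v, 0 ≤ B x v v)
    (hγ : IsPath γ v) : ContinuousOn (unitVel B γ v) (Icc 0 1) :=
  ((hγ.continuousOn_augSpeed hc).inv₀ fun s _ => (augSpeed_pos hB s).ne').smul hγ.2

theorem augSpeed_smul_unitVel (hB : ∀ x v, 0 ≤ B x v v) (s : ℝ) :
    augSpeed B γ v s • unitVel B γ v s = v s := by
  rw [unitVel, smul_smul, mul_inv_cancel₀ (augSpeed_pos hB s).ne', one_smul]

theorem augSpeed_sq_mul_unitVel (hB : ∀ x v, 0 ≤ B x v v) (s : ℝ) :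
    1 + augSpeed B γ v s ^ 2 * B (γ s) (unitVel B γ v s) (unitVel B γ v s)
      = augSpeed B γ v s ^ 2 := by
  conv_rhs => rw [augSpeed_sq hB, ← augSpeed_smul_unitVel (γ := γ) (v := v) hB s]
  simp only [map_smul, smul_apply, smul_eq_mul]
  ring

theorem unitVel_le_one (hB : ∀ x v, 0 ≤ B x v v) (s : ℝ) :
    B (γ s) (unitVel B γ v s) (unitVel B γ v s) ≤ 1 := by
  have h1 := augSpeed_sq_mul_unitVel (γ := γ) (v := v) hB s
  have h2 : 0 < augSpeed B γ v s ^ 2 := pow_pos (augSpeed_pos hB s) 2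
  by_contra! h3
  nlinarith

/-- First variation bound for the augmented speed. -/
theorem sqrt_one_add_le {l q q₀ : ℝ} (hl : 0 < l) (h₀ : 1 + l ^ 2 * q₀ = l ^ 2) (hq : 0 ≤ q) :
    Real.sqrt (1 + l ^ 2 * q) ≤ l * (1 + (q - q₀) / 2) := by
  have e : 1 + l ^ 2 * q = l ^ 2 * (1 + (q - q₀)) := by linear_combination h₀
  have h1 : 0 < 1 + (q - q₀) := by
    have : 0 < l ^ 2 * (1 + (q - q₀)) := by rw [← e]; positivity
    exact pos_of_mul_pos_right this (by positivity)
  rw [e]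
  refine Real.sqrt_le_iff.2 ⟨by have : 0 ≤ 1 + (q - q₀) / 2 := by linarith
                                positivity, ?_⟩
  rw [mul_pow]
  have : 1 + (q - q₀) ≤ (1 + (q - q₀) / 2) ^ 2 := by nlinarith [sq_nonneg (q - q₀)]
  gcongr

/-- Comparison of two functions by means of their derivatives. -/
theorem le_of_deriv_le {f f' b b' : ℝ → ℝ} {r : ℝ} (hr : r ∈ Icc (0:ℝ) 1)
    (hf : ∀ s ∈ Icc (0:ℝ) 1, HasDerivWithinAt f (f' s) (Icc 0 1) s)
    (hb : ∀ s ∈ Icc (0:ℝ) 1, HasDerivWithinAt b (b' s) (Icc 0 1) s)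
    (h0 : f 0 ≤ b 0) (h : ∀ s ∈ Icc (0:ℝ) 1, f' s ≤ b' s) : f r ≤ b r := by
  have hd : ∀ s ∈ Icc (0:ℝ) 1, HasDerivWithinAt (fun s => b s - f s) (b' s - f' s) (Icc 0 1) s :=
    fun s hs => (hb s hs).sub (hf s hs)
  have hm : MonotoneOn (fun s => b s - f s) (Icc 0 1) := by
    refine monotoneOn_of_hasDerivWithinAt_nonneg (convex_Icc 0 1)
      (fun s hs => (hd s hs).continuousWithinAt) (f' := fun s => b' s - f' s) ?_ ?_
    · intro s hs
      exact (hd s (interior_subset hs)).mono interior_subset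
    · intro s hs
      have := h s (interior_subset hs)
      linarith
  have := hm zero_mem_unit hr hr.1
  simp only at this
  linarith

namespace AugPath

variable (hB : ∀ x v, 0 ≤ B x v v) (h : AugPath B x₀ γ v ℓ)
include hB h

theorem id_le {s : ℝ} (hs : s ∈ Icc (0:ℝ) 1) : s ≤ ℓ s :=
  le_of_deriv_le (f := fun s => s) hs (fun s _ => hasDerivWithinAt_id s _) h.deriv
    (by simp [h.zero])
    fun s _ => one_le_augSpeed hB s

theorem nonneg {s : ℝ} (hs : s ∈ Icc (0:ℝ) 1) : 0 ≤ ℓ s := hs.1.trans (h.id_le hB hs)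

omit hB in
theorem arcLength_le {ℓ₀ : ℝ → ℝ} (h₀ : IsArcLength B γ v ℓ₀) {s : ℝ} (hs : s ∈ Icc (0:ℝ) 1) :
    ℓ₀ s ≤ ℓ s :=
  le_of_deriv_le hs h₀.2 h.deriv (by rw [h₀.1, h.zero]) fun s _ =>
    Real.sqrt_le_sqrt (by linarith)

omit hB in
theorem continuousOn : ContinuousOn ℓ (Icc 0 1) := fun s hs => (h.deriv s hs).continuousWithinAt

omit hB in
theorem hasDerivWithinAt_cutoff {s : ℝ} (hs : s ∈ Icc (0:ℝ) 1) :
    HasDerivWithinAt (fun s => cutoff (ℓ s)) (augSpeed B γ v s * cutoffDeriv (ℓ s))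
      (Icc 0 1) s :=
  ((hasDerivAt_cutoff (ℓ s)).comp_hasDerivWithinAt s (h.deriv s hs)).congr_deriv (mul_comm _ _)

end AugPath

theorem IsPath.exists_augPath (hc : Continuous B) (hγ : IsPath γ v) :
    ∃ ℓ, AugPath B (γ 0) γ v ℓ :=
  ⟨fun s => ∫ u in (0:ℝ)..s, augSpeed B γ v u, hγ, rfl, by simp, fun _ hs =>
    hasDerivWithinAt_primitive (hγ.continuousOn_augSpeed hc) hs⟩

/-- Parallel transport of a frame along a path. -/
theorem LeviCivita.exists_parallel_frame {g : Vec n → Bil n} {Γ : Vec n → Conn n}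
    (h : LeviCivita g Γ) (hγ : IsPath γ v) {F : Fin n → Vec n} (hF : IsFrame (g (γ 0)) F) :
    ∃ e : Fin n → ℝ → Vec n,
      (∀ i, ∀ s ∈ Icc (0:ℝ) 1,
        HasDerivWithinAt (e i) (-(Γ (γ s) (v s) (e i s))) (Icc 0 1) s) ∧
      ∀ s ∈ Icc (0:ℝ) 1, IsFrame (g (γ s)) fun i => e i s := by
  have hA : ContinuousOn (fun s => -(Γ (γ s) (v s))) (Icc 0 1) :=
    ((h.smooth_Γ.continuous.comp_continuousOn hγ.continuousOn).clm_apply hγ.2).neg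
  choose e he0 he using fun i => exists_linear_ode_solution _ hA (F i)
  refine ⟨e, fun i s hs => he i s hs, fun s hs i j => ?_⟩
  have hd : ∀ s ∈ Icc (0:ℝ) 1,
      HasDerivWithinAt (fun s => g (γ s) (e i s) (e j s)) 0 (Icc 0 1) s := by
    intro s hs
    refine (h.hasDerivWithinAt_apply (hγ.1 s hs) (he i s hs) (he j s hs)).congr_deriv ?_
    simp
  have hz : ∀ s ∈ Icc (0:ℝ) 1, HasDerivWithinAt (fun _ : ℝ => g (γ 0) (F i) (F j)) 0 (Icc 0 1) s :=
    fun s _ => hasDerivWithinAt_const _ _ _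
  rw [← hF i j]
  exact le_antisymm
    (le_of_deriv_le hs hd hz (by rw [he0, he0]) fun _ _ => le_rfl)
    (le_of_deriv_le hs hz hd (by rw [he0, he0]) fun _ _ => le_rfl)

theorem IsFrame.sum_sq {Q : Bil n} {F : Fin n → Vec n} (hF : IsFrame Q F) (v : Vec n) :
    ∑ k, Q v (F k) ^ 2 = Q v v := by
  conv_rhs => arg 2; rw [← hF.expand v]
  simp only [map_sum, map_smul, smul_eq_mul, sq]

theorem IsFrame.abs_apply_le {Q : Bil n} {F : Fin n → Vec n} (hF : IsFrame Q F) {v : Vec n}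
    (hv : Q v v ≤ 1) (i : Fin n) : |Q v (F i)| ≤ 1 := by
  rw [← sq_le_one_iff_abs_le_one]
  refine le_trans ?_ hv
  rw [← hF.sum_sq v]
  exact Finset.single_le_sum (f := fun k => Q v (F k) ^ 2) (fun _ _ => sq_nonneg _)
    (Finset.mem_univ i)

end AugmentedPaths

section PathVariation

variable {n : ℕ} {g : Vec n → Bil n} {Γ : Vec n → Conn n} {x₀ : Vec n} {γ v : ℝ → Vec n}
  {ℓ : ℝ → ℝ}

/-- The relative velocity of the variation of a path along `e`. -/
def relVel (g : Vec n → Bil n) (Γ : Vec n → Conn n) (γ v : ℝ → Vec n) (ℓ : ℝ → ℝ)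
    (e : ℝ → Vec n) (r s : ℝ) : Vec n :=
  varVel (Γ (γ s)) (fderiv ℝ Γ (γ s)) (unitVel g γ v s) (e s) (cutoff (ℓ s)) (cutoffDeriv (ℓ s)) r

namespace LeviCivita

variable (h : LeviCivita g Γ) (hB : ∀ x v, 0 ≤ g x v v) (hp : AugPath g x₀ γ v ℓ)
  {e : ℝ → Vec n}
  (he : ∀ s ∈ Icc (0:ℝ) 1, HasDerivWithinAt e (-(Γ (γ s) (v s) (e s))) (Icc 0 1) s)
include h hB hp he

theorem isPath_variation (r : ℝ) :
    IsPath (fun s => varPoint (Γ (γ s)) (γ s) (e s) (cutoff (ℓ s)) r)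
      (fun s => augSpeed g γ v s • relVel g Γ γ v ℓ e r s) := by
  have cγ := hp.path.continuousOn
  have ce : ContinuousOn e (Icc 0 1) := fun s hs => (he s hs).continuousWithinAt
  have cη : ContinuousOn (fun s => cutoff (ℓ s)) (Icc 0 1) :=
    fun s hs => (hp.hasDerivWithinAt_cutoff hs).continuousWithinAt
  have cζ : ContinuousOn (fun s => cutoffDeriv (ℓ s)) (Icc 0 1) :=
    continuous_cutoffDeriv.comp_continuousOn hp.continuousOn
  have cu := hp.path.continuousOn_unitVel h.smooth_g.continuous hB
  have cΓ : ContinuousOn (fun s => Γ (γ s)) (Icc 0 1) := h.smooth_Γ.continuous.comp_continuousOn cγ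
  have cD : ContinuousOn (fun s => fderiv ℝ Γ (γ s)) (Icc 0 1) :=
    (h.smooth_Γ.continuous_fderiv (by simp)).comp_continuousOn cγ
  refine ⟨fun s hs => ?_, (hp.path.continuousOn_augSpeed h.smooth_g.continuous).smul ?_⟩
  · have dη := hp.hasDerivWithinAt_cutoff hs
    have dγ := hp.path.1 s hs
    have dΓ : HasDerivWithinAt (fun s => Γ (γ s)) (fderiv ℝ Γ (γ s) (v s)) (Icc 0 1) s :=
      (h.differentiable_Γ (γ s)).hasFDerivAt.comp_hasDerivWithinAt s dγ
    have d1 := (dγ.add ((dη.const_mul r).smul (he s hs))).sub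
      (((dη.pow 2).const_mul (r ^ 2 / 2)).smul ((dΓ.clm_apply (he s hs)).clm_apply (he s hs)))
    refine d1.congr_deriv ?_
    have ev := augSpeed_smul_unitVel (γ := γ) (v := v) hB s
    simp only [relVel, varVel]
    generalize unitVel g γ v s = u at ev
    generalize augSpeed g γ v s = l at ev ⊢
    rw [← ev]
    simp only [map_smul, map_neg, smul_apply, add_apply, neg_apply,
      h.Γ_symm (γ s) (e s) (Γ (γ s) u (e s))]
    push_cast
    simp only [pow_one, Pi.pow_apply]
    module
  · unfold relVel varVel
    have c1 : ContinuousOn (fun s => Γ (γ s) (unitVel g γ v s) (e s)) (Icc 0 1) :=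
      (cΓ.clm_apply cu).clm_apply ce
    exact (cu.add ((continuousOn_const (c := r)).smul ((cζ.smul ce).sub (cη.smul c1)))).sub
      ((continuousOn_const (c := r ^ 2 / 2)).smul
        (((((continuousOn_const (c := (2:ℝ))).mul cη).mul cζ).smul
          ((cΓ.clm_apply ce).clm_apply ce)).add
        ((cη.pow 2).smul ((((cD.clm_apply cu).clm_apply ce).clm_apply ce).sub
          ((continuousOn_const (c := (2:ℝ))).smul ((cΓ.clm_apply c1).clm_apply ce))))))

theorem exists_variation (r : ℝ) {m m' : ℝ → ℝ}
    (hm : ∀ s ∈ Icc (0:ℝ) 1, HasDerivWithinAt m (m' s) (Icc 0 1) s) (hm0 : m 0 = 0)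
    (hle : ∀ s ∈ Icc (0:ℝ) 1, augSpeed g γ v s * (1 +
      (g (varPoint (Γ (γ s)) (γ s) (e s) (cutoff (ℓ s)) r) (relVel g Γ γ v ℓ e r s)
          (relVel g Γ γ v ℓ e r s) - g (γ s) (unitVel g γ v s) (unitVel g γ v s)) / 2) ≤ m' s) :
    ∃ γ' v' ℓ', AugPath g x₀ γ' v' ℓ' ∧ γ' 1 = varPoint (Γ (γ 1)) (γ 1) (e 1) 1 r ∧
      ℓ' 1 ≤ m 1 := by
  obtain ⟨ℓ', hℓ'⟩ := (h.isPath_variation hB hp he r).exists_augPath h.smooth_g.continuous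
  refine ⟨fun s => varPoint (Γ (γ s)) (γ s) (e s) (cutoff (ℓ s)) r,
    fun s => augSpeed g γ v s • relVel g Γ γ v ℓ e r s, ℓ', ?_, ?_,
    le_of_deriv_le one_mem_unit hℓ'.deriv hm (by rw [hℓ'.zero, hm0]) ?_⟩
  · have e0 : varPoint (Γ (γ 0)) (γ 0) (e 0) (cutoff (ℓ 0)) r = x₀ := by
      simp [varPoint, hp.zero, cutoff_zero, hp.start]
    rw [← e0]
    exact hℓ'
  · simp only
    rw [cutoff_of_one_le (hp.id_le hB one_mem_unit)]
  · intro s hs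
    refine le_trans ?_ (hle s hs)
    refine le_trans (le_of_eq ?_) (sqrt_one_add_le (augSpeed_pos hB s)
      (augSpeed_sq_mul_unitVel hB s) (hB _ _))
    simp only [augSpeed, map_smul, smul_apply, smul_eq_mul]
    congr 2
    ring

end LeviCivita

theorem AugPath.exists_change_metric {g' : Vec n → Bil n} (hg' : Continuous g')
    (hB : ∀ x v, 0 ≤ g x v v) (hB' : ∀ x v, 0 ≤ g' x v v) (hp : AugPath g x₀ γ v ℓ)
    {m m' : ℝ → ℝ}
    (hm : ∀ s ∈ Icc (0:ℝ) 1, HasDerivWithinAt m (m' s) (Icc 0 1) s) (hm0 : m 0 = 0)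
    (hle : ∀ s ∈ Icc (0:ℝ) 1, augSpeed g γ v s * (1 +
      (g' (γ s) (unitVel g γ v s) (unitVel g γ v s)
        - g (γ s) (unitVel g γ v s) (unitVel g γ v s)) / 2) ≤ m' s) :
    ∃ ℓ', AugPath g' x₀ γ v ℓ' ∧ ℓ' 1 ≤ m 1 := by
  obtain ⟨ℓ', hℓ'⟩ := hp.path.exists_augPath hg'
  rw [hp.start] at hℓ'
  refine ⟨ℓ', hℓ', le_of_deriv_le one_mem_unit hℓ'.deriv hm (by rw [hℓ'.zero, hm0]) ?_⟩
  intro s hs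
  refine le_trans ?_ (hle s hs)
  refine le_trans (le_of_eq ?_) (sqrt_one_add_le (augSpeed_pos hB s)
    (augSpeed_sq_mul_unitVel hB s) (hB' _ _))
  have ev := augSpeed_smul_unitVel (γ := γ) (v := v) hB s
  conv_lhs => rw [augSpeed, ← ev]
  simp only [map_smul, smul_apply, smul_eq_mul]
  congr 2
  ring

end PathVariation

section LengthComparison

variable {n : ℕ} {T : ℝ}

/-- Paths from `x₀` of bounded augmented length stay in a bounded set. -/
def Confined (T : ℝ) (B : Vec n × ℝ → Bil n) (x₀ : Vec n) : Prop :=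
  ∀ A, 0 < A → ∃ ρ, ∀ t ∈ Icc 0 T, ∀ γ v ℓ, AugPath (fun y => B (y, t)) x₀ γ v ℓ →
    ∀ s ∈ Icc (0:ℝ) 1, ℓ s < A → γ s ∈ Metric.ball x₀ ρ

theorem LeviCivita.sum_second_variation {g : Vec n → Bil n} {Γ : Vec n → Conn n}
    (h : LeviCivita g Γ) {x : Vec n} {E : Fin n → Vec n} (hE : IsFrame (g x) E) (u : Vec n)
    (η ζ : ℝ) :
    ∑ i, (2 * ζ ^ 2 * g x (E i) (E i) + 2 * η ^ 2 * g x (curvOf Γ x (E i) u (E i)) u)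
      = 2 * ζ ^ 2 * n - 2 * η ^ 2 * ricOf Γ x u u := by
  have h1 : ∀ i, g x (E i) (E i) = 1 := fun i => by simpa using hE i i
  rw [Finset.sum_add_distrib, ← Finset.mul_sum, ← Finset.mul_sum, h.sum_curv_eq_neg_ricOf hE u]
  simp only [h1, Finset.sum_const, Finset.card_univ, Fintype.card_fin, nsmul_eq_mul]
  ring

namespace FlowData

variable {B : Vec n × ℝ → Bil n} {Γ : Vec n × ℝ → Conn n} (h : FlowData T B Γ)
  {x₀ : Vec n} {γ v : ℝ → Vec n} {ℓ : ℝ → ℝ} {t : ℝ}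
include h

theorem continuous_B (ht : t ∈ Icc 0 T) : Continuous fun y => B (y, t) :=
  (h.leviCivita t ht).smooth_g.continuous

theorem continuousOn_curv (ht : t ∈ Icc 0 T) {e u : ℝ → Vec n}
    (cγ : ContinuousOn γ (Icc 0 1)) (ce : ContinuousOn e (Icc 0 1))
    (cu : ContinuousOn u (Icc 0 1)) :
    ContinuousOn (fun s => B (γ s, t) (curvOf (fun y => Γ (y, t)) (γ s) (e s) (u s) (e s)) (u s))
      (Icc 0 1) := by
  have hL := h.leviCivita t ht
  have cB : ContinuousOn (fun s => B (γ s, t)) (Icc 0 1) :=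
    hL.smooth_g.continuous.comp_continuousOn cγ
  have cΓ : ContinuousOn (fun s => Γ (γ s, t)) (Icc 0 1) :=
    hL.smooth_Γ.continuous.comp_continuousOn cγ
  have cD : ContinuousOn (fun s => fderiv ℝ (fun y => Γ (y, t)) (γ s)) (Icc 0 1) :=
    (hL.smooth_Γ.continuous_fderiv (by simp)).comp_continuousOn cγ
  unfold curvOf
  have c1 : ContinuousOn (fun s => Γ (γ s, t) (e s) (Γ (γ s, t) (u s) (e s))) (Icc 0 1) :=
    (cΓ.clm_apply ce).clm_apply ((cΓ.clm_apply cu).clm_apply ce)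
  have c2 : ContinuousOn (fun s => Γ (γ s, t) (u s) (Γ (γ s, t) (e s) (e s))) (Icc 0 1) :=
    (cΓ.clm_apply cu).clm_apply ((cΓ.clm_apply ce).clm_apply ce)
  exact (cB.clm_apply ((((((cD.clm_apply ce).clm_apply cu).clm_apply ce).sub
    (((cD.clm_apply cu).clm_apply ce).clm_apply ce)).add c1).sub c2)).clm_apply cu

theorem continuousOn_ric (hT : 0 < T) (ht : t ∈ Icc 0 T) {u : ℝ → Vec n}
    (cγ : ContinuousOn γ (Icc 0 1)) (cu : ContinuousOn u (Icc 0 1)) :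
    ContinuousOn (fun s => ricST Γ (γ s, t) (u s) (u s)) (Icc 0 1) := by
  have c1 : ContinuousOn (fun s => ricST Γ (γ s, t)) (Icc 0 1) :=
    (h.smooth_ric hT).continuousOn.comp (f := fun s => (γ s, t)) (cγ.prodMk continuousOn_const)
      fun s _ => ⟨mem_univ _, ht⟩
  exact (c1.clm_apply cu).clm_apply cu

/-- First and second variation of the augmented length along a frame and backwards in time. -/
theorem exists_comparison (hT : 0 < T) (hconf : Confined T B x₀) :
    ∃ C, 0 ≤ C ∧ ∀ A, 1 < A → ∀ t₁ t₂ ω, 0 < t₁ → t₂ < T → 0 < ω → ∃ ε₀ > 0, ∃ Q,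
      ∀ t ∈ Icc t₁ t₂, ∀ γ v ℓ, AugPath (fun y => B (y, t)) x₀ γ v ℓ → ℓ 1 < A →
      ∃ (F : Fin n → Vec n) (a b : Fin n → ℝ) (d : ℝ), IsFrame (B (γ 1, t)) F ∧
        (∀ i, |a i| ≤ 1) ∧ (∀ i, |b i| ≤ Q) ∧ |d| ≤ Q ∧ ∑ i, b i + d / 2 ≤ C ∧
        ∀ ε, |ε| ≤ ε₀ →
          (∀ i, ∃ γ' v' ℓ', AugPath (fun y => B (y, t)) x₀ γ' v' ℓ' ∧
            γ' 1 = varPoint (Γ (γ 1, t)) (γ 1) (F i) 1 ε ∧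
            ℓ' 1 ≤ ℓ 1 + ε * a i + ε ^ 2 / 2 * b i + ω * ε ^ 2 * ℓ 1) ∧
          (∃ ℓ', AugPath (fun y => B (y, t - ε ^ 2)) x₀ γ v ℓ' ∧
            ℓ' 1 ≤ ℓ 1 + ε ^ 2 / 2 * d + ω * ε ^ 2 * ℓ 1) := by
  obtain ⟨ρ₁, hρ₁⟩ := hconf 1 one_pos
  obtain ⟨C₀, hC₀⟩ := h.exists_ric_le hT (K := Metric.closedBall x₀ ρ₁ ×ˢ Icc 0 T)
    ((isCompact_closedBall x₀ ρ₁).prod isCompact_Icc) (prod_mono_left (subset_univ _))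
  refine ⟨2 * n + |C₀|, by positivity, fun A hA t₁ t₂ ω ht₁ ht₂ hω => ?_⟩
  obtain ⟨ρ, hρ⟩ := hconf A (one_pos.trans hA)
  obtain ⟨ε₁, hε₁, M₁, h₁⟩ := h.uniform_variation hT (isCompact_closedBall x₀ ρ) ht₁ ht₂ hω
  obtain ⟨ε₂, hε₂, M₂, h₂⟩ := h.uniform_time_variation hT (isCompact_closedBall x₀ ρ) ht₁ ht₂ hω
  refine ⟨min (min ε₁ ε₂) (Real.sqrt t₁), by positivity, A * (|M₁| + |M₂|),
    fun t ht γ v ℓ hp hℓA => ?_⟩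
  have htT : t ∈ Icc 0 T := ⟨ht₁.le.trans ht.1, ht.2.trans ht₂.le⟩
  have hL := h.leviCivita t htT
  have hB : ∀ x v, 0 ≤ B (x, t) v v := fun x v => h.nonneg (p := (x, t)) htT v
  have hmono : ∀ s ∈ Icc (0:ℝ) 1, ℓ s ≤ ℓ 1 := by
    have : MonotoneOn ℓ (Icc 0 1) := by
      refine monotoneOn_of_hasDerivWithinAt_nonneg (convex_Icc 0 1) hp.continuousOn
        (f' := augSpeed (fun y => B (y, t)) γ v) ?_ ?_
      · intro s hs
        exact (hp.deriv s (interior_subset hs)).mono interior_subset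
      · intro s hs
        exact (augSpeed_pos (B := fun y => B (y, t)) hB s).le
    exact fun s hs => this hs one_mem_unit hs.2
  have hγK : ∀ s ∈ Icc (0:ℝ) 1, γ s ∈ Metric.closedBall x₀ ρ := fun s hs =>
    Metric.ball_subset_closedBall (hρ t htT γ v ℓ hp s hs ((hmono s hs).trans_lt hℓA))
  obtain ⟨F₀, hF₀⟩ := exists_isFrame (h.posDef (γ 0) t htT)
  obtain ⟨e, he, heF⟩ := hL.exists_parallel_frame hp.path hF₀
  set lam := augSpeed (fun y => B (y, t)) γ v with hlam
  set u := unitVel (fun y => B (y, t)) γ v with hu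
  have hlam0 : ∀ s, 0 < lam s := fun s => augSpeed_pos (B := fun y => B (y, t)) hB s
  have hu1 : ∀ s, B (γ s, t) (u s) (u s) ≤ 1 :=
    fun s => unitVel_le_one (B := fun y => B (y, t)) hB s
  have he1 : ∀ i, ∀ s ∈ Icc (0:ℝ) 1, B (γ s, t) (e i s) (e i s) ≤ 1 := fun i s hs => by
    simpa using (heF s hs i i).le
  have hη : ∀ s ∈ Icc (0:ℝ) 1, cutoff (ℓ s) ∈ Icc (0:ℝ) 1 :=
    fun s hs => cutoff_mem (hp.nonneg hB hs)
  have hζ : ∀ s ∈ Icc (0:ℝ) 1, cutoffDeriv (ℓ s) ∈ Icc (0:ℝ) 2 :=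
    fun s hs => cutoffDeriv_mem (hp.nonneg hB hs)
  -- continuity of the integrands
  have cγ := hp.path.continuousOn
  have cl : ContinuousOn lam (Icc 0 1) := hp.path.continuousOn_augSpeed (h.continuous_B htT)
  have cu : ContinuousOn u (Icc 0 1) := hp.path.continuousOn_unitVel (h.continuous_B htT) hB
  have ce : ∀ i, ContinuousOn (e i) (Icc 0 1) := fun i s hs => (he i s hs).continuousWithinAt
  have cη : ContinuousOn (fun s => cutoff (ℓ s)) (Icc 0 1) :=
    fun s hs => (hp.hasDerivWithinAt_cutoff hs).continuousWithinAt
  have cζ : ContinuousOn (fun s => cutoffDeriv (ℓ s)) (Icc 0 1) :=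
    continuous_cutoffDeriv.comp_continuousOn hp.continuousOn
  have cB : ContinuousOn (fun s => B (γ s, t)) (Icc 0 1) :=
    (h.continuous_B htT).comp_continuousOn cγ
  set a' : Fin n → ℝ → ℝ := fun i s => lam s * (cutoffDeriv (ℓ s) * B (γ s, t) (e i s) (u s))
    with ha'
  set f₂ : Fin n → ℝ → ℝ := fun i s => 2 * cutoffDeriv (ℓ s) ^ 2 * B (γ s, t) (e i s) (e i s)
    + 2 * cutoff (ℓ s) ^ 2 *
      B (γ s, t) (curvOf (fun y => Γ (y, t)) (γ s) (e i s) (u s) (e i s)) (u s)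
    with hf₂
  set d' : ℝ → ℝ := fun s => lam s * (4 * ricST Γ (γ s, t) (u s) (u s) / 2) with hd'
  have ca : ∀ i, ContinuousOn (a' i) (Icc 0 1) := fun i =>
    cl.mul (cζ.mul ((cB.clm_apply (ce i)).clm_apply cu))
  have cb : ∀ i, ContinuousOn (fun s => lam s * (f₂ i s / 2)) (Icc 0 1) := fun i =>
    cl.mul (((((continuousOn_const (c := (2:ℝ))).mul (cζ.pow 2)).mul
      ((cB.clm_apply (ce i)).clm_apply (ce i))).add
      (((continuousOn_const (c := (2:ℝ))).mul (cη.pow 2)).mul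
        (h.continuousOn_curv htT cγ (ce i) cu))).div_const 2)
  have cd : ContinuousOn d' (Icc 0 1) :=
    cl.mul (((continuousOn_const (c := (4:ℝ))).mul (h.continuousOn_ric hT htT cγ cu)).div_const 2)
  set a : Fin n → ℝ → ℝ := fun i s => ∫ w in (0:ℝ)..s, a' i w with ha
  set b : Fin n → ℝ → ℝ := fun i s => ∫ w in (0:ℝ)..s, lam w * (f₂ i w / 2) with hb
  set d : ℝ → ℝ := fun s => ∫ w in (0:ℝ)..s, d' w with hd
  have da : ∀ i, ∀ s ∈ Icc (0:ℝ) 1, HasDerivWithinAt (a i) (a' i s) (Icc 0 1) s :=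
    fun i s hs => hasDerivWithinAt_primitive (ca i) hs
  have db : ∀ i, ∀ s ∈ Icc (0:ℝ) 1, HasDerivWithinAt (b i) (lam s * (f₂ i s / 2)) (Icc 0 1) s :=
    fun i s hs => hasDerivWithinAt_primitive (cb i) hs
  have dd : ∀ s ∈ Icc (0:ℝ) 1, HasDerivWithinAt d (d' s) (Icc 0 1) s :=
    fun s hs => hasDerivWithinAt_primitive cd hs
  have a0 : ∀ i, a i 0 = 0 := fun i => by simp [ha]
  have b0 : ∀ i, b i 0 = 0 := fun i => by simp [hb]
  have d0 : d 0 = 0 := by simp [hd]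
  have dη := fun s (hs : s ∈ Icc (0:ℝ) 1) => hp.hasDerivWithinAt_cutoff hs
  have η0 : cutoff (ℓ 0) = 0 := by rw [hp.zero, cutoff_zero]
  have η1 : cutoff (ℓ 1) = 1 := cutoff_of_one_le (hp.id_le hB one_mem_unit)
  have hf₂M : ∀ i, ∀ s ∈ Icc (0:ℝ) 1, |f₂ i s| ≤ |M₁| := fun i s hs =>
    (h₁ (γ s) (hγK s hs) t ht (u s) (e i s) (hu1 s) (he1 i s hs) _ (hη s hs) _
      (hζ s hs)).1.trans (le_abs_self _)
  have hdM : ∀ s ∈ Icc (0:ℝ) 1, |4 * ricST Γ (γ s, t) (u s) (u s)| ≤ |M₂| := fun s hs =>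
    (h₂ (γ s) (hγK s hs) t ht (u s) (hu1 s)).1.trans (le_abs_self _)
  have hae : ∀ i, ∀ s ∈ Icc (0:ℝ) 1, |a' i s| ≤ lam s * cutoffDeriv (ℓ s) := fun i s hs => by
    have h3 : |B (γ s, t) (e i s) (u s)| ≤ 1 := by
      rw [hL.g_symm (γ s)]
      exact (heF s hs).abs_apply_le (hu1 s) i
    have h4 := (hζ s hs).1
    simp only [ha', abs_mul, abs_of_pos (hlam0 s), abs_of_nonneg h4]
    have := (hlam0 s).le
    exact mul_le_mul_of_nonneg_left (mul_le_of_le_one_right h4 h3) this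
  have hlin : ∀ c, ∀ s ∈ Icc (0:ℝ) 1,
      HasDerivWithinAt (fun s => c * ℓ s) (c * lam s) (Icc 0 1) s :=
    fun c s hs => (hp.deriv s hs).const_mul c
  have habs : ∀ {f f' : ℝ → ℝ} {c : ℝ}, f 0 = 0 →
      (∀ s ∈ Icc (0:ℝ) 1, HasDerivWithinAt f (f' s) (Icc 0 1) s) → 0 ≤ c →
      (∀ s ∈ Icc (0:ℝ) 1, |f' s| ≤ c * lam s) → |f 1| ≤ A * c := by
    intro f f' c hf0 hf hc hle
    have e1 := le_of_deriv_le one_mem_unit hf (hlin c) (by simp [hf0, hp.zero])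
      fun s hs => (abs_le.1 (hle s hs)).2
    have e2 := le_of_deriv_le one_mem_unit (hlin (-c)) hf (by simp [hf0, hp.zero])
      fun s hs => by linarith [(abs_le.1 (hle s hs)).1]
    have e3 : c * ℓ 1 ≤ c * A := by gcongr
    exact abs_le.2 ⟨by linarith, by linarith⟩
  refine ⟨fun i => e i 1, fun i => a i 1, fun i => b i 1, d 1, heF 1 one_mem_unit, ?_, ?_, ?_,
    ?_, ?_⟩
  · intro i
    have e1 := le_of_deriv_le one_mem_unit (da i) dη (by rw [a0 i, η0])
      fun s hs => (abs_le.1 (hae i s hs)).2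
    have e2 := le_of_deriv_le one_mem_unit (fun s hs => (dη s hs).neg) (da i)
      (by simp [a0 i, η0]) fun s hs => (abs_le.1 (hae i s hs)).1
    rw [η1] at e1
    simp only [Pi.neg_apply, η1] at e2
    exact abs_le.2 ⟨e2, e1⟩
  · intro i
    refine habs (b0 i) (db i) (by positivity) fun s hs => ?_
    rw [abs_mul, abs_of_pos (hlam0 s), mul_comm, abs_div, abs_two]
    have := hf₂M i s hs
    have := abs_nonneg M₁
    have := abs_nonneg M₂
    exact mul_le_mul_of_nonneg_right (by linarith) (hlam0 s).le
  · refine habs d0 dd (by positivity) fun s hs => ?_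
    rw [abs_mul, abs_of_pos (hlam0 s), mul_comm, abs_div, abs_two]
    have := hdM s hs
    have := abs_nonneg M₁
    have := abs_nonneg M₂
    exact mul_le_mul_of_nonneg_right (by linarith) (hlam0 s).le
  · have hs1 : ∀ s ∈ Icc (0:ℝ) 1, HasDerivWithinAt (fun s => ∑ i, b i s + d s / 2)
        (∑ i, lam s * (f₂ i s / 2) + d' s / 2) (Icc 0 1) s := fun s hs =>
      (HasDerivWithinAt.fun_sum fun i _ => db i s hs).add ((dd s hs).div_const 2)
    have e1 := le_of_deriv_le one_mem_unit hs1 (fun s hs => (dη s hs).const_mul (2 * n + |C₀|))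
      (by simp [b0, d0, η0]) ?_
    · simpa [η1] using e1
    · intro s hs
      have e2 : ∑ i, lam s * (f₂ i s / 2) + d' s / 2 = lam s * (n * cutoffDeriv (ℓ s) ^ 2
          + (1 - cutoff (ℓ s) ^ 2) * ricST Γ (γ s, t) (u s) (u s)) := by
        rw [← Finset.mul_sum, ← Finset.sum_div, hL.sum_second_variation (heF s hs)]
        simp only [hd', ricST]
        ring
      rw [e2]
      have hζs := hζ s hs
      have hηs := hη s hs
      have h5 := one_sub_cutoff_sq_le (hp.nonneg hB hs)
      have h6 : 0 ≤ 1 - cutoff (ℓ s) ^ 2 := by nlinarith [hηs.1, hηs.2]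
      have h7 : (1 - cutoff (ℓ s) ^ 2) * ricST Γ (γ s, t) (u s) (u s)
          ≤ |C₀| * cutoffDeriv (ℓ s) := by
        rcases lt_or_ge (ℓ s) 1 with hl | hl
        · have h8 : ricST Γ (γ s, t) (u s) (u s) ≤ |C₀| :=
            (le_abs_self _).trans ((hC₀ (γ s, t) ⟨Metric.ball_subset_closedBall
              (hρ₁ t htT γ v ℓ hp s hs hl), htT⟩ (u s) (hu1 s)).trans (le_abs_self _))
          have h9 := abs_nonneg C₀
          calc _ ≤ (1 - cutoff (ℓ s) ^ 2) * |C₀| := mul_le_mul_of_nonneg_left h8 h6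
            _ ≤ cutoffDeriv (ℓ s) * |C₀| := mul_le_mul_of_nonneg_right h5 h9
            _ = _ := mul_comm _ _
        · rw [cutoff_of_one_le hl]
          have := mul_nonneg (abs_nonneg C₀) hζs.1
          linarith
      have h8 : n * cutoffDeriv (ℓ s) ^ 2 ≤ 2 * n * cutoffDeriv (ℓ s) := by
        have : cutoffDeriv (ℓ s) ^ 2 ≤ 2 * cutoffDeriv (ℓ s) := by nlinarith [hζs.1, hζs.2]
        have := mul_le_mul_of_nonneg_left this (Nat.cast_nonneg (α := ℝ) n)
        linarith
      have := mul_le_mul_of_nonneg_left (add_le_add h8 h7) (hlam0 s).le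
      linarith
  · intro ε hε
    have hε' : |ε| ≤ ε₁ ∧ |ε| ≤ ε₂ ∧ |ε| ≤ Real.sqrt t₁ :=
      ⟨hε.trans ((min_le_left _ _).trans (min_le_left _ _)),
        hε.trans ((min_le_left _ _).trans (min_le_right _ _)), hε.trans (min_le_right _ _)⟩
    refine ⟨fun i => ?_, ?_⟩
    · have hm : ∀ s ∈ Icc (0:ℝ) 1, HasDerivWithinAt
          (fun s => ℓ s + ε * a i s + ε ^ 2 / 2 * b i s + ω * ε ^ 2 * ℓ s)
          (lam s + ε * a' i s + ε ^ 2 / 2 * (lam s * (f₂ i s / 2)) + ω * ε ^ 2 * lam s)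
          (Icc 0 1) s := fun s hs =>
        ((((hp.deriv s hs).add ((da i s hs).const_mul ε)).add
          ((db i s hs).const_mul (ε ^ 2 / 2)))).add ((hp.deriv s hs).const_mul (ω * ε ^ 2))
      refine hL.exists_variation hB hp (he i) ε hm (by simp [hp.zero, a0, b0]) fun s hs => ?_
      have e1 := (abs_le.1 ((h₁ (γ s) (hγK s hs) t ht (u s) (e i s) (hu1 s) (he1 i s hs) _
        (hη s hs) _ (hζ s hs)).2 ε hε'.1)).2
      have e2 : lam s + ε * a' i s + ε ^ 2 / 2 * (lam s * (f₂ i s / 2)) + ω * ε ^ 2 * lam s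
          = lam s * (1 + (ε * (2 * cutoffDeriv (ℓ s) * B (γ s, t) (e i s) (u s))
            + ε ^ 2 / 2 * f₂ i s + 2 * (ω * ε ^ 2)) / 2) := by
        simp only [ha']
        ring
      rw [e2]
      have := sq_nonneg ε
      have h3 : 0 ≤ ω * ε ^ 2 := by positivity
      refine mul_le_mul_of_nonneg_left ?_ (hlam0 s).le
      simp only [relVel]
      linarith
    · have ht' : t - ε ^ 2 ∈ Icc 0 T := by
        have : ε ^ 2 ≤ t₁ := by
          rw [← sq_abs]
          calc |ε| ^ 2 ≤ Real.sqrt t₁ ^ 2 := by gcongr; exact hε'.2.2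
            _ = t₁ := Real.sq_sqrt ht₁.le
        exact ⟨by linarith [ht.1], by linarith [sq_nonneg ε, htT.2]⟩
      have hm : ∀ s ∈ Icc (0:ℝ) 1, HasDerivWithinAt
          (fun s => ℓ s + ε ^ 2 / 2 * d s + ω * ε ^ 2 * ℓ s)
          (lam s + ε ^ 2 / 2 * d' s + ω * ε ^ 2 * lam s) (Icc 0 1) s := fun s hs =>
        ((hp.deriv s hs).add ((dd s hs).const_mul (ε ^ 2 / 2))).add
          ((hp.deriv s hs).const_mul (ω * ε ^ 2))
      refine hp.exists_change_metric (h.continuous_B ht') hB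
        (fun x v => h.nonneg (p := (x, t - ε ^ 2)) ht' v) hm (by simp [hp.zero, d0])
        fun s hs => ?_
      have e1 := (abs_le.1 ((h₂ (γ s) (hγK s hs) t ht (u s) (hu1 s)).2 ε hε'.2.1)).2
      have e2 : lam s + ε ^ 2 / 2 * d' s + ω * ε ^ 2 * lam s
          = lam s * (1 + (ε ^ 2 / 2 * (4 * ricST Γ (γ s, t) (u s) (u s))
            + 2 * (ω * ε ^ 2)) / 2) := by
        simp only [hd']
        ring
      rw [e2]
      have h3 : 0 ≤ ω * ε ^ 2 := by positivity
      refine mul_le_mul_of_nonneg_left ?_ (hlam0 s).le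
      linarith

end FlowData

end LengthComparison

section MaximumPrinciple

variable {n : ℕ} {T : ℝ}

theorem hasDerivAt_div_sub_pow (c A : ℝ) (k : ℕ) {s : ℝ} (hs : s ≠ A) :
    HasDerivAt (fun s => c / (A - s) ^ k) (k * c / (A - s) ^ (k + 1)) s := by
  have h0 : A - s ≠ 0 := sub_ne_zero.2 hs.symm
  have h1 := (((hasDerivAt_id s).const_sub A).pow k).inv (pow_ne_zero k h0) |>.const_mul c
  refine (h1.congr_deriv ?_).congr_of_eventuallyEq (.of_forall fun r => ?_)
  · rcases k with _ | k
    · simp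
    · simp only [id, Pi.pow_apply, Nat.add_sub_cancel]
      field_simp
      ring
  · simp [div_eq_mul_inv]

/-- Uniform second order expansion of the barrier `m / (A - s)²` away from `s = A`. -/
theorem exists_taylor_barrier (m A κ Q : ℝ) (hκ : 0 < κ) {e : ℝ} (he : 0 < e) :
    ∃ ε > 0, ∀ L ∈ Icc 1 (A - κ), ∀ a β : ℝ, |a| ≤ 1 → |β| ≤ Q → ∀ r, |r| ≤ ε →
      m / (A - (L + r * a + r ^ 2 / 2 * β)) ^ 2 ≤ m / (A - L) ^ 2
        + r * (2 * m / (A - L) ^ 3 * a)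
        + r ^ 2 / 2 * (2 * m / (A - L) ^ 3 * β + 6 * m / (A - L) ^ 4 * a ^ 2) + e * r ^ 2 := by
  have hZ : IsCompact (Icc 1 (A - κ) ×ˢ (Icc (-1:ℝ) 1 ×ˢ Icc (-Q) Q)) :=
    isCompact_Icc.prod (isCompact_Icc.prod isCompact_Icc)
  have hne : ∀ z ∈ Icc 1 (A - κ) ×ˢ (Icc (-1:ℝ) 1 ×ˢ Icc (-Q) Q), z.1 < A :=
    fun z hz => by linarith [hz.1.2]
  have hF : ∀ z ∈ Icc 1 (A - κ) ×ˢ (Icc (-1:ℝ) 1 ×ˢ Icc (-Q) Q), ContDiffAt ℝ 2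
      (fun q : ℝ × (ℝ × ℝ × ℝ) => m / (A - (q.2.1 + q.1 * q.2.2.1 + q.1 ^ 2 / 2 * q.2.2.2)) ^ 2)
      (0, z) := by
    intro z hz
    have h0 : A - (z.1 + 0 * z.2.1 + 0 ^ 2 / 2 * z.2.2) ≠ 0 := by
      have := hne z hz
      simp only [zero_mul, add_zero, ne_eq, OfNat.ofNat_ne_zero, not_false_eq_true, zero_pow,
        zero_div]
      linarith
    have h1 : ContDiffAt ℝ 2 (fun q : ℝ × (ℝ × ℝ × ℝ) =>
        A - (q.2.1 + q.1 * q.2.2.1 + q.1 ^ 2 / 2 * q.2.2.2)) (0, z) := by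
      refine ContDiff.contDiffAt ?_
      fun_prop
    exact contDiffAt_const.div (h1.pow 2) (pow_ne_zero 2 h0)
  have hjet : ∀ z ∈ Icc 1 (A - κ) ×ˢ (Icc (-1:ℝ) 1 ×ˢ Icc (-Q) Q),
      HasTwoJet (fun r => m / (A - (z.1 + r * z.2.1 + r ^ 2 / 2 * z.2.2)) ^ 2)
        (2 * m / (A - z.1) ^ 3 * z.2.1)
        (2 * m / (A - z.1) ^ 3 * z.2.2 + 6 * m / (A - z.1) ^ 4 * z.2.1 ^ 2) := by
    intro z hz
    have h1 := hne z hz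
    refine hasTwoJet_quadratic (f := fun s => m / (A - s) ^ 2)
      (f' := fun s => 2 * m / (A - s) ^ 3) ?_ ?_
    · filter_upwards [eventually_ne_nhds h1.ne] with s hs
      exact_mod_cast hasDerivAt_div_sub_pow m A 2 hs
    · refine (hasDerivAt_div_sub_pow (2 * m) A 3 h1.ne).congr_deriv ?_
      norm_num
      ring
  obtain ⟨ε, hε, _, hT⟩ := uniform_taylor hZ hF hjet he
  refine ⟨ε, hε, fun L hL a β ha hβ r hr => ?_⟩
  have h1 := (abs_le.1 ((hT (L, a, β) ⟨hL, abs_le.1 ha, abs_le.1 hβ⟩).2.2 r hr)).2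
  simp only [zero_mul, add_zero, ne_eq, OfNat.ofNat_ne_zero, not_false_eq_true, zero_pow,
    zero_div] at h1
  linarith

theorem div_sub_sq_le_div_sub_sq {m A s r : ℝ} (hm : 0 ≤ m) (hsr : s ≤ r) (hr : r < A) :
    m / (A - s) ^ 2 ≤ m / (A - r) ^ 2 := by
  have : 0 < A - r := by linarith
  gcongr

theorem le_of_second_difference {u f₁ f₂ b g₁ g₂ e M r : ℝ} (hr : 0 < r)
    (hM : M - e * r ^ 2 < u - b)
    (h₁ : u + r * f₁ + r ^ 2 / 2 * f₂ - e * r ^ 2 ≤ M + (b + r * g₁ + r ^ 2 / 2 * g₂ + e * r ^ 2))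
    (h₂ : u + -r * f₁ + r ^ 2 / 2 * f₂ - e * r ^ 2
      ≤ M + (b + -r * g₁ + r ^ 2 / 2 * g₂ + e * r ^ 2)) :
    f₂ ≤ g₂ + 6 * e := by
  have hr2 : 0 < r ^ 2 := by positivity
  refine le_of_mul_le_mul_left ?_ hr2
  linarith

theorem le_of_difference {u u' f b g e M r : ℝ} (hr : 0 < r) (hM : M - e * r ^ 2 < u - b)
    (h₁ : -(e * r ^ 2) ≤ u' - u - r ^ 2 / 2 * (-2 * f))
    (h₂ : u' ≤ M + (b + r ^ 2 / 2 * g + e * r ^ 2)) : -f ≤ g / 2 + 3 * e := by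
  have hr2 : 0 < r ^ 2 := by positivity
  refine le_of_mul_le_mul_left ?_ hr2
  linarith

theorem quadratic_argument_lt {A L D r a β κ : ℝ} (hr : |r| ≤ 1) (ha : |a| ≤ 1) (hβ : |β| ≤ D)
    (hκ : 0 < κ) (hrκ : |r| * (2 + D) ≤ κ) (hL : L ≤ A - κ) :
    L + r * a + r ^ 2 / 2 * β < A := by
  have hD : 0 ≤ D := (abs_nonneg β).trans hβ
  have hr0 := abs_nonneg r
  have h1 : r * a ≤ |r| := by
    refine (le_abs_self _).trans ?_
    rw [abs_mul]
    exact mul_le_of_le_one_right hr0 ha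
  have h2 : r ^ 2 / 2 * β ≤ |r| / 2 * D := by
    rw [← sq_abs r]
    calc |r| ^ 2 / 2 * β ≤ |r| ^ 2 / 2 * D := by gcongr; exact (le_abs_self β).trans hβ
      _ ≤ |r| / 2 * D := by gcongr; nlinarith
  nlinarith

theorem barrier_contradiction {n : ℕ} {A C L P M c d e f m S lap dt : ℝ} (hC : 0 ≤ C) (hL : 1 ≤ L)
    (hLA : L < A) (hm : 0 < m) (hc : 0 < c) (hM : 0 < M) (he : 0 < e)
    (hmc : c * m = 2 * C * A + 6 * n + 1) (hP : 2 * m / (A - L) ^ 3 ≤ P)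
    (heQ : e * ((2 * n + 1) * (A * P) + 6 * n + 3) = c * M ^ 2 / 8)
    (hS : S + d / 2 ≤ C)
    (hf : m / (A - L) ^ 2 + M / 2 < f)
    (hlap : lap ≤ 2 * m / (A - L) ^ 3 * (S + n * (2 * e * L)) + n * (6 * m / (A - L) ^ 4)
      + n * (6 * e))
    (hdt : -dt ≤ 2 * m / (A - L) ^ 3 * (d + 2 * e * L) / 2 + 3 * e)
    (hmain : c * f ^ 2 ≤ lap - dt) : False := by
  have hAL : 0 < A - L := by linarith
  have e1 : 2 * m / (A - L) ^ 3 * C + n * (6 * m / (A - L) ^ 4) ≤ c * (m / (A - L) ^ 2) ^ 2 := by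
    have h1 : 2 * m / (A - L) ^ 3 * C + n * (6 * m / (A - L) ^ 4)
        = m * (2 * C * (A - L) + 6 * n) / (A - L) ^ 4 := by
      field_simp
    have h2 : c * (m / (A - L) ^ 2) ^ 2 = m * (c * m) / (A - L) ^ 4 := by
      field_simp
    rw [h1, h2, hmc]
    have h3 : 0 ≤ C * L := by positivity
    refine div_le_div_of_nonneg_right (mul_le_mul_of_nonneg_left ?_ hm.le) (by positivity)
    linarith
  have hb0 : 0 < m / (A - L) ^ 2 := by positivity
  have hb₁0 : 0 < 2 * m / (A - L) ^ 3 := by positivity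
  generalize m / (A - L) ^ 2 = b₀ at *
  generalize 2 * m / (A - L) ^ 3 = b₁ at *
  generalize 6 * m / (A - L) ^ 4 = b₂ at *
  have e2 : b₁ * (S + d / 2) ≤ b₁ * C := by gcongr
  have hP0 : 0 ≤ P := hb₁0.le.trans hP
  have e3 : (2 * n + 1) * (b₁ * (e * L)) ≤ (2 * n + 1) * (P * (e * A)) := by gcongr
  have e4 : b₀ ^ 2 + M ^ 2 / 4 ≤ f ^ 2 := by nlinarith
  have e5 := mul_le_mul_of_nonneg_left e4 hc.le
  have e6 : 0 < c * M ^ 2 := by positivity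
  linarith

theorem exists_augPath_const (B : Vec n → Bil n) (x : Vec n) :
    ∃ γ v ℓ, AugPath B x γ v ℓ ∧ γ 1 = x ∧ ℓ 1 = 1 :=
  ⟨fun s => x + s • (0 : Vec n), fun _ => 0, fun s => s,
    ⟨IsPath.line x 0, by simp, rfl, fun s _ =>
      (hasDerivWithinAt_id s _).congr_deriv (by simp [augSpeed])⟩, by simp, rfl⟩

namespace FlowData

variable {B : Vec n × ℝ → Bil n} {Γ : Vec n × ℝ → Conn n} (h : FlowData T B Γ) {x₀ : Vec n}
include h

theorem confined (hT : 0 < T) (hcomp : ∀ t ∈ Icc 0 T, PathComplete fun y => B (y, t))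
    (x₀ : Vec n) : Confined T B x₀ := by
  intro A hA
  set B' : ℝ → Vec n → Bil n := fun t y => B (y, projIcc 0 T hT.le t) with hB'
  have c : Continuous fun p : ℝ × Vec n => B' p.1 p.2 :=
    h.smooth_B.continuousOn.comp_continuous (f := fun p : ℝ × Vec n =>
      (p.2, (projIcc 0 T hT.le p.1 : ℝ)))
      (continuous_snd.prodMk (continuous_subtype_val.comp (continuous_projIcc.comp continuous_fst)))
      fun p => ⟨mem_univ _, (projIcc 0 T hT.le p.1).2⟩
  obtain ⟨ρ, hρ⟩ := exists_ball_forall_path c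
    (fun t x v hv => h.pos (p := (x, _)) (projIcc 0 T hT.le t).2 hv)
    (fun t => hcomp _ (projIcc 0 T hT.le t).2) (isCompact_Icc (a := 0) (b := T)) x₀ hA
  refine ⟨ρ, fun t ht γ v ℓ hp s hs hℓ => ?_⟩
  have e : B' t = fun y => B (y, t) := by
    funext y
    simp only [hB', projIcc_of_mem hT.le ht]
  obtain ⟨ℓ₀, h₀⟩ := hp.path.exists_arcLength (h.continuous_B ht)
  obtain ⟨γ', v', ℓ', hγ', hℓ', e0, e1, e2⟩ := reach_subpath hp.path h₀ le_rfl hs.1 hs.2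
  have := hρ t ht γ' v' ℓ' hγ' (by rw [e]; exact hℓ') (e0.trans hp.start) ?_ 1 one_mem_unit
  · rwa [e1] at this
  · rw [e2, h₀.1, sub_zero]
    exact (hp.arcLength_le h₀ hs).trans_lt hℓ

set_option maxHeartbeats 1000000 in
/-- A localised maximum principle along a Ricci flow. -/
theorem le_barrier (hT : 0 < T) (hconf : Confined T B x₀) {f : Vec n × ℝ → ℝ}
    (hf : ContDiffOn ℝ (⊤ : ℕ∞) f (slab n T)) (hf0 : ∀ x, f (x, 0) ≤ 0) {c : ℝ} (hc : 0 < c)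
    (hsub : ∀ x, ∀ t ∈ Ioo 0 T, ∀ F, IsFrame (B (x, t)) F → 0 < f (x, t) →
      c * f (x, t) ^ 2 ≤ lapOf (Γ (x, t)) (fun y => f (y, t)) F x - deriv (fun s => f (x, s)) t)
    {t₀ : ℝ} (ht₀ : t₀ ∈ Ioo 0 T) :
    ∃ C, 0 ≤ C ∧ ∀ A, 1 < A → f (x₀, t₀) ≤ (2 * C * A + 6 * n + 1) / c / (A - 1) ^ 2 := by
  obtain ⟨C, hC, hcmp⟩ := h.exists_comparison hT hconf
  refine ⟨C, hC, fun A hA => ?_⟩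
  set m := (2 * C * A + 6 * n + 1) / c with hm
  have hA0 : 0 < A := one_pos.trans hA
  have hm0 : 0 < m := by positivity
  have hmc : c * m = 2 * C * A + 6 * n + 1 := by rw [hm]; field_simp
  by_contra! hcon
  obtain ⟨ρ, hρ⟩ := hconf A hA0
  set K := Metric.closedBall x₀ ρ with hK
  have hKc : IsCompact K := isCompact_closedBall x₀ ρ
  have hKT : K ×ˢ Icc 0 t₀ ⊆ slab n T :=
    prod_mono (subset_univ _) (Icc_subset_Icc_right ht₀.2.le)
  obtain ⟨U, hU⟩ := (hKc.prod (isCompact_Icc (a := 0) (b := t₀))).exists_bound_of_continuousOn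
    (hf.continuousOn.mono hKT)
  have h0T : ∀ t ∈ Icc 0 t₀, t ∈ Icc 0 T := fun t ht => ⟨ht.1, ht.2.trans ht₀.2.le⟩
  have hmem : ∀ t ∈ Icc 0 t₀, ∀ γ v ℓ, AugPath (fun y => B (y, t)) x₀ γ v ℓ → ℓ 1 < A →
      γ 1 ∈ K ∧ f (γ 1, t) ≤ U ∧ 1 ≤ ℓ 1 := by
    intro t ht γ v ℓ hp hℓ
    have h1 : γ 1 ∈ K :=
      Metric.ball_subset_closedBall (hρ t (h0T t ht) γ v ℓ hp 1 one_mem_unit hℓ)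
    exact ⟨h1, (le_abs_self _).trans (hU (γ 1, t) ⟨h1, ht⟩),
      hp.id_le (fun x v => h.nonneg (p := (x, t)) (h0T t ht) v) one_mem_unit⟩
  set S : Set ℝ := {y | ∃ t ∈ Icc 0 t₀, ∃ γ v ℓ, AugPath (fun y => B (y, t)) x₀ γ v ℓ ∧ ℓ 1 < A ∧
    y = f (γ 1, t) - m / (A - ℓ 1) ^ 2} with hS
  have hSb : BddAbove S := by
    refine ⟨U, ?_⟩
    rintro y ⟨t, ht, γ, v, ℓ, hp, hℓ, rfl⟩
    have := (hmem t ht γ v ℓ hp hℓ).2.1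
    have : 0 ≤ m / (A - ℓ 1) ^ 2 := by positivity
    linarith
  have hle : ∀ t ∈ Icc 0 t₀, ∀ γ v ℓ, AugPath (fun y => B (y, t)) x₀ γ v ℓ → ∀ r, ℓ 1 ≤ r →
      r < A → f (γ 1, t) ≤ sSup S + m / (A - r) ^ 2 := by
    intro t ht γ v ℓ hp r hr hrA
    have h1 := le_csSup hSb ⟨t, ht, γ, v, ℓ, hp, hr.trans_lt hrA, rfl⟩
    have h2 := div_sub_sq_le_div_sub_sq hm0.le hr hrA
    linarith
  set M := sSup S with hMdef
  obtain ⟨γ₀, v₀, ℓ₀, hp₀, hγ₀, hℓ₀⟩ := exists_augPath_const (fun y => B (y, t₀)) x₀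
  have hS₀ : f (x₀, t₀) - m / (A - 1) ^ 2 ∈ S :=
    ⟨t₀, ⟨ht₀.1.le, le_rfl⟩, γ₀, v₀, ℓ₀, hp₀, by rw [hℓ₀]; exact hA, by rw [hγ₀, hℓ₀]⟩
  have hM : 0 < M := lt_of_lt_of_le (by linarith) (le_csSup hSb hS₀)
  have hU0 : 0 < U := by
    have h1 := (hmem t₀ ⟨ht₀.1.le, le_rfl⟩ γ₀ v₀ ℓ₀ hp₀ (by rw [hℓ₀]; exact hA)).2.1
    rw [hγ₀] at h1
    have : 0 ≤ m / (A - 1) ^ 2 := by positivity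
    linarith
  -- near-maximisers stay away from the initial time
  obtain ⟨δ, hδ, hδt⟩ : ∃ δ > 0, ∀ x ∈ K, ∀ t ∈ Icc 0 t₀, M / 2 < f (x, t) → δ ≤ t := by
    have huc := (hKc.prod (isCompact_Icc (a := 0) (b := t₀))).uniformContinuousOn_of_continuous
      (hf.continuousOn.mono hKT)
    obtain ⟨δ, hδ, hd⟩ := Metric.uniformContinuousOn_iff.1 huc (M / 2) (by linarith)
    refine ⟨δ, hδ, fun x hx t ht hft => ?_⟩
    by_contra! htδ
    have h1 := hd (x, t) ⟨hx, ht⟩ (x, 0) ⟨hx, le_rfl, ht₀.1.le⟩ (by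
      rw [Prod.dist_eq, dist_self, max_eq_right dist_nonneg, Real.dist_eq, sub_zero,
        abs_of_nonneg ht.1]
      exact htδ)
    rw [Real.dist_eq] at h1
    have := (abs_lt.1 h1).2
    linarith [hf0 x]
  set κ := Real.sqrt (m / U) with hκdef
  have hκ : 0 < κ := Real.sqrt_pos.2 (by positivity)
  have hκ2 : κ ^ 2 = m / U := Real.sq_sqrt (by positivity)
  set P := 2 * m / κ ^ 3 with hP
  have hP0 : 0 < P := by positivity
  set Q := (2 * n + 1) * (A * P) + 6 * n + 3 with hQ
  have hQ0 : 0 < Q := by positivity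
  set e := c * M ^ 2 / (8 * Q) with he
  have he0 : 0 < e := by positivity
  have heQ : e * Q = c * M ^ 2 / 8 := by rw [he]; field_simp
  obtain ⟨ε₁, hε₁, D, hD⟩ := hcmp A hA δ t₀ e hδ ht₀.2 he0
  have hKδ : K ×ˢ Icc δ t₀ ⊆ slab n T :=
    prod_mono (subset_univ _) (Icc_subset_Icc hδ.le ht₀.2.le)
  obtain ⟨ρ', hρ'⟩ := h.exists_norm_le (hKc.prod (isCompact_Icc (a := δ) (b := t₀))) hKδ
  obtain ⟨ε₂, hε₂, hX⟩ := uniform_taylor_varPoint h.smooth_Γ hf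
    (Z := K ×ˢ (Icc δ t₀ ×ˢ Metric.closedBall 0 ρ'))
    (hKc.prod (isCompact_Icc.prod (isCompact_closedBall 0 ρ')))
    (fun z hz => ⟨hδ.trans_le hz.2.1.1, hz.2.1.2.trans_lt ht₀.2⟩) he0
  obtain ⟨ε₃, hε₃, hτ⟩ := uniform_taylor_time hf (Z := K ×ˢ Icc δ t₀) (hKc.prod isCompact_Icc)
    (fun z hz => ⟨hδ.trans_le hz.2.1, hz.2.2.trans_lt ht₀.2⟩) he0
  set D' := |D| + 2 * e * A with hD'
  have hD0 : 0 ≤ D' := by positivity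
  obtain ⟨ε₄, hε₄, hb⟩ := exists_taylor_barrier m A κ D' hκ he0
  obtain ⟨ε, hε, l1, l2, l3, l4, l5, l6, l7⟩ : ∃ ε > 0, ε ≤ ε₁ ∧ ε ≤ ε₂ ∧ ε ≤ ε₃ ∧ ε ≤ ε₄ ∧ ε ≤ 1 ∧
      ε ≤ δ ∧ ε ≤ κ / (2 + D') := by
    refine ⟨min ε₁ (min ε₂ (min ε₃ (min ε₄ (min 1 (min δ (κ / (2 + D'))))))), by positivity, ?_⟩
    simp only [min_le_iff, le_refl, true_or, or_true, and_self]
  have hεκ : ε * (2 + D') ≤ κ := by rwa [le_div_iff₀ (by positivity)] at l7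
  obtain ⟨y, ⟨t, ht, γ, v, ℓ, hp, hℓ, rfl⟩, hy⟩ := exists_lt_of_lt_csSup ⟨_, hS₀⟩
    (show max (M - e * ε ^ 2) (M / 2) < M from
      max_lt (by have : 0 < e * ε ^ 2 := by positivity
                 linarith) (by linarith))
  have hy1 := (le_max_left _ _).trans_lt hy
  have hy2 := (le_max_right _ _).trans_lt hy
  obtain ⟨hxK, hfU, hℓ1⟩ := hmem t ht γ v ℓ hp hℓ
  set x := γ 1 with hx
  set L := ℓ 1 with hL
  have hAL : 0 < A - L := by linarith
  have hb0 : 0 < m / (A - L) ^ 2 := by positivity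
  have htδ : δ ≤ t := hδt x hxK t ht (by linarith)
  have htI : t ∈ Icc δ t₀ := ⟨htδ, ht.2⟩
  have htT : t ∈ Ioo 0 T := ⟨hδ.trans_le htδ, ht.2.trans_lt ht₀.2⟩
  have hκL : κ ≤ A - L := by
    refine Real.sqrt_le_iff.2 ⟨hAL.le, ?_⟩
    have h1 : m / (A - L) ^ 2 ≤ U := by linarith
    rw [div_le_iff₀ (by positivity)] at h1
    rw [div_le_iff₀ hU0]
    linarith
  have hLI : L ∈ Icc 1 (A - κ) := ⟨hℓ1, by linarith⟩
  obtain ⟨F, a, b, d, hF, ha, hbD, hdD, hsum, hcomp⟩ := hD t htI γ v ℓ hp hℓ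
  set b₁ := 2 * m / (A - L) ^ 3 with hb₁
  set b₂ := 6 * m / (A - L) ^ 4 with hb₂
  have hb₁0 : 0 < b₁ := by positivity
  have hb₂0 : 0 < b₂ := by positivity
  have hb₁P : b₁ ≤ P := by rw [hb₁, hP]; gcongr
  have heL : e * L ≤ e * A := by gcongr
  have heL0 : 0 ≤ e * L := by positivity
  have hβ : ∀ β, |β| ≤ D → |β + 2 * e * L| ≤ D' := by
    intro β hβ
    have h1 := abs_le.1 (hβ.trans (le_abs_self D))
    exact abs_le.2 ⟨by linarith, by linarith⟩
  have hε2 : ε ^ 2 ≤ ε := by nlinarith only [hε, l5]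
  have hlt : ∀ r a β : ℝ, |r| = ε → |a| ≤ 1 → |β| ≤ D' → L + r * a + r ^ 2 / 2 * β < A :=
    fun r a β hr ha hβ => quadratic_argument_lt (hr.le.trans l5) ha hβ hκ (hr ▸ hεκ) hLI.2
  have habs : ∀ r, |r| = ε → r ^ 2 = ε ^ 2 := fun r hr => by rw [← sq_abs, hr]
  have hFn : ∀ i, ‖F i‖ ≤ ρ' := fun i => hρ' (x, t) ⟨hxK, htI⟩ (F i) (by simpa using (hF i i).le)
  -- second derivative bound in a frame direction
  have hspace : ∀ i, fderiv ℝ (fderiv ℝ fun y => f (y, t)) x (F i) (F i)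
      - fderiv ℝ (fun y => f (y, t)) x (Γ (x, t) (F i) (F i))
      ≤ b₁ * (b i + 2 * e * L) + b₂ + 6 * e := by
    intro i
    have key : ∀ r, |r| = ε → f (x, t) + r * fderiv ℝ (fun y => f (y, t)) x (F i)
        + ε ^ 2 / 2 * (fderiv ℝ (fderiv ℝ fun y => f (y, t)) x (F i) (F i)
          - fderiv ℝ (fun y => f (y, t)) x (Γ (x, t) (F i) (F i))) - e * ε ^ 2
        ≤ M + (m / (A - L) ^ 2 + r * (b₁ * a i)
          + ε ^ 2 / 2 * (b₁ * (b i + 2 * e * L) + b₂ * a i ^ 2) + e * ε ^ 2) := by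
      intro r hr
      obtain ⟨γ', v', ℓ', hp', hγ', hℓ'⟩ := (hcomp r (hr.le.trans l1)).1 i
      have h1 := hle t ht γ' v' ℓ' hp' (L + r * a i + r ^ 2 / 2 * (b i + 2 * e * L))
        (by linarith) (hlt r _ _ hr (ha i) (hβ _ (hbD i)))
      have h2 := hb L hLI (a i) _ (ha i) (hβ _ (hbD i)) r (hr.le.trans l4)
      have h3 := (abs_le.1 (hX (x, t, F i) ⟨hxK, htI, by simpa using hFn i⟩ r (hr.le.trans l2))).1
      rw [hγ'] at h1
      simp only [habs r hr] at h1 h2 h3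
      linarith
    have k3 : b₂ * a i ^ 2 ≤ b₂ :=
      mul_le_of_le_one_right hb₂0.le ((sq_le_one_iff_abs_le_one (a i)).2 (ha i))
    have k4 := le_of_second_difference hε hy1 (key ε (abs_of_pos hε))
      (key (-ε) (by rw [abs_neg, abs_of_pos hε]))
    linarith only [k3, k4]
  have htime : - deriv (fun s => f (x, s)) t ≤ b₁ * (d + 2 * e * L) / 2 + 3 * e := by
    obtain ⟨ℓ', hp', hℓ'⟩ := (hcomp ε ((abs_of_pos hε).le.trans l1)).2
    have ht' : t - ε ^ 2 ∈ Icc 0 t₀ := ⟨by linarith, by linarith [sq_nonneg ε, ht.2]⟩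
    have h1 := hle _ ht' γ v ℓ' hp' (L + ε * 0 + ε ^ 2 / 2 * (d + 2 * e * L))
      (by linarith) (hlt ε _ _ (abs_of_pos hε) (by simp) (hβ _ hdD))
    have h2 := hb L hLI 0 _ (by simp) (hβ _ hdD) ε ((abs_of_pos hε).le.trans l4)
    have h3 := (abs_le.1 (hτ (x, t) ⟨hxK, htI⟩ ε ((abs_of_pos hε).le.trans l3))).1
    exact le_of_difference hε hy1 h3 (by linarith only [h1, h2])
  have hlap : lapOf (Γ (x, t)) (fun y => f (y, t)) F x
      ≤ b₁ * (∑ i, b i + n * (2 * e * L)) + n * b₂ + n * (6 * e) := by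
    refine (Finset.sum_le_sum fun i _ => hspace i).trans (le_of_eq ?_)
    simp only [Finset.sum_add_distrib, ← Finset.mul_sum, Finset.sum_const, Finset.card_univ,
      Fintype.card_fin, nsmul_eq_mul]
    ring
  exact barrier_contradiction hC hℓ1 hℓ hm0 hc hM he0 hmc hb₁P heQ hsum (by linarith) hlap htime
    (hsub x t htT F hF (by linarith))

theorem nonpos_of_subsolution (hT : 0 < T) (hconf : Confined T B x₀) {f : Vec n × ℝ → ℝ}
    (hf : ContDiffOn ℝ (⊤ : ℕ∞) f (slab n T)) (hf0 : ∀ x, f (x, 0) ≤ 0) {c : ℝ} (hc : 0 < c)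
    (hsub : ∀ x, ∀ t ∈ Ioo 0 T, ∀ F, IsFrame (B (x, t)) F → 0 < f (x, t) →
      c * f (x, t) ^ 2 ≤ lapOf (Γ (x, t)) (fun y => f (y, t)) F x - deriv (fun s => f (x, s)) t)
    {t₀ : ℝ} (ht₀ : t₀ ∈ Ioo 0 T) : f (x₀, t₀) ≤ 0 := by
  obtain ⟨C, hC, hle⟩ := h.le_barrier hT hconf hf hf0 hc hsub ht₀
  by_contra! hpos
  set δ := f (x₀, t₀)
  set D : ℝ := 4 * C + 6 * n + 1 with hD
  have hD0 : 0 < D := by positivity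
  set s := 1 + D / (c * δ) with hs
  have hs0 : 0 < D / (c * δ) := by positivity
  have h1 := hle (1 + s) (by linarith)
  rw [add_sub_cancel_left, div_div, le_div_iff₀ (by positivity)] at h1
  have h2 : c * δ * s = c * δ + D := by rw [hs]; field_simp
  have h3 : 2 * C * (1 + s) + 6 * n + 1 ≤ D * s := by
    have h4 : 0 ≤ (2 * C + 6 * n + 1) * (s - 1) := by
      have : 0 ≤ s - 1 := by linarith
      positivity
    rw [hD]
    linarith
  have h5 : δ * (c * s ^ 2) = (c * δ + D) * s := by rw [← h2]; ring
  have h6 : 0 < c * δ * s := by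
    have : 0 < s := by linarith
    positivity
  linarith

end FlowData

end MaximumPrinciple

section ScalarCurvatureBound

variable {n : ℕ}

theorem lapOf_neg_sub_const (Γ : Conn n) (f : Vec n → ℝ) (a : ℝ) (F : Fin n → Vec n) (x : Vec n) :
    lapOf Γ (fun y => -f y - a) F x = -lapOf Γ f F x := by
  have h1 : fderiv ℝ (fun y => -f y - a) = -fderiv ℝ f := by
    funext y
    rw [fderiv_sub_const, fderiv_fun_neg, Pi.neg_apply]
  simp only [lapOf, h1, fderiv_neg, Pi.neg_apply, neg_apply,
    ← Finset.sum_neg_distrib]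
  refine Finset.sum_congr rfl fun k _ => ?_
  ring

/-- The solution of the comparison equation `ψ' = -(2/n) ψ²` with `ψ 0 = K`. -/
theorem hasDerivAt_comparison {N K t : ℝ} (ht : 2 * t + N / K ≠ 0) :
    HasDerivAt (fun s => N / (2 * s + N / K)) (-(2 / N) * (N / (2 * t + N / K)) ^ 2) t := by
  have h1 : HasDerivAt (fun s : ℝ => 2 * s + N / K) (2 * 1) t :=
    ((hasDerivAt_id t).const_mul 2).add_const _
  refine ((hasDerivAt_const t N).fun_div h1 ht).congr_deriv ?_
  field_simp
  ring

namespace FlowData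

variable {T : ℝ} {B : Vec n × ℝ → Bil n} {Γ : Vec n × ℝ → Conn n} (h : FlowData T B Γ)
include h

theorem neg_le_scal_of_mem_Ioo (hn : 0 < n) (hT : 0 < T)
    (hcomp : ∀ t ∈ Icc 0 T, PathComplete fun y => B (y, t)) {K : ℝ} (hK : 0 < K)
    (hinit : ∀ x, -K ≤ scalST B Γ (x, 0)) (x : Vec n) {t : ℝ} (ht : t ∈ Ioo 0 T) :
    -(n / (2 * t + n / K)) ≤ scalST B Γ (x, t) := by
  have hN : (0:ℝ) < n := by exact_mod_cast hn
  have hpos : ∀ t : ℝ, 0 ≤ t → 0 < 2 * t + n / K := fun t ht => by positivity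
  have hsmooth : ContDiffOn ℝ (⊤ : ℕ∞)
      (fun p : Vec n × ℝ => -scalST B Γ p - n / (2 * p.2 + n / K)) (slab n T) := by
    refine (h.smooth_scal hT).neg.sub (contDiffOn_const.div ?_ fun p hp => (hpos _ hp.2.1).ne')
    exact ContDiff.contDiffOn (by fun_prop)
  have hmax := h.nonpos_of_subsolution hT (h.confined hT hcomp x) hsmooth ?_
    (c := 2 / n) (by positivity) ?_ ht
  · simp only at hmax
    linarith
  · intro y
    have : (n : ℝ) / (2 * 0 + n / K) = K := by field_simp; simp
    simp only [this]
    linarith [hinit y]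
  · intro y s hs F hF hf
    have hS : DifferentiableAt ℝ (fun r => scalST B Γ (y, r)) s :=
      (h.evolution hT hs hF).differentiableAt
    have hψ := hasDerivAt_comparison (K := K) (hpos s hs.1.le).ne'
    have hd := (hS.hasDerivAt.fun_neg.fun_sub hψ).deriv
    have he := h.evolution_ge hT hs hF
    have hψ0 : (0:ℝ) < n / (2 * s + n / K) := div_pos hN (hpos s hs.1.le)
    simp only [lapOf_neg_sub_const (Γ (y, s)) (fun y => scalST B Γ (y, s)), hd] at hf ⊢
    generalize (n : ℝ) / (2 * s + n / K) = ψ at *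
    have hsq : (-scalST B Γ (y, s) - ψ) ^ 2 ≤ scalST B Γ (y, s) ^ 2 - ψ ^ 2 := by nlinarith
    have := mul_le_mul_of_nonneg_left hsq (show (0:ℝ) ≤ 2 / n by positivity)
    linarith

theorem neg_le_scal (hn : 0 < n) (hT : 0 < T)
    (hcomp : ∀ t ∈ Icc 0 T, PathComplete fun y => B (y, t)) {K : ℝ} (hK : 0 < K)
    (hinit : ∀ x, -K ≤ scalST B Γ (x, 0)) (x : Vec n) {t : ℝ} (ht : t ∈ Icc 0 T) :
    -(n / (2 * t + n / K)) ≤ scalST B Γ (x, t) := by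
  have hN : (0:ℝ) < n := by exact_mod_cast hn
  have hpos : ∀ t : ℝ, 0 ≤ t → 2 * t + n / K ≠ 0 := fun t ht => by positivity
  rw [← closure_Ioo hT.ne] at ht
  refine le_on_closure (fun s hs => h.neg_le_scal_of_mem_Ioo hn hT hcomp hK hinit x hs) ?_ ?_ ht
  · rw [closure_Ioo hT.ne]
    exact (continuousOn_const.div (by fun_prop) fun s hs => hpos s hs.1).neg
  · rw [closure_Ioo hT.ne]
    exact (h.smooth_scal hT).continuousOn.comp (by fun_prop) fun s hs => ⟨mem_univ _, hs⟩

end FlowData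

end ScalarCurvatureBound

end Proof

/-- Lower bound for the scalar curvature of any complete Ricci flow
(Corollary 2.3 (i)). -/
theorem stmt_4 (n : ℕ) (hn : 2 ≤ n) (T K : ℝ) (hT : 0 < T) (hK : 0 < K)
    (g : (Fin n → ℝ) → ℝ → Matrix (Fin n) (Fin n) ℝ)
    (hg : SmoothMetricFamily g (Icc 0 T)) (hflow : IsRicciFlow g (Icc 0 T))
    (hcomplete : ∀ t ∈ Icc (0:ℝ) T, riemComplete (fun x => g x t))
    (hinit : ∀ x, -K ≤ scalarCurv (fun y => g y 0) x) :
    ∀ x, ∀ t ∈ Icc (0:ℝ) T, -((n:ℝ)/(2*t + (n:ℝ)/K)) ≤ scalarCurv (fun y => g y t) x := by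
  intro x t ht
  have h := flowData_of_ricciFlow hT hg hflow
  rw [← scalST_eq_scalarCurv hT hg x ht]
  refine h.neg_le_scal (by omega) hT (fun s hs => ?_) hK (fun y => ?_) x ht
  · exact pathComplete_of_riemComplete (h.continuous_B hs) (hcomplete s hs)
  · rw [scalST_eq_scalarCurv hT hg y ⟨le_rfl, hT.le⟩]
    exact hinit y

end
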